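/- There exists a Borel probability measure μ* on X with supp(μ*) = J̃ such that for every point (w₀,z₀) ∈ J̃ the sequence of measures (μ_n^{(w₀,z₀)})_{n≥1} converges to μ* in the weak* topology; in particular the limit measure μ* is independent of the chosen point (w₀,z₀) ∈ J̃. -/

import Mathlib

open MeasureTheory Filter Topology Polynomial
open scoped OnePoint Classical ENNReal

noncomputable section

namespace SkewRational

/-- The Riemann sphere, modelled as the one-point compactification of `ℂ`. -/
abbrev Sphere : Type := OnePoint ℂ

/-- The product space `X = Σ_N⁺ × ℂ̂`. -/
abbrev SymX (N : ℕ) : Type := (ℕ → Fin N) × Sphere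

variable {N : ℕ}

/-- The left shift on `Σ_N⁺`. -/
def shiftW (w : ℕ → Fin N) : ℕ → Fin N := fun n => w (n + 1)

/-- Prepending a letter to an infinite word. -/
def consW (v : Fin N) (w : ℕ → Fin N) : ℕ → Fin N := fun n => if n = 0 then v else w (n - 1)

/-- Evaluation of the rational map `P/Q` (in irreducible form) on the Riemann sphere. -/
def ratEval (P Q : ℂ[X]) : Sphere → Sphere := fun z =>
  OnePoint.elim z
    (if Q.natDegree < P.natDegree then (OnePoint.infty : Sphere)
     else if P.natDegree < Q.natDegree then ((0 : ℂ) : Sphere)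
     else ((P.leadingCoeff / Q.leadingCoeff : ℂ) : Sphere))
    (fun a => if Q.eval a = 0 then (OnePoint.infty : Sphere) else ((P.eval a / Q.eval a : ℂ) : Sphere))

/-- The multiset of preimages (with multiplicity) of a point of the sphere under `P/Q`. -/
def fiber (P Q : ℂ[X]) (a : Sphere) : Multiset Sphere :=
  OnePoint.elim a
    ((Q.roots.map fun z => (z : Sphere)) +
      Multiset.replicate (max P.natDegree Q.natDegree - Q.natDegree) (OnePoint.infty : Sphere))
    (fun b =>
      (((P - Polynomial.C b * Q).roots.map fun z => (z : Sphere)) +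
        Multiset.replicate
          (max P.natDegree Q.natDegree - (P - Polynomial.C b * Q).natDegree) (OnePoint.infty : Sphere)))

variable (p q : Fin N → ℂ[X])

/-- The degree `d_i` of the rational map `R_i = p i / q i`. -/
def degR (i : Fin N) : ℕ := max (p i).natDegree (q i).natDegree

/-- `D = d₁ + ⋯ + d_N`. -/
def Dtot : ℕ := ∑ i, degR p q i

/-- Standing assumptions: `N ≥ 1`, each `R_i = p i / q i` in irreducible form, all degrees
at least `1`, and at least one degree at least `2`. -/
def Good : Prop :=
  1 ≤ N ∧ (∀ i, IsCoprime (p i) (q i)) ∧ (∀ i, 1 ≤ degR p q i) ∧ (∃ i, 2 ≤ degR p q i)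

/-- The skew-product map `T(w, z) = (σ w, R_{w 0} z)`. -/
def Tmap : SymX N → SymX N := fun x => (shiftW x.1, ratEval (p (x.1 0)) (q (x.1 0)) x.2)

/-- The multiset of preimages of a point under `T`, counted with multiplicity. -/
def preimT (x : SymX N) : Multiset (SymX N) :=
  ∑ v : Fin N, (fiber (p v) (q v) x.2).map fun z => (consW v x.1, z)

/-- The multiset of `n`-th order preimages under `T^n`, counted with multiplicity. -/
def preimTn : ℕ → SymX N → Multiset (SymX N)
  | 0, x => {x}
  | n + 1, x => (preimT p q x).bind fun y => preimTn n y

/-- The chordal (spherical) metric on the Riemann sphere. -/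
def sphDist : Sphere → Sphere → ℝ := fun z w =>
  OnePoint.elim z
    (OnePoint.elim w 0 fun b => 2 / Real.sqrt (1 + ‖b‖ ^ 2))
    (fun a =>
      OnePoint.elim w (2 / Real.sqrt (1 + ‖a‖ ^ 2))
        (fun b => 2 * dist a b / (Real.sqrt (1 + ‖a‖ ^ 2) * Real.sqrt (1 + ‖b‖ ^ 2))))

/-- The metric `d(w, w') = 2^{-n(w,w')}` on `Σ_N⁺`. -/
def shiftDist (w w' : ℕ → Fin N) : ℝ :=
  if h : ∃ n, w n ≠ w' n then (2 : ℝ)⁻¹ ^ (Nat.find h + 1) else 0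

/-- The metric on `X`: maximum of the two coordinate metrics. -/
def dX : SymX N → SymX N → ℝ := fun x y => max (shiftDist x.1 y.1) (sphDist x.2 y.2)

/-- Montel normality of a family of self-maps of the sphere on a set `U`. -/
def NormalOn (F : Set (Sphere → Sphere)) (U : Set Sphere) : Prop :=
  ∀ s : ℕ → Sphere → Sphere, (∀ n, s n ∈ F) →
    ∃ φ : ℕ → ℕ, StrictMono φ ∧ ∃ g : Sphere → Sphere,
      ∀ K : Set Sphere, K ⊆ U → IsCompact K → ∀ ε : ℝ, 0 < ε →
        ∀ᶠ n in atTop, ∀ z ∈ K, sphDist (s (φ n) z) (g z) < ε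

/-- The compositions `R_{w (n-1)} ∘ ⋯ ∘ R_{w 0}`. -/
def itComp (w : ℕ → Fin N) : ℕ → Sphere → Sphere
  | 0 => id
  | n + 1 => ratEval (p (w n)) (q (w n)) ∘ itComp w n

/-- The fibrewise Fatou set `F_w`. -/
def fatouW (w : ℕ → Fin N) : Set Sphere :=
  {z | ∃ U : Set Sphere, IsOpen U ∧ z ∈ U ∧
    NormalOn {g | ∃ n, 1 ≤ n ∧ g = itComp p q w n} U}

/-- The fibrewise Julia set `J_w`. -/
def juliaW (w : ℕ → Fin N) : Set Sphere := (fatouW p q w)ᶜ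

/-- The Julia set `J̃` of the skew-product map `T`. -/
def juliaSet : Set (SymX N) :=
  closure (⋃ w : ℕ → Fin N, {w} ×ˢ juliaW p q w)

/-- The critical points of `T`: `(w, z)` with `z` a critical point of `R_{w 0}`. -/
def critSet : Set (SymX N) :=
  {x | 2 ≤ (fiber (p (x.1 0)) (q (x.1 0))
        (ratEval (p (x.1 0)) (q (x.1 0)) x.2)).count x.2}

/-- Assumption (A1): no super-attracting periodic point of `T` lies in the Julia set
(a periodic point is super-attracting exactly when its orbit meets the critical set,
i.e. the derivative of the return composition vanishes). -/
def NoSuperAttract : Prop :=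
  ∀ x ∈ juliaSet p q, ∀ m : ℕ, 1 ≤ m → (Tmap p q)^[m] x = x →
    ∀ k < m, (Tmap p q)^[k] x ∉ critSet p q

instance : MeasurableSpace (SymX N) := borel _
instance : BorelSpace (SymX N) := ⟨rfl⟩

instance : MeasurableSpace ↥(juliaSet p q) := borel _
instance : BorelSpace ↥(juliaSet p q) := ⟨rfl⟩

/-! ### Fixed points counted with multiplicity -/

/-- Formal composition of rational maps as pairs of polynomials: `compPair a b = a ∘ b`. -/
def compPair (a b : ℂ[X] × ℂ[X]) : ℂ[X] × ℂ[X] :=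
  (∑ i ∈ Finset.range (max a.1.natDegree a.2.natDegree + 1),
      Polynomial.C (a.1.coeff i) * b.1 ^ i * b.2 ^ (max a.1.natDegree a.2.natDegree - i),
   ∑ i ∈ Finset.range (max a.1.natDegree a.2.natDegree + 1),
      Polynomial.C (a.2.coeff i) * b.1 ^ i * b.2 ^ (max a.1.natDegree a.2.natDegree - i))

/-- For a word `[v₁, …, v_m]`, the composite `R_{v_m} ∘ ⋯ ∘ R_{v₁}` as a pair of
polynomials. -/
def wordPair : List (Fin N) → ℂ[X] × ℂ[X]
  | [] => (Polynomial.X, 1)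
  | v :: t => compPair (wordPair t) (p v, q v)

/-- The multiset of fixed points (with multiplicity) on the sphere of the rational map given
by a pair of polynomials; a degree-`k` map has `k + 1` fixed points with multiplicity. -/
def fixMul (a : ℂ[X] × ℂ[X]) : Multiset Sphere :=
  ((a.1 - Polynomial.X * a.2).roots.map fun z => (z : Sphere)) +
    Multiset.replicate
      (max a.1.natDegree a.2.natDegree + 1 - (a.1 - Polynomial.X * a.2).natDegree) (OnePoint.infty : Sphere)

/-- The periodic word `(v₁ ⋯ v_m v₁ ⋯ v_m ⋯)`. -/
def perW {m : ℕ} (hm : 0 < m) (v : Fin m → Fin N) : ℕ → Fin N :=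
  fun n => v ⟨n % m, Nat.mod_lt n hm⟩

/-- The multiset `Fix_m(T)` of fixed points of `T^m`, counted with multiplicity. -/
def fixMultiset (m : ℕ) : Multiset (SymX N) :=
  if hm : 0 < m then
    ∑ v : Fin m → Fin N, (fixMul (wordPair p q (List.ofFn v))).map fun z => (perW hm v, z)
  else 0

/-! ### Thermodynamic formalism -/

/-- The ergodic (Birkhoff) sum `f^n`. -/
def birk (f : SymX N → ℝ) (n : ℕ) (y : SymX N) : ℝ :=
  ∑ k ∈ Finset.range n, f ((Tmap p q)^[k] y)

/-- `(L_f^n 1)(x) = Σ_{T^n y = x} e^{f^n(y)}`. -/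
def LSum (f : SymX N → ℝ) (n : ℕ) (x : SymX N) : ℝ :=
  ((preimTn p q n x).map fun y => Real.exp (birk p q f n y)).sum

/-- The pressure `P(f) = sup_{x ∈ J̃} limsup (1/n) log (L_f^n 1)(x)`. -/
def pressure (f : SymX N → ℝ) : ℝ :=
  ⨆ x : ↥(juliaSet p q), limsup (fun n : ℕ => (n : ℝ)⁻¹ * Real.log (LSum p q f n ↑x)) atTop

/-- Extension by zero of a function on `J̃` to all of `X`; since `T⁻¹ J̃ = J̃`, the values
outside `J̃` are irrelevant in all expressions below. -/
def jextend (f : ↥(juliaSet p q) → ℝ) : SymX N → ℝ :=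
  fun x => if hx : x ∈ juliaSet p q then f ⟨x, hx⟩ else 0

/-- Hölder continuity on `J̃` with respect to the metric `d_X`. -/
def HolderOnJ (f : ↥(juliaSet p q) → ℝ) : Prop :=
  ∃ C : ℝ, 0 < C ∧ ∃ α : ℝ, α ∈ Set.Ioc (0 : ℝ) 1 ∧
    ∀ x y : ↥(juliaSet p q), |f x - f y| ≤ C * dX (x : SymX N) (y : SymX N) ^ α

/-- `Q(g) = P(f + g) − P(f)`. -/
def Qfun (f g : ↥(juliaSet p q) → ℝ) : ℝ :=
  pressure p q (jextend p q fun x => f x + g x) - pressure p q (jextend p q f)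

/-- The Legendre transform `L(m) = sup_g (∫ g dm − Q(g)) ∈ [0, (OnePoint.infty : Sphere)]`. -/
def LLfun (f : ↥(juliaSet p q) → ℝ) (m : ProbabilityMeasure ↥(juliaSet p q)) : EReal :=
  ⨆ g : C(↥(juliaSet p q), ℝ),
    (((∫ x, g x ∂(m : Measure ↥(juliaSet p q))) - Qfun p q f g : ℝ) : EReal)

/-- `ρ(K) = inf_{m ∈ K} L(m)`. -/
def rho (f : ↥(juliaSet p q) → ℝ) (K : Set (ProbabilityMeasure ↥(juliaSet p q))) : EReal :=
  ⨅ m ∈ K, LLfun p q f m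

/-- Membership in `M_T`: `T`-invariance of a probability measure on `J̃`. -/
def MTinv (m : ProbabilityMeasure ↥(juliaSet p q)) : Prop :=
  ∀ A : Set (SymX N), MeasurableSet A →
    ((m : Measure ↥(juliaSet p q)).map Subtype.val) (Tmap p q ⁻¹' A) =
      ((m : Measure ↥(juliaSet p q)).map Subtype.val) A

/-- The orbital measure `μ_{y,n} = (1/n)(δ_y + δ_{Ty} + ⋯ + δ_{T^{n-1}y})`, viewed as a
measure on `J̃`. -/
def orbMeas (y : SymX N) (n : ℕ) : Measure ↥(juliaSet p q) :=
  Measure.comap Subtype.val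
    ((n : ℝ≥0∞)⁻¹ • ∑ k ∈ Finset.range n, Measure.dirac ((Tmap p q)^[k] y))

/-- The (unique, if it exists) probability-measure avatar of `μ` lies in `K`. -/
def inK (μ : Measure ↥(juliaSet p q)) (K : Set (ProbabilityMeasure ↥(juliaSet p q))) : Prop :=
  ∃ ν : ProbabilityMeasure ↥(juliaSet p q), (ν : Measure ↥(juliaSet p q)) = μ ∧ ν ∈ K

/-- The sequence `(1/n) log [Σ_{T^n y = x, μ_{y,n} ∈ K} e^{f^n(y)} / Σ_{T^n y = x} e^{f^n(y)}]`,
valued in `EReal` with the convention `log 0 = ⊥`. -/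
def preimLDSeq (f : ↥(juliaSet p q) → ℝ) (x : SymX N)
    (K : Set (ProbabilityMeasure ↥(juliaSet p q))) : ℕ → EReal := fun n =>
  if (((preimTn p q n x).filter fun y => inK p q (orbMeas p q y n) K).map
        fun y => Real.exp (birk p q (jextend p q f) n y)).sum = 0 then ⊥
  else
    (((n : ℝ)⁻¹ * Real.log
      (((((preimTn p q n x).filter fun y => inK p q (orbMeas p q y n) K).map
          fun y => Real.exp (birk p q (jextend p q f) n y)).sum) /
        LSum p q (jextend p q f) n x) : ℝ) : EReal)

/-- `Fix_m(T) ∩ J̃` as a multiset. -/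
def fixJ (m : ℕ) : Multiset (SymX N) := (fixMultiset p q m).filter fun y => y ∈ juliaSet p q

/-- `Σ_{(ω,ζ) ∈ Fix_m(T) ∩ J̃} e^{f^m(ω,ζ)}`. -/
def fixSum (f : SymX N → ℝ) (m : ℕ) : ℝ :=
  ((fixJ p q m).map fun y => Real.exp (birk p q f m y)).sum

/-- The periodic-point analogue of `preimLDSeq`, with the convention `log 0 = ⊥`. -/
def fixLDSeq (f : ↥(juliaSet p q) → ℝ)
    (K : Set (ProbabilityMeasure ↥(juliaSet p q))) : ℕ → EReal := fun m =>
  if (((fixJ p q m).filter fun y => inK p q (orbMeas p q y m) K).map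
        fun y => Real.exp (birk p q (jextend p q f) m y)).sum = 0 then ⊥
  else
    (((m : ℝ)⁻¹ * Real.log
      (((((fixJ p q m).filter fun y => inK p q (orbMeas p q y m) K).map
          fun y => Real.exp (birk p q (jextend p q f) m y)).sum) /
        fixSum p q (jextend p q f) m) : ℝ) : EReal)

/-! ### Inverse branches -/

/-- Projection of a subset of `X` to the sphere coordinate. -/
def projC (E : Set (SymX N)) : Set Sphere := Prod.snd '' E

/-- For a word `[v₁, …, v_m]`, the composite map `R_{v₁} ∘ R_{v₂} ∘ ⋯ ∘ R_{v_m}`. -/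
def mapWord (l : List (Fin N)) : Sphere → Sphere :=
  l.foldr (fun i f => ratEval (p i) (q i) ∘ f) id

/-- `γ_m(U)`: the total number of analytic inverse branches of `T^m` on `U`, counted over
all `m`-strings.  (A continuous section of a rational map off its critical values is
automatically holomorphic.) -/
def gammaCount (U : Set (SymX N)) (m : ℕ) : ℕ :=
  Nat.card ((v : Fin m → Fin N) ×
    { s : C(↥(projC U), Sphere) // ∀ z : ↥(projC U), mapWord p q (List.ofFn v) (s z) = ↑z })

/-- `C_n = ⋃_{k=1}^n T^k(C)`, the critical values of `T` of order up to `n`. -/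
def critValSet (n : ℕ) : Set (SymX N) :=
  ⋃ k ∈ Finset.Icc 1 n, (Tmap p q)^[k] '' critSet p q

/-- `τ`: the number of distinct critical values of `T` in `U` (projected to the sphere). -/
def tauCount (U : Set (SymX N)) : ℕ := (Prod.snd '' (Tmap p q '' critSet p q ∩ U)).ncard

/-! ### The averaging operator `G` -/

/-- `(G^m h)(x) = D^{-m} Σ_{T^m y = x} h(y)`. -/
def GmFun (h : SymX N → ℝ) (m : ℕ) (x : SymX N) : ℝ :=
  ((Dtot p q : ℝ) ^ m)⁻¹ * ((preimTn p q m x).map h).sum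

/-- The supremum norm on functions on `J̃`. -/
def supJ (f : ↥(juliaSet p q) → ℝ) : ℝ := ⨆ x, |f x|

section
/-! ### Part 1: sphere basics -/

/-- Standard homogeneous lift of a point of the sphere. -/
def lft (z : Sphere) : ℂ × ℂ := OnePoint.elim z (1, 0) (fun a => (a, 1))

def n2 (u : ℂ × ℂ) : ℝ := ‖WithLp.toLp 2 u‖

def wdg (u v : ℂ × ℂ) : ℂ := u.1 * v.2 - u.2 * v.1

def sg (z c : Sphere) : ℝ := ‖wdg (lft z) (lft c)‖ / (n2 (lft z) * n2 (lft c))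

def proj (u : ℂ × ℂ) : Sphere :=
  if u.2 = 0 then OnePoint.infty else ((u.1 / u.2 : ℂ) : Sphere)

@[simp] lemma lft_coe (a : ℂ) : lft (a : Sphere) = (a, 1) := rfl
@[simp] lemma lft_infty : lft (OnePoint.infty : Sphere) = (1, 0) := rfl

lemma n2_eq (u : ℂ × ℂ) : n2 u = √(‖u.1‖ ^ 2 + ‖u.2‖ ^ 2) := by
  simp [n2, WithLp.prod_norm_eq_of_L2]

lemma n2_sq (u : ℂ × ℂ) : n2 u ^ 2 = ‖u.1‖ ^ 2 + ‖u.2‖ ^ 2 := by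
  rw [n2_eq, Real.sq_sqrt (by positivity)]

lemma n2_nonneg (u : ℂ × ℂ) : 0 ≤ n2 u := norm_nonneg _

lemma n2_pos {u : ℂ × ℂ} (h : u ≠ 0) : 0 < n2 u := by
  refine norm_pos_iff.2 fun h' => h ?_
  simpa using h'

lemma n2_smul (k : ℂ) (u : ℂ × ℂ) : n2 (k • u) = ‖k‖ * n2 u := by
  simp [n2, WithLp.toLp_smul, norm_smul]

lemma n2_add (u v : ℂ × ℂ) : n2 (u + v) ≤ n2 u + n2 v := by
  simp only [n2, WithLp.toLp_add]; exact norm_add_le _ _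

lemma continuous_n2 : Continuous n2 := by
  have : n2 = fun u => √(‖u.1‖ ^ 2 + ‖u.2‖ ^ 2) := funext n2_eq
  rw [this]; fun_prop

lemma wdg_smul_left (k : ℂ) (u v) : wdg (k • u) v = k * wdg u v := by
  simp [wdg]; ring

lemma wdg_smul_right (k : ℂ) (u v) : wdg u (k • v) = k * wdg u v := by
  simp [wdg]; ring

lemma wdg_comm (u v) : ‖wdg u v‖ = ‖wdg v u‖ := by
  rw [← norm_neg]; congr 1; simp [wdg]; ring

lemma continuous_wdg : Continuous fun x : (ℂ × ℂ) × (ℂ × ℂ) => wdg x.1 x.2 := by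
  unfold wdg; fun_prop

lemma fst_le_n2 (u : ℂ × ℂ) : ‖u.1‖ ≤ n2 u := by
  rw [n2_eq]; exact Real.le_sqrt_of_sq_le (by nlinarith [sq_nonneg ‖u.2‖])

lemma snd_le_n2 (u : ℂ × ℂ) : ‖u.2‖ ≤ n2 u := by
  rw [n2_eq]; exact Real.le_sqrt_of_sq_le (by nlinarith [sq_nonneg ‖u.1‖])

lemma wdg_le (u v) : ‖wdg u v‖ ≤ n2 u * n2 v := by
  have h1 : ‖wdg u v‖ ≤ ‖u.1‖ * ‖v.2‖ + ‖u.2‖ * ‖v.1‖ := by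
    unfold wdg; refine (norm_sub_le _ _).trans ?_; simp
  refine h1.trans (abs_le_of_sq_le_sq' ?_ (mul_nonneg (n2_nonneg _) (n2_nonneg _))).2
  rw [mul_pow, n2_sq, n2_sq]
  nlinarith [sq_nonneg (‖u.1‖ * ‖v.1‖ - ‖u.2‖ * ‖v.2‖)]

lemma wdg_triangle (u v w) :
    ‖wdg u w‖ * n2 v ≤ ‖wdg u v‖ * n2 w + ‖wdg v w‖ * n2 u := by
  have : wdg u w • v = wdg u v • w + wdg v w • u := by
    ext <;> simp [wdg] <;> ring
  rw [← n2_smul, this, ← n2_smul, ← n2_smul]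
  exact n2_add _ _

lemma lft_ne (z : Sphere) : lft z ≠ 0 := by
  induction z using OnePoint.rec <;> simp

lemma nl_pos (z : Sphere) : 0 < n2 (lft z) := n2_pos (lft_ne z)

lemma nl_one_le (z : Sphere) : 1 ≤ n2 (lft z) := by
  induction z using OnePoint.rec with
  | infty => simp [n2_eq]
  | coe a => simpa using snd_le_n2 (a, 1)

lemma exists_proj {u : ℂ × ℂ} (h : u ≠ 0) : ∃ k : ℂ, k ≠ 0 ∧ u = k • lft (proj u) := by
  unfold proj
  split_ifs with h2
  · refine ⟨u.1, fun h1 => h (Prod.ext h1 h2), ?_⟩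
    ext <;> simp [h2]
  · refine ⟨u.2, h2, ?_⟩
    ext <;> simp
    field_simp

lemma proj_lft (z : Sphere) : proj (lft z) = z := by
  induction z using OnePoint.rec <;> simp [proj]

lemma proj_smul {k : ℂ} (hk : k ≠ 0) (u : ℂ × ℂ) : proj (k • u) = proj u := by
  unfold proj
  simp only [Prod.smul_fst, Prod.smul_snd, smul_eq_mul, mul_eq_zero, hk, false_or]
  split_ifs
  · rfl
  · congr 1; field_simp

lemma sg_proj {u v : ℂ × ℂ} (hu : u ≠ 0) (hv : v ≠ 0) :
    sg (proj u) (proj v) = ‖wdg u v‖ / (n2 u * n2 v) := by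
  obtain ⟨k, hk, hk'⟩ := exists_proj hu
  obtain ⟨l, hl, hl'⟩ := exists_proj hv
  rw [hk', hl', proj_smul hk, proj_smul hl, proj_lft, proj_lft, n2_smul, n2_smul, wdg_smul_left,
    wdg_smul_right, norm_mul, norm_mul, sg]
  have := norm_pos_iff.2 hk
  have := norm_pos_iff.2 hl
  have := nl_pos (proj u)
  have := nl_pos (proj v)
  field_simp

lemma sg_nonneg (z c) : 0 ≤ sg z c :=
  div_nonneg (norm_nonneg _) (mul_nonneg (n2_nonneg _) (n2_nonneg _))

lemma sg_comm (z c) : sg z c = sg c z := by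
  unfold sg; rw [wdg_comm, mul_comm (n2 _)]

lemma sg_le_one (z c) : sg z c ≤ 1 :=
  div_le_one_of_le₀ (wdg_le _ _) (mul_nonneg (n2_nonneg _) (n2_nonneg _))

lemma sg_eq_zero {z c} : sg z c = 0 ↔ z = c := by
  unfold sg
  rw [div_eq_zero_iff, or_iff_left (mul_pos (nl_pos _) (nl_pos _)).ne', norm_eq_zero]
  induction z using OnePoint.rec <;> induction c using OnePoint.rec <;> simp [wdg, sub_eq_zero]

@[simp] lemma sg_self (z) : sg z z = 0 := sg_eq_zero.2 rfl

lemma sg_pos {z c} (h : z ≠ c) : 0 < sg z c :=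
  lt_of_le_of_ne (sg_nonneg _ _) fun h' => h (sg_eq_zero.1 h'.symm)

lemma sg_triangle (z y c) : sg z c ≤ sg z y + sg y c := by
  unfold sg
  have := nl_pos z
  have := nl_pos y
  have := nl_pos c
  have h := wdg_triangle (lft z) (lft y) (lft c)
  rw [div_add_div _ _ (by positivity) (by positivity), div_le_div_iff₀ (by positivity) (by positivity)]
  have : 0 < n2 (lft z) * n2 (lft c) * n2 (lft y) := by positivity
  nlinarith

lemma sphDist_eq (z c) : sphDist z c = 2 * sg z c := by
  have h1 : ∀ a : ℂ, n2 (a, 1) = √(1 + ‖a‖ ^ 2) := fun a => by rw [n2_eq]; simp [add_comm]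
  have h2 : n2 (1, 0) = 1 := by rw [n2_eq]; simp
  induction z using OnePoint.rec <;> induction c using OnePoint.rec <;>
    simp [sphDist, sg, wdg, h1, h2, dist_eq_norm] <;> ring

/-- Degree-zero homogeneous functions, continuous off the origin, descend continuously. -/
lemma continuous_of_hom {f : ℂ × ℂ → ℝ} (hf : ∀ u, u ≠ 0 → ContinuousAt f u)
    (hom : ∀ k : ℂ, k ≠ 0 → ∀ u, u ≠ 0 → f (k • u) = f u) :
    Continuous fun z : Sphere => f (lft z) := by
  rw [OnePoint.continuous_iff]
  constructor
  · rw [coclosedCompact_eq_cocompact, ← Metric.cobounded_eq_cocompact]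
    have h1 : Tendsto (fun a : ℂ => f (1, a⁻¹)) (Bornology.cobounded ℂ) (𝓝 (f (1, 0))) := by
      refine (hf (1, 0) (by simp)).tendsto.comp ?_
      exact tendsto_const_nhds.prodMk_nhds tendsto_inv₀_cobounded
    refine h1.congr' ?_
    filter_upwards [Bornology.eventually_ne_cobounded (0 : ℂ)] with a ha
    have := hom a ha (1, a⁻¹) (by simp)
    rw [← this]; simp [ha]
  · refine continuous_iff_continuousAt.2 fun a => ?_
    exact (hf (a, 1) (by simp)).comp (f := fun a : ℂ => (a, (1 : ℂ))) (by fun_prop)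

lemma continuous_sg_left (c : Sphere) : Continuous fun z => sg z c := by
  refine continuous_of_hom (f := fun u => ‖wdg u (lft c)‖ / (n2 u * n2 (lft c))) ?_ ?_
  · intro u hu
    have := n2_pos hu
    have := nl_pos c
    refine ContinuousAt.div ?_ ?_ (by positivity)
    · unfold wdg; fun_prop
    · exact (continuous_n2.mul continuous_const).continuousAt
  · intro k hk u hu
    have := n2_pos hu
    have := nl_pos c
    have := norm_pos_iff.2 hk
    simp only [n2_smul, wdg_smul_left, norm_mul]
    field_simp

lemma sg_lip (z z' c c') : |sg z c - sg z' c'| ≤ sg z z' + sg c c' := by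
  have h1 := sg_triangle z z' c
  have h2 := sg_triangle z' c' c
  have h3 := sg_triangle z' z c'
  have h4 := sg_triangle z c c'
  rw [sg_comm c' c] at h2
  rw [sg_comm z' z] at h3
  exact abs_le.2 ⟨by linarith, by linarith⟩

lemma continuous_sg : Continuous fun x : Sphere × Sphere => sg x.1 x.2 := by
  refine continuous_iff_continuousAt.2 fun x => ?_
  have h : Tendsto (fun y : Sphere × Sphere => sg y.1 x.1 + sg y.2 x.2) (𝓝 x) (𝓝 0) := by
    have : Continuous (fun y : Sphere × Sphere => sg y.1 x.1 + sg y.2 x.2) :=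
      ((continuous_sg_left _).comp continuous_fst).add ((continuous_sg_left _).comp continuous_snd)
    simpa using this.tendsto x
  rw [ContinuousAt, tendsto_iff_dist_tendsto_zero]
  refine squeeze_zero (fun _ => dist_nonneg) (fun y => ?_) h
  rw [Real.dist_eq]; exact sg_lip _ _ _ _

/-- auxiliary copy of the sphere carrying the chordal metric -/
def SphC : Type := Sphere

instance : MetricSpace SphC where
  dist := sg
  dist_self := sg_self
  dist_comm := sg_comm
  dist_triangle := sg_triangle
  eq_of_dist_eq_zero := fun h => sg_eq_zero.1 h

@[reducible] def sphMS0 : MetricSpace Sphere := inferInstanceAs (MetricSpace SphC)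

lemma sphTop_eq : (inferInstance : TopologicalSpace Sphere) =
    sphMS0.toUniformSpace.toTopologicalSpace := by
  let e : Sphere ≃ SphC := Equiv.refl _
  have hc : Continuous e := by
    refine continuous_iff_continuousAt.2 fun z => ?_
    refine tendsto_iff_dist_tendsto_zero.2 ?_
    have := (continuous_sg_left z).tendsto z
    rw [sg_self] at this
    exact this
  have := hc.homeoOfEquivCompactToT2.isInducing.eq_induced
  exact this.trans (@induced_id Sphere sphMS0.toUniformSpace.toTopologicalSpace)

@[reducible] def sphMS : MetricSpace Sphere := sphMS0.replaceTopology sphTop_eq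

attribute [local instance] sphMS

lemma sph_dist (z c : Sphere) : dist z c = sg z c := rfl

example : CompactSpace Sphere := inferInstance
instance : SecondCountableTopology Sphere := inferInstance
instance : TopologicalSpace.MetrizableSpace Sphere := inferInstance

lemma tendsto_sph {α : Type*} {l : Filter α} {f : α → Sphere} {z : Sphere} :
    Tendsto f l (𝓝 z) ↔ Tendsto (fun a => sg (f a) z) l (𝓝 0) :=
  tendsto_iff_dist_tendsto_zero

lemma nhds_sph (z : Sphere) : (𝓝 z).HasBasis (fun ε : ℝ => 0 < ε) (fun ε => {y | sg y z < ε}) :=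
  Metric.nhds_basis_ball

lemma sg_seq {c : Sphere} {s : ℕ → Sphere} (h : Tendsto s atTop (𝓝 c)) (y : Sphere) :
    Tendsto (fun n => sg y (s n)) atTop (𝓝 (sg y c)) := by
  simp_rw [sg_comm y]
  exact ((continuous_sg_left y).tendsto c).comp h

end

section
/-! ### Part 2: the key identity -/

def homP (W : ℂ[X]) (d : ℕ) (u : ℂ × ℂ) : ℂ :=
  ∑ i ∈ Finset.range (d + 1), W.coeff i * u.1 ^ i * u.2 ^ (d - i)

lemma homP_smul (W : ℂ[X]) (d : ℕ) (k : ℂ) (u : ℂ × ℂ) :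
    homP W d (k • u) = k ^ d * homP W d u := by
  unfold homP
  rw [Finset.mul_sum]
  refine Finset.sum_congr rfl fun i hi => ?_
  have hi' : i ≤ d := Nat.lt_succ_iff.1 (Finset.mem_range.1 hi)
  have : k ^ d = k ^ i * k ^ (d - i) := by rw [← pow_add]; congr 1; omega
  rw [this]; simp [mul_pow]; ring

lemma homP_coe {W : ℂ[X]} {d : ℕ} (h : W.natDegree ≤ d) (a : ℂ) : homP W d (a, 1) = W.eval a := by
  rw [eval_eq_sum_range' (Nat.lt_succ_of_le h)]; simp [homP]

lemma homP_infty (W : ℂ[X]) (d : ℕ) : homP W d (1, 0) = W.coeff d := by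
  unfold homP
  rw [Finset.sum_eq_single d]
  · simp
  · intro i hi hne
    have hi' : i < d + 1 := Finset.mem_range.1 hi
    have : d - i ≠ 0 := by omega
    simp [this]
  · simp

lemma homP_sub (P Q : ℂ[X]) (b : ℂ) (d : ℕ) (u) :
    homP (P - C b * Q) d u = homP P d u - b * homP Q d u := by
  unfold homP
  rw [Finset.mul_sum, ← Finset.sum_sub_distrib]
  refine Finset.sum_congr rfl fun i _ => ?_
  simp; ring

lemma continuous_homP (W : ℂ[X]) (d : ℕ) : Continuous (homP W d) := by
  unfold homP; fun_prop

lemma differentiable_homP (W : ℂ[X]) (d : ℕ) : Differentiable ℂ (homP W d) := by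
  unfold homP; fun_prop

lemma n2_infty : n2 (1, 0) = 1 := by rw [n2_eq]; simp

lemma homP_factor {W : ℂ[X]} {d : ℕ} (hW : W ≠ 0) (h : W.natDegree ≤ d) (c : Sphere) :
    ‖homP W d (lft c)‖ / n2 (lft c) ^ d =
      (‖W.leadingCoeff‖ * (W.roots.map fun y : ℂ => n2 (lft (y : Sphere))).prod) *
      (((W.roots.map fun z : ℂ => (z : Sphere)) +
        Multiset.replicate (d - W.natDegree) (OnePoint.infty : Sphere)).map fun y => sg y c).prod := by
  have hs : W.Splits := IsAlgClosed.splits W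
  have hcard : W.roots.card = W.natDegree := hs.natDegree_eq_card_roots.symm
  rw [Multiset.map_add, Multiset.prod_add, Multiset.map_map, Multiset.map_replicate,
    Multiset.prod_replicate]
  induction c using OnePoint.rec with
  | infty =>
    simp only [lft_infty, homP_infty, n2_infty, one_pow, div_one]
    rcases h.eq_or_lt with h | h
    · subst h
      simp only [Nat.sub_self, pow_zero, mul_one, coeff_natDegree]
      rw [mul_assoc, ← Multiset.prod_map_mul]
      have : ∀ y : ℂ, n2 (lft (y : Sphere)) * ((fun y => sg y OnePoint.infty) ∘ fun z : ℂ => (z : Sphere)) y = 1 := by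
        intro y
        have := nl_pos (y : Sphere)
        simp only [Function.comp, sg, lft_infty, n2_infty, wdg, lft_coe] at *
        simp; field_simp
      rw [Multiset.map_congr rfl fun y _ => this y]; simp
    · rw [coeff_eq_zero_of_natDegree_lt h]
      have : d - W.natDegree ≠ 0 := by omega
      simp [this]
  | coe a =>
    have hev : W.eval a = W.leadingCoeff * (W.roots.map fun r => a - r).prod := by
      conv_lhs => rw [hs.eq_prod_roots]
      simp [eval_multiset_prod]
    simp only [lft_coe]
    rw [homP_coe h, hev, norm_mul]
    have hn : 0 < n2 (a, 1) := nl_pos (a : Sphere)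
    have h1 : ‖(W.roots.map fun r => a - r).prod‖ =
        (W.roots.map fun y => n2 (y, 1)).prod *
        (W.roots.map ((fun y => sg y (a : Sphere)) ∘ fun z : ℂ => (z : Sphere))).prod *
          n2 (a, 1) ^ W.natDegree := by
      rw [← hcard]
      generalize W.roots = s
      induction s using Multiset.induction_on with
      | empty => simp
      | cons r s ih =>
        simp only [Multiset.map_cons, Multiset.prod_cons, norm_mul, Multiset.card_cons, pow_succ, ih]
        have hr : 0 < n2 (r, 1) := nl_pos (r : Sphere)
        have : ‖a - r‖ = n2 (r, 1) * ((fun y => sg y (a : Sphere)) ∘ fun z : ℂ => (z : Sphere)) r * n2 (a, 1) := by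
          simp only [Function.comp, sg, wdg, lft_coe, mul_one, one_mul]
          rw [norm_sub_rev]; field_simp
        rw [this]; ring
    have h2 : sg OnePoint.infty (a : Sphere) = (n2 (a, 1))⁻¹ := by
      simp [sg, wdg, n2_infty]
    rw [h1, h2, inv_pow]
    have h3 : n2 (a, 1) ^ d = n2 (a, 1) ^ W.natDegree * n2 (a, 1) ^ (d - W.natDegree) := by
      rw [← pow_add]; congr 1; omega
    rw [h3]
    field_simp

/-- Abstract data of a rational map needed for the argument. -/
structure RM (R : Sphere → Sphere) (fib : Sphere → Multiset Sphere) (d : ℕ) (A B : Sphere → ℝ) :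
    Prop where
  dpos : 1 ≤ d
  card : ∀ z, (fib z).card = d
  Apos : ∀ z, 0 < A z
  Bpos : ∀ z, 0 < B z
  Bcont : Continuous B
  ki : ∀ z c, A z * ((fib z).map fun y => sg y c).prod = sg (R c) z * B c

def FF (P Q : ℂ[X]) (u : ℂ × ℂ) : ℂ × ℂ :=
  (homP P (max P.natDegree Q.natDegree) u, homP Q (max P.natDegree Q.natDegree) u)

lemma FF_smul (P Q : ℂ[X]) (k : ℂ) (u : ℂ × ℂ) :
    FF P Q (k • u) = k ^ (max P.natDegree Q.natDegree) • FF P Q u := by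
  ext <;> simp [FF, homP_smul]

section rat
variable {P Q : ℂ[X]} (hc : IsCoprime P Q) (hd : 1 ≤ max P.natDegree Q.natDegree)
include hc hd

lemma Q_ne : Q ≠ 0 := by
  rintro rfl
  rw [isCoprime_zero_right] at hc
  have := natDegree_eq_zero_of_isUnit hc
  simp [this] at hd

lemma W_ne (b : ℂ) : P - C b * Q ≠ 0 := by
  intro h
  have h1 : P = C b * Q := sub_eq_zero.1 h
  have h2 : IsUnit Q := by
    rw [h1] at hc
    exact isCoprime_self.1 (hc.of_mul_left_right)
  have h3 := natDegree_eq_zero_of_isUnit h2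
  have h4 : P.natDegree ≤ 0 := by
    rw [h1, ← h3]; exact natDegree_C_mul_le _ _
  omega

lemma FF_lft_ne (z : Sphere) : FF P Q (lft z) ≠ 0 := by
  intro h
  induction z using OnePoint.rec with
  | infty =>
    simp only [FF, lft_infty, homP_infty, Prod.mk_eq_zero] at h
    obtain ⟨h1, h2⟩ := h
    rcases le_total P.natDegree Q.natDegree with h' | h'
    · rw [max_eq_right h', coeff_natDegree, leadingCoeff_eq_zero] at h2
      exact Q_ne hc hd h2
    · rw [max_eq_left h', coeff_natDegree, leadingCoeff_eq_zero] at h1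
      subst h1
      simp at h' hd; omega
  | coe a =>
    simp only [FF, lft_coe, Prod.mk_eq_zero] at h
    rw [homP_coe (le_max_left _ _), homP_coe (le_max_right _ _)] at h
    obtain ⟨h1, h2⟩ := h
    obtain ⟨u, v, huv⟩ := hc
    have := congrArg (eval a) huv
    simp [h1, h2] at this

lemma FF_ne {u : ℂ × ℂ} (hu : u ≠ 0) : FF P Q u ≠ 0 := by
  obtain ⟨k, hk, h⟩ := exists_proj hu
  rw [h, FF_smul]
  exact smul_ne_zero (pow_ne_zero _ hk) (FF_lft_ne hc hd _)

lemma ratEval_lft (z : Sphere) : ratEval P Q z = proj (FF P Q (lft z)) := by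
  induction z using OnePoint.rec with
  | infty =>
    simp only [FF, lft_infty, homP_infty, ratEval, OnePoint.elim_infty, proj]
    split_ifs with h1 h2 h3 h4 h5
    · rfl
    · rw [max_eq_left h1.le, coeff_eq_zero_of_natDegree_lt h1] at h2; exact absurd rfl h2
    · rw [max_eq_right h3.le, coeff_natDegree, leadingCoeff_eq_zero] at h4
      exact absurd h4 (Q_ne hc hd)
    · rw [max_eq_right h3.le, coeff_eq_zero_of_natDegree_lt h3]; simp
    · rw [max_eq_right (by omega), coeff_natDegree, leadingCoeff_eq_zero] at h5
      exact absurd h5 (Q_ne hc hd)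
    · have : P.natDegree = Q.natDegree := by omega
      rw [max_eq_right (by omega), coeff_natDegree, ← this, coeff_natDegree]
  | coe a =>
    have : FF P Q (lft a) = (P.eval a, Q.eval a) := by
      simp only [FF, lft_coe]
      rw [homP_coe (le_max_left _ _), homP_coe (le_max_right _ _)]
    rw [this]
    rfl

lemma ratEval_proj {u : ℂ × ℂ} (hu : u ≠ 0) : ratEval P Q (proj u) = proj (FF P Q u) := by
  obtain ⟨k, hk, h⟩ := exists_proj hu
  rw [ratEval_lft hc hd]
  conv_rhs => rw [h, FF_smul, proj_smul (pow_ne_zero _ hk)]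

lemma exists_RM : ∃ A B, RM (ratEval P Q) (fiber P Q) (max P.natDegree Q.natDegree) A B := by
  have hdW : ∀ b, (P - C b * Q).natDegree ≤ max P.natDegree Q.natDegree := fun b =>
    (natDegree_sub_le _ _).trans (max_le_max_left _ (natDegree_C_mul_le _ _))
  set d := max P.natDegree Q.natDegree with hdd
  let Wz : Sphere → ℂ[X] := fun z => OnePoint.elim z Q (fun b => P - C b * Q)
  have hWne : ∀ z, Wz z ≠ 0 := by
    intro z
    induction z using OnePoint.rec with
    | infty => exact Q_ne hc hd
    | coe b => exact W_ne hc hd b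
  have hWd : ∀ z, (Wz z).natDegree ≤ d := by
    intro z
    induction z using OnePoint.rec with
    | infty => exact le_max_right _ _
    | coe b => exact hdW b
  have hfib : ∀ z, fiber P Q z = ((Wz z).roots.map fun z : ℂ => (z : Sphere)) +
        Multiset.replicate (d - (Wz z).natDegree) (OnePoint.infty : Sphere) := by
    intro z
    have hm : ∀ s : Multiset ℂ, (s.map fun z => (z : Sphere)) = s.map fun z : ℂ => (z : Sphere) := by
      intro s
      simp [Multiset.bind_def, Multiset.pure_def, Multiset.bind_singleton]
    induction z using OnePoint.rec
    · exact congrArg (· + _) (hm _)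
    · exact congrArg (· + _) (hm _)
  have hw : ∀ z u, ‖wdg (FF P Q u) (lft z)‖ = ‖homP (Wz z) d u‖ := by
    intro z u
    induction z using OnePoint.rec with
    | infty => simp [wdg, FF, Wz, hdd]
    | coe b => simp only [wdg, FF, Wz, lft_coe, OnePoint.elim_some, homP_sub]; congr 1; ring
  refine ⟨fun z => (‖(Wz z).leadingCoeff‖ * ((Wz z).roots.map fun y : ℂ => n2 (lft (y : Sphere))).prod) /
    n2 (lft z), fun c => n2 (FF P Q (lft c)) / n2 (lft c) ^ d, hd, ?_, ?_, ?_, ?_, ?_⟩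
  · intro z
    rw [hfib]
    have hs : (Wz z).Splits := IsAlgClosed.splits _
    have hcard : (Wz z).roots.card = (Wz z).natDegree := hs.natDegree_eq_card_roots.symm
    simp only [Multiset.card_add, Multiset.card_map, Multiset.card_replicate, hcard]
    have := hWd z
    omega
  · intro z
    refine div_pos (mul_pos (norm_pos_iff.2 (leadingCoeff_ne_zero.2 (hWne z))) ?_) (nl_pos z)
    refine Multiset.prod_pos fun x hx => ?_
    obtain ⟨y, _, rfl⟩ := Multiset.mem_map.1 hx
    exact nl_pos _
  · intro z
    exact div_pos (n2_pos (FF_lft_ne hc hd z)) (pow_pos (nl_pos z) _)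
  · refine continuous_of_hom (f := fun u => n2 (FF P Q u) / n2 u ^ d) ?_ ?_
    · intro u hu
      have h1 : Continuous fun u => n2 (FF P Q u) :=
        continuous_n2.comp ((continuous_homP _ _).prodMk (continuous_homP _ _))
      exact h1.continuousAt.div (continuous_n2.pow _).continuousAt (pow_pos (n2_pos hu) _).ne'
    · intro k hk u hu
      have := n2_pos hu
      have := norm_pos_iff.2 hk
      simp only [FF_smul, n2_smul, norm_pow, mul_pow, ← hdd]
      field_simp
  · intro z c
    have h1 := homP_factor (hWne z) (hWd z) c
    rw [← hfib, ← hw] at h1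
    have h2 : sg (ratEval P Q c) z = ‖wdg (FF P Q (lft c)) (lft z)‖ / (n2 (FF P Q (lft c)) * n2 (lft z)) := by
      rw [ratEval_lft hc hd, ← sg_proj (FF_lft_ne hc hd c) (lft_ne z), proj_lft]
    have h3 := n2_pos (FF_lft_ne hc hd c)
    have h4 := nl_pos z
    have h5 := nl_pos c
    rw [h2, div_mul_eq_mul_div, ← h1]
    field_simp

end rat

end

section
/-! ### Part 3: consequences of the key identity -/
attribute [local instance] sphMS

lemma prod_sg_nonneg (s : Multiset Sphere) (c : Sphere) : 0 ≤ (s.map fun y => sg y c).prod :=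
  Multiset.prod_nonneg fun a ha => by
    obtain ⟨y, _, rfl⟩ := Multiset.mem_map.1 ha; exact sg_nonneg _ _

lemma prod_sg_le_one (s : Multiset Sphere) (c : Sphere) : (s.map fun y => sg y c).prod ≤ 1 := by
  induction s using Multiset.induction_on with
  | empty => simp
  | cons a s ih =>
    simp only [Multiset.map_cons, Multiset.prod_cons]
    exact mul_le_one₀ (sg_le_one _ _) (prod_sg_nonneg _ _) ih

lemma prod_sg_eq_zero {s : Multiset Sphere} {c : Sphere} :
    (s.map fun y => sg y c).prod = 0 ↔ c ∈ s := by
  rw [Multiset.prod_eq_zero_iff, Multiset.mem_map]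
  constructor
  · rintro ⟨y, hy, h⟩; rwa [← sg_eq_zero.1 h]
  · intro h; exact ⟨c, h, sg_self c⟩

lemma continuous_prod_sg (s : Multiset Sphere) : Continuous fun c => (s.map fun y => sg y c).prod := by
  induction s using Multiset.induction_on with
  | empty => exact continuous_const (y := (1 : ℝ))
  | cons a s ih =>
    simp only [Multiset.map_cons, Multiset.prod_cons]
    refine Continuous.mul ?_ ih
    exact (continuous_sg_left a).congr fun c => sg_comm _ _

lemma pow_le_prod_sg {s : Multiset Sphere} {c : Sphere} {ε : ℝ} (hε : 0 ≤ ε)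
    (h : ∀ y ∈ s, ε ≤ sg y c) : ε ^ s.card ≤ (s.map fun y => sg y c).prod := by
  induction s using Multiset.induction_on with
  | empty => simp
  | cons a s ih =>
    simp only [Multiset.map_cons, Multiset.prod_cons, Multiset.card_cons, pow_succ']
    have h1 := h a (Multiset.mem_cons_self _ _)
    have h2 := ih fun y hy => h y (Multiset.mem_cons_of_mem hy)
    exact mul_le_mul h1 h2 (pow_nonneg hε _) (hε.trans h1)

/-- A multiset of points is determined by its chordal product. -/
lemma multiset_eq_of_prod {s : Multiset Sphere} : ∀ {t : Multiset Sphere} {α β : ℝ}, 0 < α → 0 < β →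
    (∀ c, α * (s.map fun y => sg y c).prod = β * (t.map fun y => sg y c).prod) → s = t := by
  induction s using Multiset.induction_on with
  | empty =>
    intro t α β ha hb h
    by_contra hne
    obtain ⟨c, hc⟩ := Multiset.exists_mem_of_ne_zero (Ne.symm hne)
    have := h c
    rw [prod_sg_eq_zero.2 hc] at this
    simp at this; exact ha.ne' this
  | cons a s ih =>
    intro t α β ha hb h
    have hat : a ∈ t := by
      have := h a
      rw [prod_sg_eq_zero.2 (Multiset.mem_cons_self a s), mul_zero, eq_comm, mul_eq_zero,
        or_iff_right hb.ne'] at this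
      exact prod_sg_eq_zero.1 this
    obtain ⟨t', rfl⟩ := Multiset.exists_cons_of_mem hat
    rw [ih (t := t') ha hb]
    have : (fun c => α * (s.map fun y => sg y c).prod) = fun c => β * (t'.map fun y => sg y c).prod := by
      refine Continuous.ext_on (dense_compl_singleton a) (continuous_const.mul (continuous_prod_sg s))
        (continuous_const.mul (continuous_prod_sg t')) ?_
      intro c hc
      have h1 := h c
      simp only [Multiset.map_cons, Multiset.prod_cons] at h1
      have : sg a c ≠ 0 := (sg_pos (Ne.symm hc)).ne'
      refine mul_left_cancel₀ this ?_
      linear_combination h1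
    exact fun c => congrFun this c

lemma exists_enum (d : ℕ) (s : Multiset Sphere) (h : s.card = d) :
    ∃ y : Fin d → Sphere, s = Finset.univ.val.map y := by
  subst h
  refine ⟨fun i => s.toList.get (i.cast (by simp)), ?_⟩
  rw [Fin.univ_val_map]
  conv_lhs => rw [← Multiset.coe_toList s]
  congr 1
  refine List.ext_getElem (by simp) ?_
  intro n h1 h2
  simp

namespace RM
variable {R : Sphere → Sphere} {fib : Sphere → Multiset Sphere} {d : ℕ} {A B : Sphere → ℝ}
  (h : RM R fib d A B)
include h

lemma mem_fib {y z : Sphere} : y ∈ fib z ↔ R y = z := by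
  rw [← prod_sg_eq_zero, ← sg_eq_zero]
  have h1 := h.ki z y
  have h2 := (h.Apos z).ne'
  have h3 := (h.Bpos y).ne'
  constructor
  · intro h'
    rw [h', mul_zero, eq_comm, mul_eq_zero] at h1
    exact h1.resolve_right h3
  · intro h'
    rw [h', zero_mul, mul_eq_zero] at h1
    exact h1.resolve_left h2

lemma cont : Continuous R := by
  refine continuous_iff_continuousAt.2 fun c => ?_
  rw [ContinuousAt, tendsto_sph]
  have h1 : ∀ c', sg (R c') (R c) = A (R c) * ((fib (R c)).map fun y => sg y c').prod / B c' := by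
    intro c'
    rw [eq_div_iff (h.Bpos c').ne', h.ki]
  simp_rw [h1]
  have h2 : Continuous fun c' => A (R c) * ((fib (R c)).map fun y => sg y c').prod / B c' :=
    (continuous_const.mul (continuous_prod_sg _)).div h.Bcont fun c' => (h.Bpos c').ne'
  have h3 := h2.tendsto c
  rw [prod_sg_eq_zero.2 (h.mem_fib.2 rfl)] at h3
  simpa using h3

lemma exists_mem (z : Sphere) : ∃ y, y ∈ fib z := by
  refine Multiset.card_pos_iff_exists_mem.1 ?_
  rw [h.card]; exact h.dpos

lemma B_bdd : ∃ m M : ℝ, 0 < m ∧ 0 < M ∧ ∀ c, m ≤ B c ∧ B c ≤ M := by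
  obtain ⟨c0, _, h0⟩ := isCompact_univ.exists_isMinOn (⟨OnePoint.infty, trivial⟩ : (Set.univ : Set Sphere).Nonempty)
    h.Bcont.continuousOn
  obtain ⟨c1, _, h1⟩ := isCompact_univ.exists_isMaxOn (⟨OnePoint.infty, trivial⟩ : (Set.univ : Set Sphere).Nonempty)
    h.Bcont.continuousOn
  exact ⟨B c0, B c1, h.Bpos _, h.Bpos _, fun c => ⟨h0 trivial, h1 trivial⟩⟩

lemma A_bdd : ∃ α : ℝ, 0 < α ∧ ∀ z, α ≤ A z := by
  obtain ⟨m, M, hm, -, hB⟩ := h.B_bdd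
  refine ⟨m / 2, by positivity, fun z => ?_⟩
  obtain ⟨c0, hc0⟩ := h.exists_mem ((0 : ℂ) : Sphere)
  obtain ⟨c1, hc1⟩ := h.exists_mem OnePoint.infty
  rw [h.mem_fib] at hc0 hc1
  have key : ∀ c, (1 / 2 : ℝ) ≤ sg (R c) z → m / 2 ≤ A z := by
    intro c hc
    have h1 := h.ki z c
    have h2 : m / 2 ≤ sg (R c) z * B c := by
      have := mul_le_mul hc (hB c).1 hm.le (sg_nonneg _ _)
      linarith
    have h3 := prod_sg_le_one (fib z) c
    nlinarith [h.Apos z]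
  have ht := sg_triangle ((0 : ℂ) : Sphere) z OnePoint.infty
  have h01 : sg ((0 : ℂ) : Sphere) OnePoint.infty = 1 := by simp [sg, wdg, n2_eq]
  rw [h01] at ht
  by_cases hh : (1 / 2 : ℝ) ≤ sg (R c0) z
  · exact key c0 hh
  · refine key c1 ?_
    rw [hc0] at hh
    rw [hc1, sg_comm]
    linarith

lemma lower : ∃ κ : ℝ, 0 < κ ∧ κ ≤ 1 ∧ ∀ c x, κ * ((fib x).map fun y => sg y c).prod ≤ sg (R c) x := by
  obtain ⟨m, M, hm, hM, hB⟩ := h.B_bdd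
  obtain ⟨α, hα, hA⟩ := h.A_bdd
  refine ⟨min 1 (α / M), by positivity, min_le_left _ _, fun c x => ?_⟩
  have h1 := h.ki x c
  have h2 := prod_sg_nonneg (fib x) c
  have h3 := sg_nonneg (R c) x
  calc min 1 (α / M) * ((fib x).map fun y => sg y c).prod
      ≤ (α / M) * ((fib x).map fun y => sg y c).prod := by gcongr; exact min_le_right _ _
    _ = (α * ((fib x).map fun y => sg y c).prod) / M := by ring
    _ ≤ (A x * ((fib x).map fun y => sg y c).prod) / M := by gcongr; exact hA x
    _ = sg (R c) x * B c / M := by rw [h1]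
    _ ≤ sg (R c) x * M / M := by gcongr; exact (hB c).2
    _ = sg (R c) x := by field_simp

lemma isOpenMap : IsOpenMap R := by
  refine IsOpenMap.of_nhds_le fun c => ?_
  obtain ⟨κ, hκ, -, hl⟩ := h.lower
  intro U hU
  obtain ⟨ε, hε, hU⟩ := (nhds_sph c).mem_iff.1 (mem_map.1 hU)
  refine (nhds_sph (R c)).mem_iff.2 ⟨κ * ε ^ d, by positivity, fun z' hz' => ?_⟩
  have : ∃ y ∈ fib z', sg y c < ε := by
    by_contra! hcon
    have h1 := pow_le_prod_sg hε.le hcon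
    rw [h.card] at h1
    have h2 := hl c z'
    have h3 : sg z' (R c) < κ * ε ^ d := hz'
    rw [sg_comm] at h3
    nlinarith
  obtain ⟨y, hy, hyc⟩ := this
  rw [← h.mem_fib.1 hy]
  exact hU hyc

lemma fib_limit {z : ℕ → Sphere} {z0 : Sphere} (hz : Tendsto z atTop (𝓝 z0))
    {y : ℕ → Fin d → Sphere} {y0 : Fin d → Sphere} (hy : Tendsto y atTop (𝓝 y0))
    (hf : ∀ k, fib (z k) = Finset.univ.val.map (y k)) : fib z0 = Finset.univ.val.map y0 := by
  have hprod : ∀ (y : Fin d → Sphere) c, ((Finset.univ.val.map y).map fun y => sg y c).prod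
      = ∏ i, sg (y i) c := by intro y c; rw [Multiset.map_map]; rfl
  have hlim : ∀ c, Tendsto (fun k => ∏ i, sg (y k i) c) atTop (𝓝 (∏ i, sg (y0 i) c)) := by
    intro c
    refine tendsto_finsetProd _ fun i _ => ?_
    exact ((continuous_sg_left c).tendsto _).comp (((continuous_apply i).tendsto _).comp hy)
  have hrhs : ∀ c, Tendsto (fun k => sg (R c) (z k) * B c) atTop (𝓝 (sg (R c) z0 * B c)) := fun c =>
    (sg_seq hz _).mul_const _
  -- choose a generic point
  obtain ⟨c, hc⟩ : ∃ c : Sphere, c ∉ (fib z0 + Finset.univ.val.map y0).toFinset :=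
    Infinite.exists_notMem_finset _
  simp only [Multiset.mem_toFinset, Multiset.mem_add, not_or] at hc
  have hp : 0 < ∏ i, sg (y0 i) c := by
    rw [← hprod]
    exact lt_of_le_of_ne (prod_sg_nonneg _ _) fun h' => hc.2 (prod_sg_eq_zero.1 h'.symm)
  have hr : 0 < sg (R c) z0 * B c := mul_pos (sg_pos fun h' => hc.1 (h.mem_fib.2 h')) (h.Bpos c)
  set α := (sg (R c) z0 * B c) / ∏ i, sg (y0 i) c with hα
  have hA : Tendsto (fun k => A (z k)) atTop (𝓝 α) := by
    have h1 := (hrhs c).div (hlim c) hp.ne'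
    refine h1.congr' ?_
    filter_upwards [(hlim c).eventually (lt_mem_nhds hp)] with k hk
    have := h.ki (z k) c
    rw [hf, hprod] at this
    rw [Pi.div_apply, ← this]; field_simp
  refine multiset_eq_of_prod (h.Apos z0) (div_pos hr hp) fun c' => ?_
  rw [h.ki, hprod]
  refine tendsto_nhds_unique (hrhs c') ((hA.mul (hlim c')).congr fun k => ?_)
  rw [← h.ki, hf, hprod]

/-- sums over fibres depend continuously on parameters -/
lemma continuous_sum {W : Type*} [TopologicalSpace W] [FirstCountableTopology W]
    {Φ : W × Sphere → ℝ} (hΦ : Continuous Φ) :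
    Continuous fun x : W × Sphere => ((fib x.2).map fun y => Φ (x.1, y)).sum := by
  rw [continuous_iff_seqContinuous]
  intro x x0 hx
  choose y hy using fun z => exists_enum d (fib z) (h.card z)
  have hsum : ∀ (w : W) (y : Fin d → Sphere), ((Finset.univ.val.map y).map fun y => Φ (w, y)).sum
      = ∑ i, Φ (w, y i) := by intro y c; rw [Multiset.map_map]; rfl
  refine tendsto_of_subseq_tendsto fun ns hns => ?_
  obtain ⟨y0, -, φ, hφ, hlim⟩ := isCompact_univ.tendsto_subseq (x := fun k => y (x (ns k)).2)
    fun _ => Set.mem_univ _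
  refine ⟨φ, ?_⟩
  have hx' : Tendsto (fun k => x (ns (φ k))) atTop (𝓝 x0) := hx.comp (hns.comp hφ.tendsto_atTop)
  have h0 := h.fib_limit ((continuous_snd.tendsto _).comp hx') hlim fun k => hy _
  simp only [h0, hsum, Function.comp]
  have : (fun k => ((fib (x (ns (φ k))).2).map fun y => Φ ((x (ns (φ k))).1, y)).sum) =
      fun k => ∑ i, Φ ((x (ns (φ k))).1, y (x (ns (φ k))).2 i) := by
    funext k; rw [hy, hsum]
  rw [this]
  refine tendsto_finsetSum _ fun i _ => ?_
  refine (hΦ.tendsto _).comp ?_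
  exact ((continuous_fst.tendsto _).comp hx').prodMk_nhds (((continuous_apply i).tendsto _).comp hlim)

lemma crit_limit {c y' : ℕ → Sphere} {c0 : Sphere} (hc : Tendsto c atTop (𝓝 c0))
    (hy' : Tendsto y' atTop (𝓝 c0)) (hm : ∀ k, y' k ∈ (fib (R (c k))).erase (c k)) :
    2 ≤ (fib (R c0)).count c0 := by
  have hen : ∀ k, ∃ y : Fin d → Sphere, ∃ ij : Fin d × Fin d, fib (R (c k)) = Finset.univ.val.map y ∧
      ij.1 ≠ ij.2 ∧ y ij.1 = c k ∧ y ij.2 = y' k := by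
    intro k
    obtain ⟨y, hy⟩ := exists_enum d _ (h.card (R (c k)))
    have h1 : c k ∈ Finset.univ.val.map y := by rw [← hy]; exact h.mem_fib.2 rfl
    obtain ⟨i, -, hi⟩ := Multiset.mem_map.1 h1
    have h2 : (Finset.univ.val.map y).erase (c k) = (Finset.univ.val.erase i).map y := by
      rw [← hi, Multiset.map_erase_of_mem _ _ (Finset.mem_univ i)]
    have h3 := hm k
    rw [hy, h2] at h3
    obtain ⟨j, hj, hj'⟩ := Multiset.mem_map.1 h3
    refine ⟨y, (i, j), hy, ?_, hi, hj'⟩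
    intro hij
    have hij' : i = j := hij
    subst hij'
    exact (Multiset.Nodup.notMem_erase Finset.univ.nodup) hj
  choose y ij hy hne hi hj using hen
  obtain ⟨⟨y0, ij0⟩, -, φ, hφ, hlim⟩ := isCompact_univ.tendsto_subseq (x := fun k => (y k, ij k))
    fun _ => Set.mem_univ _
  have hl1 : Tendsto (fun k => y (φ k)) atTop (𝓝 y0) := (continuous_fst.tendsto _).comp hlim
  have hl2 : Tendsto (fun k => ij (φ k)) atTop (𝓝 ij0) := (continuous_snd.tendsto _).comp hlim
  have hev : ∀ᶠ k in atTop, ij (φ k) = ij0 := by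
    rw [nhds_discrete] at hl2
    exact tendsto_pure.1 hl2
  have h0 := h.fib_limit (((h.cont.tendsto _).comp hc).comp hφ.tendsto_atTop) hl1 fun k => hy _
  have e1 : y0 ij0.1 = c0 := by
    refine tendsto_nhds_unique (((continuous_apply ij0.1).tendsto _).comp hl1)
      ((hc.comp hφ.tendsto_atTop).congr' ?_)
    filter_upwards [hev] with k hk
    simp only [Function.comp]
    rw [← hi, hk]
  have e2 : y0 ij0.2 = c0 := by
    refine tendsto_nhds_unique (((continuous_apply ij0.2).tendsto _).comp hl1)
      ((hy'.comp hφ.tendsto_atTop).congr' ?_)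
    filter_upwards [hev] with k hk
    simp only [Function.comp]
    rw [← hj, hk]
  have hne0 : ij0.1 ≠ ij0.2 := by
    obtain ⟨k, hk⟩ := hev.exists
    rw [← hk]; exact hne _
  rw [h0, Multiset.count_map]
  have : ({ij0.1, ij0.2} : Finset (Fin d)).card ≤ (Multiset.filter (fun a => c0 = y0 a) Finset.univ.val).card := by
    refine Multiset.card_le_card (Finset.val_le_iff_val_subset.2 ?_)
    intro a ha
    rw [Multiset.mem_filter]
    refine ⟨Finset.mem_univ_val _, ?_⟩
    have ha' : a = ij0.1 ∨ a = ij0.2 := by simpa using ha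
    rcases ha' with rfl | rfl
    · exact e1.symm
    · exact e2.symm
  rwa [Finset.card_pair hne0] at this

end RM

lemma crit_finite {P Q : ℂ[X]} (hc : IsCoprime P Q) (hd : 1 ≤ max P.natDegree Q.natDegree) :
    {c : Sphere | 2 ≤ (fiber P Q (ratEval P Q c)).count c}.Finite := by
  have hw : wronskian P Q ≠ 0 := by
    intro h0
    obtain ⟨h1, h2⟩ := hc.wronskian_eq_zero_iff.1 h0
    have h1' := derivative_eq_zero.1 h1
    have h2' := derivative_eq_zero.1 h2
    omega
  refine Set.Finite.subset ((Set.finite_singleton (OnePoint.infty : Sphere)).union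
    (((wronskian P Q).roots.toFinset.finite_toSet).image fun z : ℂ => (z : Sphere))) ?_
  intro c hcc
  induction c using OnePoint.rec with
  | infty => left; rfl
  | coe a =>
    right
    refine ⟨a, ?_, rfl⟩
    simp only [Finset.mem_coe, Multiset.mem_toFinset, mem_roots hw, IsRoot.def]
    have hcount : ∀ (s : Multiset ℂ) (n : ℕ), ((s.map fun z => (z : Sphere)) +
        Multiset.replicate n (OnePoint.infty : Sphere)).count (a : Sphere) = s.count a := by
      intro s n
      simp only [Multiset.bind_def, Multiset.pure_def, Multiset.bind_singleton, Multiset.map_id',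
        Multiset.count_add]
      rw [Multiset.count_map_eq_count' _ _ OnePoint.coe_injective, Multiset.count_replicate]
      simp
    have hdouble : ∀ W : ℂ[X], 2 ≤ W.roots.count a → W.eval a = 0 ∧ (derivative W).eval a = 0 := by
      intro W hW
      have hr : 1 < W.rootMultiplicity a := by rwa [count_roots] at hW
      have hW0 : W ≠ 0 := by rintro rfl; simp at hW
      exact (one_lt_rootMultiplicity_iff_isRoot hW0).1 hr
    have h2 : 2 ≤ (fiber P Q (ratEval P Q (a : Sphere))).count (a : Sphere) := hcc
    by_cases hQ : Q.eval a = 0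
    · have : ratEval P Q (a : Sphere) = OnePoint.infty := if_pos hQ
      rw [this] at h2
      have h3 := hdouble Q ((hcount _ _).symm ▸ h2)
      simp [wronskian, h3.1, h3.2]
    · have : ratEval P Q (a : Sphere) = ((P.eval a / Q.eval a : ℂ) : Sphere) := if_neg hQ
      rw [this] at h2
      have h3 := hdouble (P - C (P.eval a / Q.eval a) * Q) ((hcount _ _).symm ▸ h2)
      simp only [derivative_sub, eval_sub, derivative_mul, derivative_C, eval_add, eval_mul, eval_C,
        zero_mul, eval_zero, zero_add] at h3
      simp only [wronskian, eval_sub, eval_mul]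
      have h4 := h3.2
      field_simp at h4
      linear_combination (-1) * h4

end

section
/-! ### Part 4: averaging operators -/
attribute [local instance] sphMS

@[reducible] def sphMeas : MeasurableSpace Sphere := borel Sphere
attribute [local instance] sphMeas
lemma sphBorel : BorelSpace Sphere := ⟨rfl⟩
attribute [local instance] sphBorel

def Av (v : Fin N) : Sphere → ℝ := Classical.epsilon fun A =>
  ∃ B, RM (ratEval (p v) (q v)) (fiber (p v) (q v)) (degR p q v) A B
def Bv (v : Fin N) : Sphere → ℝ := Classical.epsilon fun B =>
  RM (ratEval (p v) (q v)) (fiber (p v) (q v)) (degR p q v) (Av p q v) B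

/-- operator averaging over preimages -/
def GS : Module.End ℝ (Sphere → ℝ) where
  toFun φ := fun z => (Dtot p q : ℝ)⁻¹ * ∑ v, ((fiber (p v) (q v) z).map φ).sum
  map_add' φ ψ := by
    funext z
    simp only [Pi.add_apply, Multiset.sum_map_add, Finset.sum_add_distrib, mul_add]
  map_smul' r φ := by
    funext z
    simp only [Pi.smul_apply, smul_eq_mul, Multiset.sum_map_mul_left, ← Finset.mul_sum,
      RingHom.id_apply]
    ring

/-- operator averaging over images -/
def Pf : Module.End ℝ (Sphere → ℝ) where
  toFun f := fun c => (Dtot p q : ℝ)⁻¹ * ∑ v, f (ratEval (p v) (q v) c)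
  map_add' φ ψ := by
    funext z
    simp only [Pi.add_apply, Finset.sum_add_distrib, mul_add]
  map_smul' r φ := by
    funext z
    simp only [Pi.smul_apply, smul_eq_mul, ← Finset.mul_sum, RingHom.id_apply]
    ring

lemma GS_apply (φ : Sphere → ℝ) (z) : GS p q φ z =
    (Dtot p q : ℝ)⁻¹ * ∑ v, ((fiber (p v) (q v) z).map φ).sum := rfl
lemma Pf_apply (φ : Sphere → ℝ) (z) : Pf p q φ z =
    (Dtot p q : ℝ)⁻¹ * ∑ v, φ (ratEval (p v) (q v) z) := rfl

def kp (z c : Sphere) : ℝ := Real.log (sg z c)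
lemma kp_comm (z c) : kp z c = kp c z := by rw [kp, sg_comm, kp]
lemma kp_nonpos (z c) : kp z c ≤ 0 := Real.log_nonpos (sg_nonneg _ _) (sg_le_one _ _)

def Uf (c : Sphere) : ℝ := (Dtot p q : ℝ)⁻¹ * ∑ v, Real.log (Bv p q v c)
def Hf (z : Sphere) : ℝ := (Dtot p q : ℝ)⁻¹ * ∑ v, Real.log (Av p q v z)
def un (n : ℕ) : Sphere → ℝ := ∑ k ∈ Finset.range n, (Pf p q ^ k) (Uf p q)
def th : ℝ := (N : ℝ) / (Dtot p q : ℝ)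
def Hn : ℕ → Sphere → ℝ
  | 0 => 0
  | n + 1 => GS p q (Hn n) + (th p q) ^ n • Hf p q

section
variable {p q} (hg : Good p q)
include hg

lemma RMv (v : Fin N) :
    RM (ratEval (p v) (q v)) (fiber (p v) (q v)) (degR p q v) (Av p q v) (Bv p q v) := by
  have h1 := Classical.epsilon_spec (exists_RM (hg.2.1 v) (hg.2.2.1 v))
  exact Classical.epsilon_spec h1

lemma N_lt_D : N < Dtot p q := by
  obtain ⟨h1, h2, h3, ⟨i, hi⟩⟩ := hg
  have : ∑ i : Fin N, 1 < Dtot p q := Finset.sum_lt_sum (fun i _ => h3 i) ⟨i, Finset.mem_univ _, hi⟩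
  simpa using this

lemma D_pos : (0 : ℝ) < Dtot p q := by
  have := N_lt_D hg
  exact_mod_cast (Nat.zero_le N).trans_lt this

lemma one_lt_D : (1 : ℝ) < Dtot p q := by
  have := N_lt_D hg
  have := hg.1
  exact_mod_cast (by omega : 1 < Dtot p q)

lemma th_nonneg : 0 ≤ th p q := by unfold th; positivity

lemma th_lt : th p q < 1 := by
  rw [th, div_lt_one (D_pos hg)]; exact_mod_cast N_lt_D hg

lemma GS_const (r : ℝ) : GS p q (fun _ => r) = fun _ => r := by
  funext z
  have : ∀ v, ((fiber (p v) (q v) z).map fun _ => r).sum = degR p q v * r := fun v => by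
    simp [(RMv hg v).card]
  rw [GS_apply]
  simp only [this, ← Finset.sum_mul]
  rw [← Nat.cast_sum, ← Dtot, ← mul_assoc, inv_mul_cancel₀ (D_pos hg).ne', one_mul]

lemma GSn_const (r : ℝ) (n : ℕ) : (GS p q ^ n) (fun _ => r) = fun _ => r := by
  induction n with
  | zero => rfl
  | succ n ih => rw [pow_succ, Module.End.mul_apply, GS_const hg, ih]

lemma GS_mono {φ ψ : Sphere → ℝ} (h : ∀ z, φ z ≤ ψ z) (z) : GS p q φ z ≤ GS p q ψ z := by
  rw [GS_apply, GS_apply]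
  refine mul_le_mul_of_nonneg_left (Finset.sum_le_sum fun v _ => ?_) (inv_nonneg.2 (D_pos hg).le)
  exact Multiset.sum_map_le_sum_map _ _ fun y _ => h y

lemma GSn_mono {φ ψ : Sphere → ℝ} (h : ∀ z, φ z ≤ ψ z) (n : ℕ) (z) :
    (GS p q ^ n) φ z ≤ (GS p q ^ n) ψ z := by
  induction n generalizing φ ψ with
  | zero => exact h z
  | succ n ih =>
    rw [pow_succ, Module.End.mul_apply, Module.End.mul_apply]
    exact ih (GS_mono hg h)

lemma GS_cont {φ : Sphere → ℝ} (h : Continuous φ) : Continuous (GS p q φ) := by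
  refine continuous_const.mul (continuous_finsetSum _ fun v _ => ?_)
  have h2 : Continuous fun x : Unit × Sphere => φ x.2 := h.comp continuous_snd
  have := (RMv hg v).continuous_sum h2
  exact this.comp (continuous_const.prodMk continuous_id : Continuous fun z : Sphere => ((), z))

lemma GSn_cont {φ : Sphere → ℝ} (h : Continuous φ) (n : ℕ) : Continuous ((GS p q ^ n) φ) := by
  induction n with
  | zero => exact h
  | succ n ih => rw [pow_succ', Module.End.mul_apply]; exact GS_cont hg ih

lemma GSn_abs {φ : Sphere → ℝ} {C : ℝ} (h : ∀ z, |φ z| ≤ C) (n : ℕ) (z) :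
    |(GS p q ^ n) φ z| ≤ C := by
  have h1 := GSn_mono hg (φ := φ) (ψ := fun _ => C) (fun z => (abs_le.1 (h z)).2) n z
  have h2 := GSn_mono hg (φ := fun _ => -C) (ψ := φ) (fun z => (abs_le.1 (h z)).1) n z
  rw [GSn_const hg] at h1 h2
  exact abs_le.2 ⟨h2, h1⟩

lemma Pf_const (r : ℝ) : Pf p q (fun _ => r) = fun _ => th p q * r := by
  funext c
  simp [Pf_apply, th]; ring

lemma Pf_cont {φ : Sphere → ℝ} (h : Continuous φ) : Continuous (Pf p q φ) := by
  refine continuous_const.mul (continuous_finsetSum _ fun v _ => h.comp (RMv hg v).cont)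

lemma Pfn_cont {φ : Sphere → ℝ} (h : Continuous φ) (n : ℕ) : Continuous ((Pf p q ^ n) φ) := by
  induction n with
  | zero => exact h
  | succ n ih => rw [pow_succ', Module.End.mul_apply]; exact Pf_cont hg ih

lemma Pfn_const (r : ℝ) (n : ℕ) : (Pf p q ^ n) (fun _ => r) = fun _ => th p q ^ n * r := by
  induction n with
  | zero => simp
  | succ n ih => rw [pow_succ', Module.End.mul_apply, ih, Pf_const hg, pow_succ']; simp only [mul_assoc]

omit hg in
lemma itComp_succ' (w : ℕ → Fin N) (n : ℕ) (c : Sphere) :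
    itComp p q w (n + 1) c = itComp p q (shiftW w) n (ratEval (p (w 0)) (q (w 0)) c) := by
  induction n with
  | zero => rfl
  | succ n ih =>
    have : itComp p q w (n + 1 + 1) c = ratEval (p (w (n + 1))) (q (w (n + 1))) (itComp p q w (n + 1) c) := rfl
    rw [this, ih]; rfl

omit hg in
@[simp] lemma shift_cons (v : Fin N) (w : ℕ → Fin N) : shiftW (consW v w) = w := by
  funext n; simp [shiftW, consW]

omit hg in
@[simp] lemma cons_zero (v : Fin N) (w : ℕ → Fin N) : consW v w 0 = v := by simp [consW]

omit hg in
@[simp] lemma cons_shift (w : ℕ → Fin N) : consW (w 0) (shiftW w) = w := by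
  funext n
  rcases n with _ | n <;> simp [shiftW, consW]

lemma Pfn_le {f : Sphere → ℝ} {M : ℝ} (n : ℕ) {c : Sphere} (h : ∀ w, f (itComp p q w n c) ≤ M) :
    (Pf p q ^ n) f c ≤ th p q ^ n * M := by
  induction n generalizing c with
  | zero =>
    obtain ⟨h1, -⟩ := hg
    simpa [itComp] using h fun _ => ⟨0, h1⟩
  | succ n ih =>
    rw [pow_succ', Module.End.mul_apply, Pf_apply]
    have : ∀ v ∈ Finset.univ, (Pf p q ^ n) f (ratEval (p v) (q v) c) ≤ th p q ^ n * M := by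
      intro v _
      refine ih fun w => ?_
      have := h (consW v w)
      rw [itComp_succ'] at this
      simpa using this
    refine (mul_le_mul_of_nonneg_left (Finset.sum_le_sum this) (inv_nonneg.2 (D_pos hg).le)).trans ?_
    simp only [Finset.sum_const, Finset.card_univ, Fintype.card_fin, nsmul_eq_mul, th, pow_succ]
    apply le_of_eq; ring

lemma Pfn_abs {f : Sphere → ℝ} {M : ℝ} (n : ℕ) (h : ∀ z, |f z| ≤ M) (c : Sphere) :
    |(Pf p q ^ n) f c| ≤ th p q ^ n * M := by
  have h1 := Pfn_le hg n (c := c) fun w => (abs_le.1 (h (itComp p q w n c))).2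
  have h2 := Pfn_le hg (f := -f) n (c := c) (M := M) fun w => by
    have := (abs_le.1 (h (itComp p q w n c))).1
    simp only [Pi.neg_apply]; linarith
  rw [map_neg] at h2
  simp only [Pi.neg_apply] at h2
  exact abs_le.2 ⟨by linarith, h1⟩

lemma Uf_cont : Continuous (Uf p q) :=
  continuous_const.mul (continuous_finsetSum _ fun v _ =>
    (RMv hg v).Bcont.log fun c => ((RMv hg v).Bpos c).ne')

lemma Uf_bdd : ∃ C, 0 ≤ C ∧ ∀ c, |Uf p q c| ≤ C := by
  obtain ⟨C, hC⟩ := (isCompact_univ (X := Sphere)).exists_bound_of_continuousOn (Uf_cont hg).continuousOn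
  exact ⟨C, (abs_nonneg _).trans (hC OnePoint.infty trivial), fun c => hC c trivial⟩

lemma un_cont (n : ℕ) : Continuous (un p q n) := by
  unfold un
  have : (∑ k ∈ Finset.range n, (Pf p q ^ k) (Uf p q)) = fun c => ∑ k ∈ Finset.range n, (Pf p q ^ k) (Uf p q) c := by
    funext c; simp
  rw [this]
  exact continuous_finsetSum _ fun k _ => Pfn_cont hg (Uf_cont hg) k

/-- `un` is uniformly bounded and Cauchy in the uniform sense -/
lemma un_bdd : ∃ C, 0 ≤ C ∧ (∀ n c, |un p q n c| ≤ C) ∧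
    ∀ n c, |un p q (n + 1) c - un p q n c| ≤ C * th p q ^ n := by
  obtain ⟨C, hC, hU⟩ := Uf_bdd hg
  have ht := th_lt hg
  have ht0 := th_nonneg hg
  have h1 : ∀ k c, |(Pf p q ^ k) (Uf p q) c| ≤ C * th p q ^ k := fun k c => by
    have := Pfn_abs hg k hU c; linarith
  have h2 : ∀ n c, |un p q n c| ≤ C * (1 - th p q)⁻¹ := by
    intro n c
    rw [un, Finset.sum_apply]
    refine (Finset.abs_sum_le_sum_abs _ _).trans ((Finset.sum_le_sum fun k _ => h1 k c).trans ?_)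
    rw [← Finset.mul_sum, ← tsum_geometric_of_lt_one ht0 ht]
    gcongr
    exact (summable_geometric_of_lt_one ht0 ht).sum_le_tsum _ fun i _ => by positivity
  have h3 : 1 ≤ (1 - th p q)⁻¹ := (one_le_inv₀ (by linarith)).2 (by linarith)
  refine ⟨C * (1 - th p q)⁻¹, by positivity, h2, fun n c => ?_⟩
  have : un p q (n + 1) c - un p q n c = (Pf p q ^ n) (Uf p q) c := by
    simp [un, Finset.sum_range_succ]
  rw [this]
  refine (h1 n c).trans ?_
  gcongr
  nlinarith

lemma log_ki (v : Fin N) {z c : Sphere} (h : ratEval (p v) (q v) c ≠ z) :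
    ((fiber (p v) (q v) z).map fun y => kp y c).sum =
      kp z (ratEval (p v) (q v) c) + Real.log (Bv p q v c) - Real.log (Av p q v z) := by
  have H := RMv hg v
  have hc : c ∉ fiber (p v) (q v) z := fun h' => h (H.mem_fib.1 h')
  have h1 := congrArg Real.log (H.ki z c)
  have hp : ∀ s : Multiset Sphere, c ∉ s → Real.log (s.map fun y => sg y c).prod = (s.map fun y => kp y c).sum := by
    intro s
    induction s using Multiset.induction_on with
    | empty => simp
    | cons a s ih =>
      intro hs
      rw [Multiset.mem_cons, not_or] at hs
      simp only [Multiset.map_cons, Multiset.prod_cons, Multiset.sum_cons]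
      rw [Real.log_mul (sg_pos (Ne.symm hs.1)).ne' (fun h' => hs.2 (prod_sg_eq_zero.1 h')), ih hs.2, kp]
  rw [Real.log_mul (H.Apos z).ne' (fun h' => hc (prod_sg_eq_zero.1 h')),
    Real.log_mul (sg_pos h).ne' (H.Bpos c).ne', hp _ hc] at h1
  rw [kp_comm z, kp]
  linarith

lemma tendsto_cofinite (v : Fin N) : Tendsto (ratEval (p v) (q v)) cofinite cofinite := by
  refine Filter.Tendsto.cofinite_of_finite_preimage_singleton fun z => ?_
  refine (fiber (p v) (q v) z).toFinset.finite_toSet.subset fun y hy => ?_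
  simpa using (RMv hg v).mem_fib.2 hy

lemma Pf_congr {f g : Sphere → ℝ} (h : f =ᶠ[cofinite] g) : Pf p q f =ᶠ[cofinite] Pf p q g := by
  have : ∀ᶠ c in cofinite, ∀ v, f (ratEval (p v) (q v) c) = g (ratEval (p v) (q v) c) :=
    eventually_all.2 fun v => (tendsto_cofinite hg v).eventually h
  filter_upwards [this] with c hc
  simp [Pf_apply, hc]

lemma Pfn_congr {f g : Sphere → ℝ} (h : f =ᶠ[cofinite] g) (n : ℕ) :
    (Pf p q ^ n) f =ᶠ[cofinite] (Pf p q ^ n) g := by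
  induction n with
  | zero => exact h
  | succ n ih => rw [pow_succ', Module.End.mul_apply, Module.End.mul_apply]; exact Pf_congr hg ih

lemma one_step (z : Sphere) : (fun c => GS p q (fun y => kp y c) z) =ᶠ[cofinite]
    (Pf p q (kp z) + Uf p q - fun _ => Hf p q z) := by
  have : ∀ᶠ c in cofinite, ∀ v, ratEval (p v) (q v) c ≠ z :=
    eventually_all.2 fun v => (tendsto_cofinite hg v).eventually
      ((Set.finite_singleton z).eventually_cofinite_notMem)
  filter_upwards [this] with c hc
  simp only [GS_apply, Pi.add_apply, Pi.sub_apply, Pf_apply, Uf, Hf]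
  rw [Finset.sum_congr rfl fun v _ => log_ki hg v (hc v)]
  rw [Finset.sum_sub_distrib, Finset.sum_add_distrib]
  ring

lemma n_step (n : ℕ) : ∀ z : Sphere, ∀ᶠ c in cofinite, (GS p q ^ n) (fun y => kp y c) z =
    (Pf p q ^ n) (kp z) c + un p q n c - Hn p q n z := by
  induction n with
  | zero => intro z; simp [un, Hn]
  | succ n ih =>
    intro z
    have h1 : ∀ᶠ c in cofinite, ∀ v, ∀ y ∈ fiber (p v) (q v) z, (GS p q ^ n) (fun y => kp y c) y =
        (Pf p q ^ n) (kp y) c + un p q n c - Hn p q n y := by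
      refine eventually_all.2 fun v => ?_
      have := (eventually_all_finset (fiber (p v) (q v) z).toFinset).2
        (fun y _ => ih y)
      simpa using this
    have h2 := Pfn_congr hg (one_step hg z) n
    filter_upwards [h1, h2] with c hc1 hc2
    have h3 : (Pf p q ^ n) (fun c => GS p q (fun y => kp y c) z) c =
        GS p q (fun y => (Pf p q ^ n) (kp y) c) z := by
      have e : (fun c => GS p q (fun y => kp y c) z) =
          (Dtot p q : ℝ)⁻¹ • ∑ v, ((fiber (p v) (q v) z).map kp).sum := by
        funext c
        simp only [GS_apply, Pi.smul_apply, smul_eq_mul, Finset.sum_apply]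
        congr 1
        refine Finset.sum_congr rfl fun v _ => ?_
        generalize fiber (p v) (q v) z = s
        induction s using Multiset.induction_on with
        | empty => simp
        | cons a s ih => simp [ih]
      rw [e, map_smul, map_sum]
      simp only [GS_apply, Pi.smul_apply, smul_eq_mul, Finset.sum_apply]
      congr 1
      refine Finset.sum_congr rfl fun v _ => ?_
      generalize fiber (p v) (q v) z = s
      induction s using Multiset.induction_on with
      | empty => simp
      | cons a s ih => simp [ih]
    have h4 : GS p q ((GS p q ^ n) (fun y => kp y c)) z =
        GS p q (fun y => (Pf p q ^ n) (kp y) c + un p q n c - Hn p q n y) z := by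
      rw [GS_apply, GS_apply]
      congr 1
      refine Finset.sum_congr rfl fun v _ => ?_
      congr 1
      exact Multiset.map_congr rfl fun y hy => hc1 v y hy
    have h5 : (fun y => (Pf p q ^ n) (kp y) c + un p q n c - Hn p q n y) =
        (fun y => (Pf p q ^ n) (kp y) c) + (fun _ => un p q n c) - Hn p q n := rfl
    have h6 : (fun _ : Sphere => Hf p q z) = fun _ => Hf p q z := rfl
    rw [map_sub, map_add, Pfn_const hg, ← Module.End.mul_apply, ← pow_succ, h3] at hc2
    rw [pow_succ', Module.End.mul_apply, h4, h5, map_sub, map_add, GS_const hg]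
    simp only [Pi.sub_apply, Pi.add_apply, Hn, Pi.smul_apply, smul_eq_mul, un,
      Finset.sum_range_succ, Finset.sum_apply] at *
    rw [hc2]; ring

lemma GSn_integral {m : Measure Sphere} (n : ℕ) : ∀ {f : Sphere → Sphere → ℝ},
    (∀ z, Integrable (f z) m) → ∀ z, Integrable (fun c => (GS p q ^ n) (fun y => f y c) z) m ∧
      (GS p q ^ n) (fun y => ∫ c, f y c ∂m) z = ∫ c, (GS p q ^ n) (fun y => f y c) z ∂m := by
  induction n with
  | zero => intro f hf z; exact ⟨hf z, rfl⟩
  | succ n ih =>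
    intro f hf z
    have hs : ∀ s : Multiset Sphere, Integrable (fun c => (s.map fun y => f y c).sum) m ∧
        (s.map fun y => ∫ c, f y c ∂m).sum = ∫ c, (s.map fun y => f y c).sum ∂m := by
      intro s
      induction s using Multiset.induction_on with
      | empty => simp
      | cons a s ih =>
        simp only [Multiset.map_cons, Multiset.sum_cons]
        exact ⟨(hf a).add ih.1, by rw [integral_add (hf a) ih.1, ih.2]⟩
    have h1 : ∀ z, Integrable (fun c => GS p q (fun y => f y c) z) m := fun z =>
      (integrable_finsetSum _ fun v _ => (hs _).1).const_mul _
    have h2 : GS p q (fun y => ∫ c, f y c ∂m) = fun z => ∫ c, GS p q (fun y => f y c) z ∂m := by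
      funext z
      simp only [GS_apply]
      rw [integral_const_mul, integral_finsetSum _ fun v _ => (hs _).1]
      congr 1
      exact Finset.sum_congr rfl fun v _ => (hs _).2
    rw [pow_succ]
    simp only [Module.End.mul_apply]
    rw [h2]
    exact ih h1 z

omit hg in
def Km (m : Measure Sphere) (z : Sphere) : ℝ := ∫ c, kp z c ∂m

def en (p q : Fin N → ℂ[X]) (m : Measure Sphere) (n : ℕ) (z : Sphere) : ℝ := ∫ c, (Pf p q ^ n) (kp z) c ∂m

lemma main_id {m : Measure Sphere} [IsProbabilityMeasure m] [NullSingletonClass m]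
    (hm : ∀ z, Integrable (kp z) m) (n : ℕ) (z : Sphere) :
    Integrable ((Pf p q ^ n) (kp z)) m ∧
      (GS p q ^ n) (Km m) z = en p q m n z + ∫ c, un p q n c ∂m - Hn p q n z := by
  obtain ⟨h1, h2⟩ := GSn_integral hg n hm z
  have h3 : ∀ᵐ c ∂m, (GS p q ^ n) (fun y => kp y c) z =
      (Pf p q ^ n) (kp z) c + un p q n c - Hn p q n z := by
    have := n_step hg n z
    rw [Filter.eventually_cofinite] at this
    exact this.measure_zero m
  have hu : Integrable (un p q n) m := by
    refine (un_cont hg n).integrable_of_hasCompactSupport ?_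
    exact HasCompactSupport.of_compactSpace _
  have h4 : Integrable ((Pf p q ^ n) (kp z)) m := by
    have : Integrable (fun c => (GS p q ^ n) (fun y => kp y c) z - un p q n c + Hn p q n z) m :=
      (h1.sub hu).add (integrable_const _)
    refine this.congr ?_
    filter_upwards [h3] with c hc
    rw [hc]; ring
  refine ⟨h4, ?_⟩
  have : (GS p q ^ n) (Km m) z = ∫ c, (GS p q ^ n) (fun y => kp y c) z ∂m := h2
  rw [this, integral_congr_ae h3,
    integral_sub (f := fun c => (Pf p q ^ n) (kp z) c + un p q n c) (h4.add hu) (integrable_const _),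
    integral_add h4 hu]
  simp [en]

lemma en_nonpos (m : Measure Sphere) (n : ℕ) (z : Sphere) : en p q m n z ≤ 0 := by
  refine integral_nonpos fun c => ?_
  have := Pfn_le hg n (c := c) fun w => kp_nonpos z (itComp p q w n c)
  simpa using this

end

end

section
/-! ### Part 5: circle measures -/
attribute [local instance] sphMS
attribute [local instance] sphMeas
attribute [local instance] sphBorel

def ang : Measure ℝ := (ENNReal.ofReal (2 * Real.pi))⁻¹ • volume.restrict (Set.Ioc 0 (2 * Real.pi))
def cmap (a : ℂ) (r : ℝ) (θ : ℝ) : Sphere := (circleMap a r θ : Sphere)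
def cm (a : ℂ) (r : ℝ) : Measure Sphere := ang.map (cmap a r)

lemma cmap_cont (a : ℂ) (r : ℝ) : Continuous (cmap a r) :=
  OnePoint.continuous_coe.comp (continuous_circleMap a r)

lemma two_pi_ne : ENNReal.ofReal (2 * Real.pi) ≠ 0 := by
  simp [Real.pi_pos]

instance ang_prob : IsProbabilityMeasure ang := ⟨by
  simp [ang]
  rw [ENNReal.inv_mul_cancel]
  · simp [Real.pi_pos]
  · exact ENNReal.mul_ne_top (by simp) (by simp)⟩

instance cm_prob (a : ℂ) (r : ℝ) : IsProbabilityMeasure (cm a r) :=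
  Measure.isProbabilityMeasure_map (cmap_cont a r).aemeasurable

lemma cm_null (a : ℂ) {r : ℝ} (hr : r ≠ 0) : NullSingletonClass (cm a r) := ⟨fun z => by
  rw [cm, Measure.map_apply (cmap_cont a r).measurable (measurableSet_singleton z)]
  have h1 : (cmap a r ⁻¹' {z}).Countable := by
    have : cmap a r ⁻¹' {z} = circleMap a r ⁻¹' ((↑) ⁻¹' ({z} : Set Sphere)) := rfl
    rw [this]
    refine Set.Countable.preimage_circleMap ?_ a hr
    refine Set.Subsingleton.countable fun x hx y hy => ?_
    simp only [Set.mem_preimage, Set.mem_singleton_iff] at hx hy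
    exact OnePoint.coe_injective (hx.trans hy.symm)
  have : volume.restrict (Set.Ioc 0 (2 * Real.pi)) (cmap a r ⁻¹' {z}) = 0 :=
    Measure.absolutelyContinuous_of_le Measure.restrict_le_self (h1.measure_zero _)
  simp [ang, this]⟩

lemma ang_integrable {g : ℝ → ℝ} : Integrable g ang ↔ IntervalIntegrable g volume 0 (2 * Real.pi) := by
  rw [ang, integrable_smul_measure (by simpa using ENNReal.mul_ne_top (by simp) ENNReal.ofReal_ne_top) (by simp [Real.pi_pos]),
    intervalIntegrable_iff_integrableOn_Ioc_of_le Real.two_pi_pos.le]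
  rfl

lemma ang_integral {g : ℝ → ℝ} : ∫ t, g t ∂ang = (2 * Real.pi)⁻¹ * ∫ t in (0:ℝ)..(2 * Real.pi), g t := by
  rw [ang, integral_smul_measure, intervalIntegral.integral_of_le Real.two_pi_pos.le]
  simp [Real.pi_pos.le]

lemma cm_integrable {a : ℂ} {r : ℝ} {f : Sphere → ℝ} (hf : Measurable f) :
    Integrable f (cm a r) ↔ CircleIntegrable (fun z : ℂ => f z) a r := by
  rw [cm, integrable_map_measure hf.aestronglyMeasurable (cmap_cont a r).aemeasurable, ang_integrable]
  rfl

lemma cm_integral {a : ℂ} {r : ℝ} {f : Sphere → ℝ} (hf : Measurable f) :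
    ∫ z, f z ∂(cm a r) = Real.circleAverage (fun z : ℂ => f z) a r := by
  rw [cm, integral_map (cmap_cont a r).aemeasurable hf.aestronglyMeasurable, ang_integral]
  rfl

lemma cm_ae (a : ℂ) (r : ℝ) (hr : 0 ≤ r) : ∀ᵐ z ∂(cm a r), ∃ b : ℂ, z = (b : Sphere) ∧ ‖b - a‖ = r := by
  have hc : IsClosed (((↑) : ℂ → Sphere) '' Metric.sphere a r) :=
    ((isCompact_sphere a r).image OnePoint.continuous_coe).isClosed
  have : ∀ᵐ z ∂(cm a r), z ∈ (((↑) : ℂ → Sphere) '' Metric.sphere a r) := by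
    refine (ae_map_iff (p := fun z => z ∈ (((↑) : ℂ → Sphere) '' Metric.sphere a r)) (cmap_cont a r).aemeasurable hc.measurableSet).2 ?_
    exact Eventually.of_forall fun θ => ⟨_, circleMap_mem_sphere a hr θ, rfl⟩
  filter_upwards [this] with z hz
  obtain ⟨b, hb, rfl⟩ := hz
  exact ⟨b, rfl, by simpa [dist_eq_norm] using hb⟩

lemma kp_meas_joint : Measurable fun x : Sphere × Sphere => kp x.1 x.2 :=
  Real.measurable_log.comp continuous_sg.measurable

lemma kp_meas (z : Sphere) : Measurable (kp z) :=
  Real.measurable_log.comp (continuous_sg.comp (Continuous.prodMk_right z)).measurable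

def nn (b : ℂ) : ℝ := n2 (b, 1)
lemma nn_one_le (b : ℂ) : 1 ≤ nn b := nl_one_le (b : Sphere)
lemma nn_cont : Continuous nn := continuous_n2.comp (by fun_prop)
lemma nn_lip (b c : ℂ) : nn b ≤ nn c + ‖b - c‖ := by
  have h1 : ((b, 1) : ℂ × ℂ) = (c, 1) + (b - c, 0) := by simp
  have h2 : n2 ((b - c, 0) : ℂ × ℂ) = ‖b - c‖ := by simp [n2_eq]
  rw [nn, h1, ← h2]; exact n2_add _ _

lemma sg_coe (b c : ℂ) : sg b c = ‖b - c‖ / (nn b * nn c) := by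
  simp [sg, wdg, nn]

lemma sg_inf (c : ℂ) : sg OnePoint.infty c = (nn c)⁻¹ := by
  simp [sg, wdg, nn, n2_infty]

lemma kp_coe {b c : ℂ} (h : c ≠ b) : kp b c = Real.log ‖c - b‖ - Real.log (nn b) - Real.log (nn c) := by
  have hb := nn_one_le b
  have hc := nn_one_le c
  have : ‖b - c‖ ≠ 0 := by simpa [sub_eq_zero] using h.symm
  rw [kp, sg_coe, Real.log_div this (by positivity), Real.log_mul (by positivity) (by positivity), norm_sub_rev]
  ring

lemma kp_inf (c : ℂ) : kp OnePoint.infty c = - Real.log (nn c) := by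
  rw [kp, sg_inf, Real.log_inv]

lemma ae_finite_ne (a : ℂ) {r : ℝ} (hr : r ≠ 0) (b : ℂ) : ∀ᵐ θ ∂ang, circleMap a r θ ≠ b := by
  have := cm_null a hr
  have h : ∀ᵐ z ∂(cm a r), z ≠ (b : Sphere) := by
    rw [ae_iff]; simpa using this.measure_singleton (b : Sphere)
  have h2 := ae_of_ae_map (cmap_cont a r).aemeasurable h
  filter_upwards [h2] with θ hθ h3
  exact hθ (by simp [cmap, h3])

/-- average of `log n` -/
def cC (a : ℂ) (r : ℝ) : ℝ := ∫ θ, Real.log (nn (circleMap a r θ)) ∂ang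

lemma lognn_cont : Continuous fun b => Real.log (nn b) :=
  nn_cont.log fun b => by linarith [nn_one_le b]

lemma lognn_int (a : ℂ) (r : ℝ) : Integrable (fun θ => Real.log (nn (circleMap a r θ))) ang :=
  ang_integrable.2 ((lognn_cont.comp (continuous_circleMap a r)).intervalIntegrable _ _)

lemma log_int (a : ℂ) (r : ℝ) (b : ℂ) : Integrable (fun θ => Real.log ‖circleMap a r θ - b‖) ang :=
  ang_integrable.2 (circleIntegrable_log_norm_sub_const (a := b) (c := a) r)

lemma log_avg (a : ℂ) {r : ℝ} (hr : 0 < r) (b : ℂ) :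
    ∫ θ, Real.log ‖circleMap a r θ - b‖ ∂ang = Real.log (max ‖b - a‖ r) := by
  have h := circleAverage_log_norm_sub_const_eq_log_radius_add_posLog (a := b) (c := a) hr.ne'
  rw [ang_integral]
  rw [Real.circleAverage_def, smul_eq_mul] at h
  rw [h, Real.posLog_eq_log_max_one (by positivity), ← Real.log_mul hr.ne' (by positivity),
    mul_max_of_nonneg _ _ hr.le, mul_one, ← mul_assoc, mul_inv_cancel₀ hr.ne', one_mul, norm_sub_rev,
    max_comm]

lemma kp_int (a : ℂ) {r : ℝ} (hr : 0 < r) (z : Sphere) : Integrable (kp z) (cm a r) := by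
  rw [cm, integrable_map_measure (kp_meas z).aestronglyMeasurable (cmap_cont a r).aemeasurable]
  induction z using OnePoint.rec with
  | infty =>
    refine (lognn_int a r).neg.congr (Eventually.of_forall fun θ => ?_)
    simp [cmap, kp_inf]
  | coe b =>
    refine (((log_int a r b).sub (integrable_const (Real.log (nn b)))).sub (lognn_int a r)).congr ?_
    filter_upwards [ae_finite_ne a hr.ne' b] with θ hθ
    simp [cmap, kp_coe hθ]

lemma Km_inf (a : ℂ) {r : ℝ} : Km (cm a r) OnePoint.infty = - cC a r := by
  rw [Km, cm, integral_map (cmap_cont a r).aemeasurable (kp_meas _).aestronglyMeasurable, cC, ← integral_neg]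
  simp [cmap, kp_inf]

lemma Km_coe (a : ℂ) {r : ℝ} (hr : 0 < r) (b : ℂ) :
    Km (cm a r) b = Real.log (max ‖b - a‖ r) - Real.log (nn b) - cC a r := by
  rw [Km, cm, integral_map (cmap_cont a r).aemeasurable (kp_meas _).aestronglyMeasurable, cC]
  rw [← log_avg a hr b]
  have : (fun θ => kp b (cmap a r θ)) =ᵐ[ang] fun θ => Real.log ‖circleMap a r θ - b‖ - Real.log (nn b) - Real.log (nn (circleMap a r θ)) := by
    filter_upwards [ae_finite_ne a hr.ne' b] with θ hθ
    simp [cmap, kp_coe hθ]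
  rw [integral_congr_ae this, integral_sub (f := fun θ => Real.log ‖circleMap a r θ - b‖ - Real.log (nn b)) ((log_int a r b).sub (integrable_const _)) (lognn_int a r),
    integral_sub (log_int a r b) (integrable_const _)]
  simp

lemma Km_cont (a : ℂ) {r : ℝ} (hr : 0 < r) : Continuous (Km (cm a r)) := by
  have hpos : ∀ u : ℂ × ℂ, u ≠ 0 → 0 < max ‖u.1 - a * u.2‖ (r * ‖u.2‖) := fun u hu => by
    by_cases h2 : u.2 = 0
    · have h1 : u.1 ≠ 0 := fun h1 => hu (Prod.ext h1 h2)
      simp [h2, h1]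
    · exact lt_max_of_lt_right (by positivity)
  have h := continuous_of_hom (f := fun u => Real.log (max ‖u.1 - a * u.2‖ (r * ‖u.2‖) / n2 u))
    (fun u hu => by
      refine ContinuousAt.log ?_ (div_pos (hpos u hu) (n2_pos hu)).ne'
      refine ContinuousAt.div (by fun_prop) continuous_n2.continuousAt (n2_pos hu).ne')
    (fun k hk u _ => by
      have hk' : 0 < ‖k‖ := norm_pos_iff.2 hk
      have : max ‖(k • u).1 - a * (k • u).2‖ (r * ‖(k • u).2‖) = ‖k‖ * max ‖u.1 - a * u.2‖ (r * ‖u.2‖) := by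
        rw [mul_max_of_nonneg _ _ hk'.le]
        simp only [Prod.smul_fst, Prod.smul_snd, smul_eq_mul, norm_mul r, norm_mul k u.2]
        congr 1
        · rw [← norm_mul]; congr 1; ring
        · ring
      simp only [this, n2_smul]
      rw [mul_div_mul_left _ _ hk'.ne'])
  refine (h.sub (continuous_const (y := cC a r))).congr fun z => ?_
  induction z using OnePoint.rec with
  | infty => simp [Km_inf, n2_infty]
  | coe b =>
    rw [Km_coe a hr]
    show Real.log (max ‖b - a * 1‖ (r * ‖(1:ℂ)‖) / n2 (b, 1)) - cC a r = _
    rw [mul_one, norm_one, mul_one, Real.log_div (by positivity) (by have := nn_one_le b; rw [nn] at this; positivity)]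
    rfl

/-- measures with continuous potential -/
structure Nice (m : Measure Sphere) : Prop where
  prob : IsProbabilityMeasure m
  null : NullSingletonClass m
  int : ∀ z, Integrable (kp z) m
  cont : Continuous (Km m)

lemma cm_nice (a : ℂ) {r : ℝ} (hr : 0 < r) : Nice (cm a r) :=
  ⟨inferInstance, cm_null a hr.ne', kp_int a hr, Km_cont a hr⟩

lemma Nice.bdd {m : Measure Sphere} (h : Nice m) : ∃ C, 0 ≤ C ∧ ∀ z, |Km m z| ≤ C := by
  obtain ⟨C, hC⟩ := (isCompact_univ (X := Sphere)).exists_bound_of_continuousOn h.cont.continuousOn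
  exact ⟨C, (abs_nonneg _).trans (hC OnePoint.infty trivial), fun c => hC c trivial⟩

lemma cont_int {f : Sphere → ℝ} (hf : Continuous f) (m : Measure Sphere) [IsProbabilityMeasure m] :
    Integrable f m := by
  obtain ⟨C, hC⟩ := (isCompact_univ (X := Sphere)).exists_bound_of_continuousOn hf.continuousOn
  exact Integrable.of_bound hf.aestronglyMeasurable C (Eventually.of_forall fun z => hC z trivial)

lemma Nice.prod_int {m m' : Measure Sphere} (h : Nice m) (h' : Nice m') :
    Integrable (Function.uncurry kp) (m.prod m') := by
  have := h.prob
  have := h'.prob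
  rw [integrable_prod_iff (by exact kp_meas_joint.aestronglyMeasurable)]
  refine ⟨Eventually.of_forall fun z => h'.int z, ?_⟩
  refine (cont_int h'.cont.neg m).congr (Eventually.of_forall fun z => ?_)
  simp only [Km, Pi.neg_apply, ← integral_neg, Function.uncurry]
  refine integral_congr_ae (Eventually.of_forall fun c => ?_)
  simp [abs_of_nonpos (kp_nonpos z c)]

lemma Nice.swap {m m' : Measure Sphere} (h : Nice m) (h' : Nice m') :
    ∫ z, Km m' z ∂m = ∫ z, Km m z ∂m' := by
  have := h.prob
  have := h'.prob
  have := integral_integral_swap (h.prod_int h')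
  simp only [Km]
  rw [this]
  simp only [kp_comm]

lemma logmax_cont (a : ℂ) {r : ℝ} (hr : 0 < r) : Continuous fun b : ℂ => Real.log (max ‖b - a‖ r) :=
  Continuous.log (by fun_prop) fun b => (lt_max_of_lt_right hr).ne'

lemma ang_cont_int {f : ℂ → ℝ} (hf : Continuous f) (a : ℂ) (r : ℝ) :
    Integrable (fun θ => f (circleMap a r θ)) ang :=
  ang_integrable.2 ((hf.comp (continuous_circleMap a r)).intervalIntegrable _ _)

lemma Km_int_cm (a : ℂ) {r : ℝ} (hr : 0 < r) (b : ℂ) {s : ℝ} :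
    ∫ z, Km (cm a r) z ∂(cm b s) = (∫ θ, Real.log (max ‖circleMap b s θ - a‖ r) ∂ang) - cC b s - cC a r := by
  rw [show cm b s = ang.map (cmap b s) from rfl, integral_map (cmap_cont b s).aemeasurable (Km_cont a hr).aestronglyMeasurable]
  simp only [cmap, Km_coe a hr]
  rw [integral_sub (f := fun θ => Real.log (max ‖circleMap b s θ - a‖ r) - Real.log (nn (circleMap b s θ)))
    ((ang_cont_int (logmax_cont a hr) b s).sub (lognn_int b s)) (integrable_const _),
    integral_sub (ang_cont_int (logmax_cont a hr) b s) (lognn_int b s)]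
  simp [cC]

lemma tail (a : ℂ) {r : ℝ} (hr : 0 < r) : ∃ L0 C1 : ℝ, 0 ≤ L0 ∧ 0 ≤ C1 ∧ ∀ y : Sphere, ∀ L : ℝ, 0 ≤ L →
    Integrable (fun c => max (-kp y c - (L + L0)) 0) (cm a r) ∧
      ∫ c, max (-kp y c - (L + L0)) 0 ∂(cm a r) ≤ C1 * Real.exp (-L) := by
  set M : ℝ := ‖a‖ + r + 1 with hM
  have hM1 : 1 ≤ M := by have := norm_nonneg a; linarith
  have hL0 : 0 ≤ Real.log (M * (M + 1)) := Real.log_nonneg (by nlinarith)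
  refine ⟨Real.log (M * (M + 1)), r⁻¹, hL0, by positivity, fun y L hL => ?_⟩
  set L0 := Real.log (M * (M + 1)) with hL0d
  have hint : Integrable (fun c => max (-kp y c - (L + L0)) 0) (cm a r) :=
    ((kp_int a hr y).neg.sub (integrable_const (L + L0))).pos_part
  refine ⟨hint, ?_⟩
  have hnn : ∀ θ, nn (circleMap a r θ) ≤ M := fun θ => by
    have h1 := nn_lip (circleMap a r θ) 0
    have h2 : nn 0 = 1 := by simp [nn, n2_eq]
    have h3 : ‖circleMap a r θ‖ ≤ ‖a‖ + r := by
      have : circleMap a r θ = a + (circleMap a r θ - a) := by ring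
      rw [this]
      refine (norm_add_le _ _).trans ?_
      simp [circleMap, abs_of_pos hr]
    simp only [sub_zero] at h1
    linarith
  have hmeas : AEStronglyMeasurable (fun c => max (-kp y c - (L + L0)) 0) (cm a r) := hint.1
  rw [cm, integral_map (cmap_cont a r).aemeasurable (by rw [← cm]; exact hmeas)]
  induction y using OnePoint.rec with
  | infty =>
    have : ∀ θ, max (-kp OnePoint.infty (cmap a r θ) - (L + L0)) 0 = 0 := fun θ => by
      rw [cmap, kp_inf, neg_neg]
      refine max_eq_right ?_
      have h1 := nn_one_le (circleMap a r θ)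
      have : Real.log (nn (circleMap a r θ)) ≤ L0 :=
        Real.log_le_log (by linarith) ((hnn θ).trans (by nlinarith))
      linarith
    simp only [this]
    simp; positivity
  | coe b =>
    set ε := Real.exp (-L) with hε
    have hε0 : 0 < ε := Real.exp_pos _
    have hε1 : ε ≤ 1 := Real.exp_le_one_iff.2 (by linarith)
    have hle : ∀ᵐ θ ∂ang, max (-kp b (cmap a r θ) - (L + L0)) 0 ≤
        Real.log (max ‖circleMap a r θ - b‖ ε) - Real.log ‖circleMap a r θ - b‖ := by
      filter_upwards [ae_finite_ne a hr.ne' b] with θ hθ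
      have hpos : 0 < ‖circleMap a r θ - b‖ := by simpa [sub_eq_zero] using hθ
      set c := circleMap a r θ with hc
      rw [cmap, kp_coe hθ]
      refine max_le ?_ (sub_nonneg.2 (Real.log_le_log hpos (le_max_left _ _)))
      have hb1 := nn_one_le b
      have hc1 := nn_one_le c
      have hmx : 0 < max ‖c - b‖ ε := lt_max_of_lt_right hε0
      have key : nn b * nn c * ε ≤ M * (M + 1) * max ‖c - b‖ ε := by
        have h1 := nn_lip b c
        rw [norm_sub_rev] at h1
        have h2 := le_max_left ‖c - b‖ ε
        have h3 := le_max_right ‖c - b‖ ε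
        have h4 := hnn θ
        have h5 : nn b * ε ≤ (M + 1) * max ‖c - b‖ ε := by
          nlinarith
        calc nn b * nn c * ε = nn c * (nn b * ε) := by ring
          _ ≤ M * ((M + 1) * max ‖c - b‖ ε) := by
            refine mul_le_mul h4 h5 (by positivity) (by linarith)
          _ = _ := by ring
      have := Real.log_le_log (by positivity) key
      rw [Real.log_mul (by positivity) (by positivity), Real.log_mul (by positivity) (by positivity),
        Real.log_mul (by positivity) hmx.ne', ← hL0d, hε, Real.log_exp] at this
      linarith
    have hi1 := ang_cont_int (logmax_cont b hε0) a r
    have hi2 := log_int a r b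
    have h1 := integral_mono_ae (hint.comp_aemeasurable (cmap_cont a r).aemeasurable) (hi1.sub hi2) hle
    refine h1.trans ?_
    simp only [Pi.sub_apply]
    rw [integral_sub hi1 hi2, log_avg a hr]
    have hsw := (cm_nice a hr).swap (cm_nice b hε0)
    rw [Km_int_cm _ hε0, Km_int_cm _ hr] at hsw
    have heq : ∫ θ, Real.log (max ‖circleMap a r θ - b‖ ε) ∂ang = ∫ θ, Real.log (max ‖circleMap b ε θ - a‖ r) ∂ang := by
      linarith
    rw [heq]
    have hX : 0 < max ‖b - a‖ r := lt_max_of_lt_right hr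
    have hbd : ∀ θ, Real.log (max ‖circleMap b ε θ - a‖ r) ≤ Real.log (max ‖b - a‖ r) + r⁻¹ * ε := fun θ => by
      have h2 : max ‖circleMap b ε θ - a‖ r ≤ max ‖b - a‖ r + ε := by
        refine max_le ?_ ((le_max_right _ _).trans (by linarith))
        have : circleMap b ε θ - a = (b - a) + (circleMap b ε θ - b) := by ring
        rw [this]
        refine (norm_add_le _ _).trans (add_le_add (le_max_left _ _) ?_)
        simp [circleMap, abs_of_pos hε0]
      have h3 : max ‖b - a‖ r + ε = max ‖b - a‖ r * (1 + ε / max ‖b - a‖ r) := by field_simp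
      refine (Real.log_le_log (lt_max_of_lt_right hr) h2).trans ?_
      rw [h3, Real.log_mul hX.ne' (by positivity)]
      have h4 := Real.log_le_sub_one_of_pos (x := 1 + ε / max ‖b - a‖ r) (by positivity)
      have h5 : ε / max ‖b - a‖ r ≤ ε / r := div_le_div_of_nonneg_left hε0.le hr (le_max_right _ _)
      rw [div_eq_mul_inv ε r] at h5
      linarith
    have := integral_mono (ang_cont_int (logmax_cont a hr) b ε) (integrable_const _) hbd
    simp only [integral_const, probReal_univ, one_smul] at this
    linarith

end

section
/-! ### Part 6: density of potentials -/
attribute [local instance] sphMS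
attribute [local instance] sphMeas
attribute [local instance] sphBorel

lemma log_lip {r x y : ℝ} (hr : 0 < r) (hx : r ≤ x) (hy : r ≤ y) : |Real.log x - Real.log y| ≤ |x - y| / r := by
  have key : ∀ x y : ℝ, r ≤ x → r ≤ y → y ≤ x → Real.log x - Real.log y ≤ (x - y) / r := fun x y hx hy h => by
    have hx0 := hr.trans_le hx
    have hy0 := hr.trans_le hy
    rw [← Real.log_div hx0.ne' hy0.ne']
    refine (Real.log_le_sub_one_of_pos (div_pos hx0 hy0)).trans ?_
    have : x / y - 1 = (x - y) / y := by field_simp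
    rw [this]
    exact div_le_div_of_nonneg_left (by linarith) hr hy
  rcases le_total y x with h | h
  · rw [abs_of_nonneg (sub_nonneg.2 (Real.log_le_log (hr.trans_le hy) h)), abs_of_nonneg (by linarith)]
    exact key x y hx hy h
  · rw [abs_sub_comm, abs_sub_comm x y, abs_of_nonneg (sub_nonneg.2 (Real.log_le_log (hr.trans_le hx) h)), abs_of_nonneg (by linarith)]
    exact key y x hy hx h

def KmC (a : ℂ) (r : ℝ) : C(Sphere, ℝ) :=
  if h : 0 < r then ⟨Km (cm a r), Km_cont a h⟩ else 0

lemma KmC_apply (a : ℂ) {r : ℝ} (hr : 0 < r) (z) : KmC a r z = Km (cm a r) z := by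
  simp [KmC, hr]

def bump (r t : ℝ) : ℝ := Real.log (max t r) - Real.log (max t (r / 2))

lemma bump_cont {r : ℝ} (hr : 0 < r) : Continuous (bump r) := by
  unfold bump
  refine (Continuous.log (by fun_prop) fun b => (lt_max_of_lt_right hr).ne').sub
    (Continuous.log (by fun_prop) fun b => (lt_max_of_lt_right (half_pos hr)).ne')

lemma bump_nonneg {r : ℝ} (hr : 0 < r) (t : ℝ) : 0 ≤ bump r t :=
  sub_nonneg.2 (Real.log_le_log (lt_max_of_lt_right (half_pos hr)) (max_le_max le_rfl (by linarith)))

lemma bump_zero {r t : ℝ} (hr : 0 < r) (h : r ≤ t) : bump r t = 0 := by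
  rw [bump, max_eq_left h, max_eq_left (by linarith), sub_self]

lemma bump_lip {r : ℝ} (hr : 0 < r) (s t : ℝ) : |bump r s - bump r t| ≤ 4 / r * |s - t| := by
  have h1 := log_lip hr (le_max_right s r) (le_max_right t r)
  have h2 := log_lip (half_pos hr) (le_max_right s (r/2)) (le_max_right t (r/2))
  have h3 := abs_max_sub_max_le_abs s t r
  have h4 := abs_max_sub_max_le_abs s t (r/2)
  have h5 := div_le_div_of_nonneg_right h3 hr.le
  have h6 := div_le_div_of_nonneg_right h4 (half_pos hr).le
  have : bump r s - bump r t = (Real.log (max s r) - Real.log (max t r)) - (Real.log (max s (r/2)) - Real.log (max t (r/2))) := by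
    unfold bump; ring
  rw [this]
  refine (abs_sub _ _).trans ?_
  have h7 : 0 ≤ |s - t| / r := by positivity
  have h8 : |s - t| / (r / 2) = 2 * (|s - t| / r) := by field_simp
  have h9 : 4 / r * |s - t| = 4 * (|s - t| / r) := by ring
  rw [h9]
  linarith

def Bf (r : ℝ) (a : ℂ) : C(Sphere, ℝ) :=
  KmC a r - KmC a (r / 2) + ContinuousMap.const _ (cC a r - cC a (r / 2))

lemma Bf_coe {r : ℝ} (hr : 0 < r) (a b : ℂ) : Bf r a b = bump r ‖b - a‖ := by
  simp only [Bf, ContinuousMap.add_apply, ContinuousMap.sub_apply, ContinuousMap.const_apply, KmC_apply a hr,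
    KmC_apply a (half_pos hr), Km_coe a hr, Km_coe a (half_pos hr), bump]
  ring

lemma Bf_inf {r : ℝ} (hr : 0 < r) (a : ℂ) : Bf r a OnePoint.infty = 0 := by
  simp only [Bf, ContinuousMap.add_apply, ContinuousMap.sub_apply, ContinuousMap.const_apply, KmC_apply a hr,
    KmC_apply a (half_pos hr), Km_inf]
  ring

lemma Bf_cont {r : ℝ} (hr : 0 < r) : Continuous (Bf r) := by
  refine (LipschitzWith.of_dist_le' (K := 4 / r) fun a a' => ?_).continuous
  have h4 : (0 : ℝ) ≤ 4 / r := by positivity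
  rw [ContinuousMap.dist_le (mul_nonneg h4 dist_nonneg)]
  intro z
  induction z using OnePoint.rec with
  | infty => rw [Bf_inf hr, Bf_inf hr, dist_self]; exact mul_nonneg h4 dist_nonneg
  | coe b =>
    rw [Bf_coe hr, Bf_coe hr, Real.dist_eq]
    refine (bump_lip hr _ _).trans ?_
    have : |‖b - a‖ - ‖b - a'‖| ≤ dist a a' := by
      refine (abs_norm_sub_norm_le _ _).trans ?_
      rw [dist_comm, dist_eq_norm]; apply le_of_eq; congr 1; ring
    exact mul_le_mul_of_nonneg_left this (by positivity)

lemma int_mem {E : Type*} [NormedAddCommGroup E] [NormedSpace ℝ E] [CompleteSpace E] (V : Submodule ℝ E)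
    (hV : IsClosed (V : Set E)) {F : ℂ → E} (hF : Continuous F) (hs : HasCompactSupport F) (hm : ∀ a, F a ∈ V) :
    ∃ g ∈ V, ∀ L : E →L[ℝ] ℝ, L g = ∫ a, L (F a) := by
  have : CompleteSpace V := hV.completeSpace_coe
  let F' : ℂ → V := fun a => ⟨F a, hm a⟩
  have hF' : Continuous F' := hF.subtype_mk _
  have hFs : HasCompactSupport F' := HasCompactSupport.intro hs.isCompact fun a ha => by
    have := image_eq_zero_of_notMem_tsupport ha
    exact Subtype.ext this
  have hFi : Integrable F' := hF'.integrable_of_hasCompactSupport hFs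
  exact ⟨_, (∫ a, F' a : V).2, fun L => ((L.comp V.subtypeL).integral_comp_comm hFi).symm⟩

section
variable {V : Submodule ℝ C(Sphere, ℝ)} (hV : IsClosed (V : Set C(Sphere, ℝ)))
  (h1 : ∀ r : ℝ, ContinuousMap.const Sphere r ∈ V)
  (hb : ∀ a : ℂ, ∀ r s : ℝ, 0 < r → 0 < s → KmC a r - KmC a s ∈ V)
include hV h1 hb

lemma Bf_mem {r : ℝ} (hr : 0 < r) (a : ℂ) : Bf r a ∈ V :=
  V.add_mem (hb a r _ hr (half_pos hr)) (h1 _)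

lemma conv_mem {f : ℂ → ℝ} (hf : Continuous f) (hs : HasCompactSupport f) {r : ℝ} (hr : 0 < r) :
    ∃ g ∈ V, g OnePoint.infty = 0 ∧ ∀ b : ℂ, g b = ∫ a, f a * bump r ‖b - a‖ := by
  obtain ⟨g, hg, hL⟩ := int_mem V hV (F := fun a => f a • Bf r a) (hf.smul (Bf_cont hr)) hs.smul_right
    (fun a => V.smul_mem _ (Bf_mem hV h1 hb hr a))
  have hev : ∀ z, g z = ∫ a, f a * Bf r a z := fun z => hL (ContinuousMap.evalCLM ℝ z)
  refine ⟨g, hg, ?_, fun b => ?_⟩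
  · rw [hev]; simp [Bf_inf hr]
  · rw [hev]; simp [Bf_coe hr]

lemma cs_mem {φ : C(Sphere, ℝ)} (h0 : φ OnePoint.infty = 0) (hs : HasCompactSupport fun a : ℂ => φ a) : φ ∈ V := by
  set f : ℂ → ℝ := fun a : ℂ => φ a with hfd
  have hf : Continuous f := φ.continuous.comp OnePoint.continuous_coe
  have huc := hs.uniformContinuous_of_continuous hf
  rw [← SetLike.mem_coe, ← hV.closure_eq, Metric.mem_closure_iff]
  intro ε hε
  obtain ⟨r, hr, hr2⟩ := Metric.uniformContinuous_iff.1 huc (ε / 2) (half_pos hε)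
  obtain ⟨g, hg, hg0, hgb⟩ := conv_mem hV h1 hb hf hs hr
  have hbc : Continuous fun a : ℂ => bump r ‖a‖ := (bump_cont hr).comp continuous_norm
  have hbs : HasCompactSupport fun a : ℂ => bump r ‖a‖ := by
    refine HasCompactSupport.intro (isCompact_closedBall (0 : ℂ) r) fun a ha => bump_zero hr ?_
    simp at ha; exact ha.le
  have hbi : ∀ b : ℂ, Integrable fun a : ℂ => bump r ‖b - a‖ := fun b =>
    (hbc.integrable_of_hasCompactSupport hbs).comp_sub_left b
  set k : ℝ := ∫ a : ℂ, bump r ‖a‖ with hk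
  have hkb : ∀ b : ℂ, ∫ a : ℂ, bump r ‖b - a‖ = k := fun b =>
    integral_sub_left_eq_self (fun a : ℂ => bump r ‖a‖) volume b
  have hkpos : 0 < k := by
    refine hbc.integral_pos_of_hasCompactSupport_nonneg_nonzero hbs (fun a => bump_nonneg hr _) (x := 0) ?_
    simp only [norm_zero, bump, max_eq_right hr.le, max_eq_right (half_pos hr).le]
    exact (sub_pos.2 (Real.log_lt_log (half_pos hr) (by linarith))).ne'
  refine ⟨k⁻¹ • g, V.smul_mem _ hg, ?_⟩
  refine lt_of_le_of_lt ?_ (half_lt_self hε)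
  rw [ContinuousMap.dist_le (by positivity)]
  intro z
  induction z using OnePoint.rec with
  | infty => simp [h0, hg0]; positivity
  | coe b =>
    rw [Real.dist_eq, ContinuousMap.smul_apply, smul_eq_mul, hgb]
    have hi1 : Integrable fun a : ℂ => f a * bump r ‖b - a‖ := by
      refine Continuous.integrable_of_hasCompactSupport ?_ hs.mul_right
      exact hf.mul (hbc.comp (by fun_prop))
    have e1 : φ b - k⁻¹ * ∫ a, f a * bump r ‖b - a‖ = k⁻¹ * ∫ a, (f b - f a) * bump r ‖b - a‖ := by
      simp only [sub_mul]
      rw [integral_sub ((hbi b).const_mul _) hi1, integral_const_mul, hkb, mul_sub]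
      show f b - _ = _
      field_simp
    rw [e1, abs_mul, abs_of_pos (inv_pos.2 hkpos)]
    have e2 : |∫ a, (f b - f a) * bump r ‖b - a‖| ≤ ∫ a, ε / 2 * bump r ‖b - a‖ := by
      rw [← Real.norm_eq_abs]
      refine norm_integral_le_of_norm_le ((hbi b).const_mul _) (Eventually.of_forall fun a => ?_)
      rw [norm_mul, Real.norm_of_nonneg (bump_nonneg hr _)]
      by_cases h : ‖b - a‖ < r
      · refine mul_le_mul_of_nonneg_right ?_ (bump_nonneg hr _)
        have := hr2 (a := b) (b := a) (by rwa [dist_eq_norm])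
        rw [dist_eq_norm] at this; exact this.le
      · rw [bump_zero hr (not_lt.1 h)]; simp
    rw [integral_const_mul, hkb] at e2
    calc k⁻¹ * _ ≤ k⁻¹ * (ε / 2 * k) := mul_le_mul_of_nonneg_left e2 (inv_pos.2 hkpos).le
      _ = ε / 2 := by field_simp

lemma V_top (φ : C(Sphere, ℝ)) : φ ∈ V := by
  wlog h0 : φ OnePoint.infty = 0 generalizing φ
  · have := this (φ - ContinuousMap.const _ (φ OnePoint.infty)) (by simp)
    have h2 := V.add_mem this (h1 (φ OnePoint.infty))
    simpa using h2
  rw [← SetLike.mem_coe, ← hV.closure_eq, Metric.mem_closure_iff]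
  intro ε hε
  set δ := ε / 2 with hδ
  have hδ0 : 0 < δ := half_pos hε
  let ψ : C(Sphere, ℝ) := ⟨fun z => φ z - max (-δ) (min (φ z) δ), by fun_prop⟩
  have hclamp : ∀ x : ℝ, |max (-δ) (min x δ)| ≤ δ := fun x => by
    rw [abs_le]; exact ⟨le_max_left _ _, max_le (by linarith) (min_le_right _ _)⟩
  refine ⟨ψ, cs_mem hV h1 hb (φ := ψ) ?_ ?_, ?_⟩
  · show φ OnePoint.infty - max (-δ) (min (φ OnePoint.infty) δ) = 0
    rw [h0, min_eq_left hδ0.le, max_eq_right (by linarith)]; simp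
  · have hK : IsCompact ((↑) ⁻¹' {z : Sphere | δ ≤ |φ z|} : Set ℂ) := by
      have hc : IsClosed {z : Sphere | δ ≤ |φ z|} := isClosed_le continuous_const φ.continuous.abs
      have hn : OnePoint.infty ∉ {z : Sphere | δ ≤ |φ z|} := by simp [h0, hδ0]
      rw [OnePoint.isClosed_iff_of_notMem hn] at hc
      exact hc.2
    refine HasCompactSupport.intro hK fun a ha => ?_
    simp only [Set.mem_preimage, Set.mem_setOf_eq, not_le, abs_lt] at ha
    show φ a - max (-δ) (min (φ a) δ) = 0
    rw [min_eq_left ha.2.le, max_eq_right ha.1.le, sub_self]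
  · refine lt_of_le_of_lt ?_ (half_lt_self hε)
    rw [ContinuousMap.dist_le (by positivity)]
    intro z
    show dist (φ z) (φ z - max (-δ) (min (φ z) δ)) ≤ δ
    rw [Real.dist_eq]
    simpa using hclamp (φ z)
end

end

section
/-! ### Part 7: equidistribution from energy decay -/
attribute [local instance] sphMS
attribute [local instance] sphMeas
attribute [local instance] sphBorel

lemma closed_null {E : Type*} [SeminormedAddCommGroup E] {ι : Type*} {l : Filter ι} (A : ι → E → ℝ) (C : ℝ)
    (hA : ∀ k x y, |A k x - A k y| ≤ C * ‖x - y‖) : IsClosed {x | Tendsto (fun k => A k x) l (𝓝 0)} := by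
  rw [← isSeqClosed_iff_isClosed]
  intro s x hs hx
  rw [Set.mem_setOf_eq, Metric.tendsto_nhds]
  intro ε hε
  have h1 : Tendsto (fun j => C * ‖s j - x‖) atTop (𝓝 0) := by
    have := (tendsto_iff_norm_sub_tendsto_zero.1 hx).const_mul C
    simpa using this
  obtain ⟨j, hj⟩ := ((h1.eventually (gt_mem_nhds (half_pos hε)))).exists
  filter_upwards [Metric.tendsto_nhds.1 (hs j) (ε / 2) (half_pos hε)] with k hk
  rw [Real.dist_eq, sub_zero] at hk ⊢
  have h2 := hA k (s j) x
  have h3 : |A k x| ≤ |A k (s j)| + |A k (s j) - A k x| := by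
    have := abs_sub (A k (s j)) (A k (s j) - A k x)
    simpa using this
  linarith

def Equi (ρ : Measure Sphere) : Prop := ∀ (a : ℂ) (r : ℝ), 0 < r →
  (∀ n, Integrable (en p q (cm a r) n) ρ) ∧ Tendsto (fun n => ∫ z, en p q (cm a r) n z ∂ρ) atTop (𝓝 0)

section
variable {p q} (hg : Good p q)
include hg

lemma Pfn_meas (n : ℕ) : ∀ {F : Sphere → Sphere → ℝ}, Measurable (Function.uncurry F) →
    Measurable fun x : Sphere × Sphere => (Pf p q ^ n) (F x.1) x.2 := by
  induction n with
  | zero => intro F hF; exact hF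
  | succ n ih =>
    intro F hF
    simp only [pow_succ, Module.End.mul_apply]
    refine ih (F := fun z => Pf p q (F z)) ?_
    simp only [Function.uncurry_def, Pf_apply]
    refine Measurable.const_mul (Finset.measurable_sum _ fun v _ => ?_) _
    exact hF.comp (measurable_fst.prodMk ((RMv hg v).cont.measurable.comp measurable_snd))

omit hg in
lemma Pfn_integral {ρ : Measure Sphere} (n : ℕ) : ∀ {F : Sphere → Sphere → ℝ},
    (∀ c, Integrable (fun z => F z c) ρ) → ∀ c, Integrable (fun z => (Pf p q ^ n) (F z) c) ρ ∧
      (Pf p q ^ n) (fun c => ∫ z, F z c ∂ρ) c = ∫ z, (Pf p q ^ n) (F z) c ∂ρ := by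
  induction n with
  | zero => intro f hf z; exact ⟨hf z, rfl⟩
  | succ n ih =>
    intro F hF c
    have h1 : ∀ c, Integrable (fun z => Pf p q (F z) c) ρ := fun c =>
      (integrable_finsetSum _ fun v _ => hF _).const_mul _
    have h2 : Pf p q (fun c => ∫ z, F z c ∂ρ) = fun c => ∫ z, Pf p q (F z) c ∂ρ := by
      funext c
      simp only [Pf_apply]
      rw [integral_const_mul, integral_finsetSum _ fun v _ => hF _]
    simp only [pow_succ, Module.End.mul_apply]
    rw [h2]
    exact ih h1 c

lemma Nice.equi {ρ : Measure Sphere} (h : Nice ρ) : Equi p q ρ := by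
  intro a r hr
  have := h.prob
  obtain ⟨C, hC, hK⟩ := h.bdd
  have hP : ∀ n c, Integrable (fun z => (Pf p q ^ n) (kp z) c) ρ ∧
      (Pf p q ^ n) (Km ρ) c = ∫ z, (Pf p q ^ n) (kp z) c ∂ρ := fun n c => by
    have := Pfn_integral (p := p) (q := q) (ρ := ρ) n (F := kp) (fun c => (h.int c).congr (Eventually.of_forall fun z => kp_comm _ _)) c
    refine ⟨this.1, ?_⟩
    rw [← this.2]
    have e : Km ρ = fun c => ∫ z, kp z c ∂ρ := funext fun c => by simp only [Km, kp_comm c]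
    rw [e]
  have hI : ∀ n, Integrable (Function.uncurry fun z c => (Pf p q ^ n) (kp z) c) (ρ.prod (cm a r)) := fun n => by
    have hm : Measurable (Function.uncurry fun z c => (Pf p q ^ n) (kp z) c) :=
      Pfn_meas hg n (F := kp) kp_meas_joint
    rw [integrable_prod_iff' hm.aestronglyMeasurable]
    refine ⟨Eventually.of_forall fun c => (hP n c).1, ?_⟩
    refine (cont_int (Pfn_cont hg h.cont n).neg (cm a r)).congr (Eventually.of_forall fun c => ?_)
    simp only [Pi.neg_apply]
    rw [(hP n c).2, ← integral_neg]
    refine integral_congr_ae (Eventually.of_forall fun z => ?_)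
    have := Pfn_le hg n (c := c) fun w => kp_nonpos z (itComp p q w n c)
    simp only [mul_zero] at this
    simp [abs_of_nonpos this, Function.uncurry]
  refine ⟨fun n => (hI n).integral_prod_left, ?_⟩
  have hv : ∀ n, ∫ z, en p q (cm a r) n z ∂ρ = ∫ c, (Pf p q ^ n) (Km ρ) c ∂(cm a r) := fun n => by
    simp only [en]
    rw [integral_integral_swap (hI n)]
    simp only [(hP n _).2]
  refine squeeze_zero_norm (a := fun n => th p q ^ n * C) (fun n => ?_) ?_
  · rw [hv]
    have := norm_integral_le_of_norm_le_const (μ := cm a r) (f := (Pf p q ^ n) (Km ρ)) (C := th p q ^ n * C) (Eventually.of_forall fun c => Pfn_abs hg n hK c)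
    simpa using this
  · have := (tendsto_pow_atTop_nhds_zero_of_lt_one (th_nonneg hg) (th_lt hg)).mul_const C
    simpa using this

lemma GSn_int (φ : C(Sphere, ℝ)) (n : ℕ) (ρ : Measure Sphere) [IsProbabilityMeasure ρ] :
    Integrable ((GS p q ^ n) φ) ρ := cont_int (GSn_cont hg φ.continuous n) ρ

lemma GSn_int_lip (φ ψ : C(Sphere, ℝ)) (n : ℕ) (ρ : Measure Sphere) [IsProbabilityMeasure ρ] :
    |∫ z, (GS p q ^ n) φ z ∂ρ - ∫ z, (GS p q ^ n) ψ z ∂ρ| ≤ ‖φ - ψ‖ := by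
  rw [← integral_sub (GSn_int hg φ n ρ) (GSn_int hg ψ n ρ)]
  have h : ∀ z, ‖(GS p q ^ n) φ z - (GS p q ^ n) ψ z‖ ≤ ‖φ - ψ‖ := fun z => by
    have := GSn_abs hg (φ := φ - ψ) (C := ‖φ - ψ‖) (fun z => (φ - ψ).norm_coe_le_norm z) n z
    rw [map_sub] at this
    exact this
  have := norm_integral_le_of_norm_le_const (μ := ρ) (Eventually.of_forall h)
  simpa using this

def VE (ρ ρ' : Measure Sphere) [IsProbabilityMeasure ρ] [IsProbabilityMeasure ρ'] : Submodule ℝ C(Sphere, ℝ) where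
  carrier := {φ | Tendsto (fun k : ℕ × ℕ => ∫ z, (GS p q ^ k.1) φ z ∂ρ - ∫ z, (GS p q ^ k.2) φ z ∂ρ') atTop (𝓝 0)}
  zero_mem' := by simp
  add_mem' {φ ψ} h1 h2 := by
    have := Tendsto.add h1 h2
    simp only [add_zero] at this
    refine this.congr fun k => ?_
    have e : ∀ n, (GS p q ^ n) (φ + ψ : C(Sphere, ℝ)) = fun z => (GS p q ^ n) φ z + (GS p q ^ n) ψ z := fun n => by
      rw [ContinuousMap.coe_add, map_add]; rfl
    simp only [e]
    rw [integral_add (GSn_int hg φ _ ρ) (GSn_int hg ψ _ ρ), integral_add (GSn_int hg φ _ ρ') (GSn_int hg ψ _ ρ')]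
    ring
  smul_mem' r φ h := by
    have := Tendsto.const_mul r h
    simp only [mul_zero] at this
    refine this.congr fun k => ?_
    have e : ∀ n, (GS p q ^ n) (r • φ : C(Sphere, ℝ)) = fun z => r * (GS p q ^ n) φ z := fun n => by
      rw [ContinuousMap.coe_smul, map_smul]; rfl
    simp only [e, integral_const_mul]
    ring

lemma VE_top {ρ ρ' : Measure Sphere} [IsProbabilityMeasure ρ] [IsProbabilityMeasure ρ'] (h : Equi p q ρ)
    (h' : Equi p q ρ') (φ : C(Sphere, ℝ)) :
    Tendsto (fun k : ℕ × ℕ => ∫ z, (GS p q ^ k.1) φ z ∂ρ - ∫ z, (GS p q ^ k.2) φ z ∂ρ') atTop (𝓝 0) := by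
  refine V_top (V := VE hg ρ ρ') ?_ ?_ ?_ φ
  · refine closed_null (fun (k : ℕ × ℕ) (φ : C(Sphere, ℝ)) => ∫ z, (GS p q ^ k.1) φ z ∂ρ - ∫ z, (GS p q ^ k.2) φ z ∂ρ') 2 ?_
    intro k φ ψ
    have h1 := GSn_int_lip hg φ ψ k.1 ρ
    have h2 := GSn_int_lip hg φ ψ k.2 ρ'
    rw [abs_le] at h1 h2 ⊢
    constructor <;> linarith
  · intro r
    have : ∀ n, (GS p q ^ n) (ContinuousMap.const Sphere r) = fun _ => r := fun n => GSn_const hg r n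
    refine tendsto_const_nhds.congr fun k => ?_
    rw [this, this]; simp
  · intro a r s hr hs
    show Tendsto _ _ _
    have := cm_null a hr.ne'
    have := cm_null a hs.ne'
    set κ : ℕ → ℝ := fun n => ∫ c, un p q n c ∂(cm a r) - ∫ c, un p q n c ∂(cm a s) with hκ
    have e : ∀ n z, (GS p q ^ n) (KmC a r - KmC a s : C(Sphere, ℝ)) z = en p q (cm a r) n z - en p q (cm a s) n z + κ n := by
      intro n z
      have h1 := (main_id hg (cm_nice a hr).int n z).2
      have h2 := (main_id hg (cm_nice a hs).int n z).2
      have e1 : ((KmC a r - KmC a s : C(Sphere, ℝ)) : Sphere → ℝ) = Km (cm a r) - Km (cm a s) := by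
        funext z; simp [KmC_apply a hr, KmC_apply a hs]
      rw [e1, map_sub, Pi.sub_apply, h1, h2, hκ]
      ring
    have e2 : ∀ n (ρ : Measure Sphere) [IsProbabilityMeasure ρ], Equi p q ρ →
        ∫ z, (GS p q ^ n) (KmC a r - KmC a s : C(Sphere, ℝ)) z ∂ρ =
        ∫ z, en p q (cm a r) n z ∂ρ - ∫ z, en p q (cm a s) n z ∂ρ + κ n := by
      intro n ρ _ h
      simp only [e]
      rw [integral_add (f := fun z => en p q (cm a r) n z - en p q (cm a s) n z)
        (((h a r hr).1 n).sub ((h a s hs).1 n)) (integrable_const _),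
        integral_sub ((h a r hr).1 n) ((h a s hs).1 n)]
      simp
    simp only [e2 _ ρ h, e2 _ ρ' h']
    obtain ⟨C, hC, -, hu⟩ := un_bdd hg
    have hκc : CauchySeq κ := by
      refine cauchySeq_of_le_geometric (th p q) (2 * C) (th_lt hg) fun n => ?_
      have hb : ∀ t : ℝ, 0 < t → |∫ c, un p q (n + 1) c ∂(cm a t) - ∫ c, un p q n c ∂(cm a t)| ≤ C * th p q ^ n := by
        intro t ht
        rw [← integral_sub (cont_int (un_cont hg _) _) (cont_int (un_cont hg _) _)]
        have := norm_integral_le_of_norm_le_const (μ := cm a t) (f := fun c => un p q (n + 1) c - un p q n c) (C := C * th p q ^ n) (Eventually.of_forall fun c => hu n c)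
        simpa using this
      have h1 := abs_le.1 (hb r hr)
      have h2 := abs_le.1 (hb s hs)
      rw [dist_comm, Real.dist_eq, abs_le]
      simp only [hκ]
      constructor <;> linarith [h1.1, h1.2, h2.1, h2.2]
    have hκ0 : Tendsto (fun k : ℕ × ℕ => κ k.1 - κ k.2) atTop (𝓝 0) := by
      rw [cauchySeq_iff_tendsto_dist_atTop_0] at hκc
      exact tendsto_zero_iff_abs_tendsto_zero _ |>.2 hκc
    have t1 : Tendsto (Prod.fst : ℕ × ℕ → ℕ) atTop atTop := by
      rw [← prod_atTop_atTop_eq]; exact tendsto_fst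
    have t2 : Tendsto (Prod.snd : ℕ × ℕ → ℕ) atTop atTop := by
      rw [← prod_atTop_atTop_eq]; exact tendsto_snd
    have := ((((h a r hr).2.comp t1).sub ((h a s hs).2.comp t1)).sub
      (((h' a r hr).2.comp t2).sub ((h' a s hs).2.comp t2))).add hκ0
    simp only [sub_zero, add_zero] at this
    refine this.congr fun k => ?_
    simp only [Function.comp_apply]
    ring

/-- the common limit functional -/
theorem T0 : ∃ ℓ : C(Sphere, ℝ) → ℝ, ∀ ρ : Measure Sphere, IsProbabilityMeasure ρ → Equi p q ρ → ∀ φ : C(Sphere, ℝ),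
    Tendsto (fun n => ∫ z, (GS p q ^ n) φ z ∂ρ) atTop (𝓝 (ℓ φ)) := by
  have h0 : Equi p q (cm 0 1) := (cm_nice 0 one_pos).equi hg
  have hc : ∀ φ : C(Sphere, ℝ), ∃ ℓ, Tendsto (fun n => ∫ z, (GS p q ^ n) φ z ∂(cm 0 1)) atTop (𝓝 ℓ) := fun φ => by
    refine cauchySeq_tendsto_of_complete ?_
    rw [cauchySeq_iff_tendsto_dist_atTop_0]
    exact (tendsto_zero_iff_abs_tendsto_zero _).1 (VE_top hg h0 h0 φ)
  choose ℓ hℓ using hc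
  refine ⟨ℓ, fun ρ _ hρ φ => ?_⟩
  have h1 := (VE_top hg hρ h0 φ).comp (show Tendsto (fun n : ℕ => (n, n)) atTop atTop by
    rw [← prod_atTop_atTop_eq]; exact tendsto_id.prodMk tendsto_id)
  have := h1.add (hℓ φ)
  simpa using this
end

end

section
/-! ### Part 8: dynamics of the skew product -/
attribute [local instance] sphMS

lemma Titer (n : ℕ) (w : ℕ → Fin N) (z : Sphere) :
    (Tmap p q)^[n] (w, z) = (fun k => w (k + n), itComp p q w n z) := by
  induction n with
  | zero => rfl
  | succ n ih =>
    rw [Function.iterate_succ_apply', ih]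
    simp only [Tmap, shiftW, zero_add]
    refine Prod.ext ?_ rfl
    funext k; exact congrArg w (by ring)

lemma itComp_congr {w w' : ℕ → Fin N} {n : ℕ} (h : ∀ k < n, w k = w' k) : itComp p q w n = itComp p q w' n := by
  induction n with
  | zero => rfl
  | succ n ih =>
    simp only [itComp]
    rw [ih fun k hk => h k (by omega), h n (by omega)]

lemma cons_cont (v : Fin N) : Continuous (consW v) := by
  refine continuous_pi fun n => ?_
  simp only [consW]
  split_ifs
  · exact continuous_const
  · exact continuous_apply _

lemma shift_cont : Continuous (shiftW (N := N)) := continuous_pi fun n => continuous_apply _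

lemma Tmap_cons (v : Fin N) (w : ℕ → Fin N) (y : Sphere) :
    Tmap p q (consW v w, y) = (w, ratEval (p v) (q v) y) := by
  simp [Tmap]

lemma eta_cons (x : SymX N) : x = (consW (x.1 0) (shiftW x.1), x.2) := by simp

section
variable {p q} (hg : Good p q)
include hg

lemma Tmap_cont : Continuous (Tmap p q) := by
  refine (shift_cont.comp continuous_fst).prodMk ?_
  have h : Continuous fun x : Fin N × Sphere => ratEval (p x.1) (q x.1) x.2 :=
    continuous_prod_of_discrete_left.2 fun v => (RMv hg v).cont
  have h2 : Continuous fun x : SymX N => (x.1 0, x.2) :=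
    ((continuous_apply 0).comp continuous_fst).prodMk continuous_snd
  exact h.comp h2

lemma itComp_cont (w : ℕ → Fin N) (n : ℕ) : Continuous (itComp p q w n) := by
  induction n with
  | zero => exact continuous_id
  | succ n ih => exact (RMv hg (w n)).cont.comp ih

lemma fatou_fwd {v : Fin N} {w : ℕ → Fin N} {y : Sphere} (h : y ∈ fatouW p q (consW v w)) :
    ratEval (p v) (q v) y ∈ fatouW p q w := by
  obtain ⟨U, hU, hy, hn⟩ := h
  obtain ⟨K', hK', hyK, hKU⟩ := exists_compact_subset hU hy
  have H := RMv hg v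
  refine ⟨ratEval (p v) (q v) '' interior K', H.isOpenMap _ isOpen_interior, ⟨y, hyK, rfl⟩, ?_⟩
  intro s hs
  choose k hk1 hk2 using hs
  obtain ⟨φ, hφ, g', hg'⟩ := hn (fun n => itComp p q (consW v w) (k n + 1)) fun n => ⟨_, by omega, rfl⟩
  have hsel : ∀ z, ∃ u, z ∈ ratEval (p v) (q v) '' interior K' → u ∈ K' ∧ ratEval (p v) (q v) u = z := fun z => by
    by_cases hz : z ∈ ratEval (p v) (q v) '' interior K'
    · obtain ⟨u, hu, rfl⟩ := hz
      exact ⟨u, fun _ => ⟨interior_subset hu, rfl⟩⟩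
    · exact ⟨z, fun h => absurd h hz⟩
  choose sel hsel using hsel
  refine ⟨φ, hφ, fun z => g' (sel z), fun K hK _ ε hε => ?_⟩
  filter_upwards [hg' K' hKU hK' ε hε] with n hn z hz
  obtain ⟨h1, h2⟩ := hsel z (hK hz)
  have := hn _ h1
  rw [itComp_succ'] at this
  simp only [shift_cons, cons_zero, h2] at this
  rw [hk2]; exact this

lemma J_back {v : Fin N} {w : ℕ → Fin N} {y : Sphere} (h : (w, ratEval (p v) (q v) y) ∈ juliaSet p q) :
    (consW v w, y) ∈ juliaSet p q := by
  set E : Set (SymX N) := ⋃ w : ℕ → Fin N, {w} ×ˢ juliaW p q w with hE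
  have hJ : juliaSet p q = closure E := rfl
  rw [hJ] at h ⊢
  let Ψ : SymX N → SymX N := Prod.map id (ratEval (p v) (q v))
  have hΨ : IsOpenMap Ψ := IsOpenMap.id.prodMap (RMv hg v).isOpenMap
  have h1 : (w, y) ∈ closure (Ψ ⁻¹' E) := hΨ.preimage_closure_subset_closure_preimage h
  let S : SymX N → SymX N := fun x => (consW v x.1, x.2)
  have hS : Continuous S := ((cons_cont v).comp continuous_fst).prodMk continuous_snd
  have h2 : S (w, y) ∈ closure E := by
    refine map_mem_closure hS h1 ?_
    rintro ⟨w', y'⟩ h'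
    simp only [hE, Ψ, Set.mem_preimage, Set.mem_iUnion, Set.mem_prod, Set.mem_singleton_iff, Prod.map, id] at h'
    obtain ⟨w'', h3, h4⟩ := h'
    subst h3
    refine Set.mem_iUnion.2 ⟨consW v w', rfl, ?_⟩
    exact fun h5 => h4 (fatou_fwd hg h5)
  exact h2

lemma J_backT {x : SymX N} (h : Tmap p q x ∈ juliaSet p q) : x ∈ juliaSet p q := by
  rw [eta_cons x]
  exact J_back hg h

lemma J_backn {x : SymX N} {n : ℕ} (h : (Tmap p q)^[n] x ∈ juliaSet p q) : x ∈ juliaSet p q := by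
  induction n generalizing x with
  | zero => exact h
  | succ n ih => exact J_backT hg (ih h)

lemma mem_preimT {x y : SymX N} : y ∈ preimT p q x ↔ Tmap p q y = x := by
  simp only [preimT, Multiset.mem_sum, Multiset.mem_map, Finset.mem_univ, true_and]
  constructor
  · rintro ⟨v, z, hz, rfl⟩
    rw [Tmap_cons, (RMv hg v).mem_fib.1 hz]
  · rintro rfl
    refine ⟨y.1 0, y.2, (RMv hg _).mem_fib.2 rfl, ?_⟩
    exact (eta_cons y).symm

lemma mem_preimTn {x y : SymX N} {n : ℕ} : y ∈ preimTn p q n x ↔ (Tmap p q)^[n] y = x := by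
  induction n generalizing x with
  | zero => simp [preimTn]
  | succ n ih =>
    simp only [preimTn, Multiset.mem_bind, mem_preimT hg, ih, Function.iterate_succ_apply']
    constructor
    · rintro ⟨a, h1, h2⟩; rw [h2, h1]
    · intro h; exact ⟨_, h, rfl⟩

lemma card_preimT (x : SymX N) : (preimT p q x).card = Dtot p q := by
  simp [preimT, Dtot, (RMv hg _).card]

lemma card_preimTn (n : ℕ) (x : SymX N) : (preimTn p q n x).card = Dtot p q ^ n := by
  induction n generalizing x with
  | zero => simp [preimTn]
  | succ n ih =>
    simp [preimTn, ih, card_preimT hg, pow_succ, Multiset.card_bind, Function.comp_def]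
    ring

lemma preimTn_J {x y : SymX N} {n : ℕ} (hx : x ∈ juliaSet p q) (h : y ∈ preimTn p q n x) : y ∈ juliaSet p q := by
  rw [mem_preimTn hg] at h
  exact J_backn hg (h ▸ hx)
end

end

section
/-! ### Part 9: (A1) bounds the visits near critical points; equidistribution from points of the Julia set -/
attribute [local instance] sphMS
attribute [local instance] sphMeas
attribute [local instance] sphBorel

def Bad (p q : Fin N → ℂ[X]) (η : ℝ) : Set (SymX N) :=
  {Y | ∃ y' ∈ (fiber (p (Y.1 0)) (q (Y.1 0)) (ratEval (p (Y.1 0)) (q (Y.1 0)) Y.2)).erase Y.2, sg Y.2 y' ≤ η}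

section
variable {p q} (hg : Good p q)
include hg

lemma crit_fin : (Prod.snd '' critSet p q).Finite := by
  refine (Set.finite_iUnion fun v : Fin N => crit_finite (hg.2.1 v) (hg.2.2.1 v)).subset ?_
  rintro _ ⟨x, hx, rfl⟩
  exact Set.mem_iUnion.2 ⟨x.1 0, hx⟩

lemma bad_limit {Z : ℕ → SymX N} {Z0 : SymX N} (hZ : Tendsto Z atTop (𝓝 Z0)) {η : ℕ → ℝ}
    (hη : Tendsto η atTop (𝓝 0)) (h : ∀ j, Z j ∈ Bad p q (η j)) : Z0 ∈ critSet p q := by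
  have h1 : Tendsto (fun j => (Z j).1) atTop (𝓝 Z0.1) := (continuous_fst.tendsto _).comp hZ
  have h2 : Tendsto (fun j => (Z j).2) atTop (𝓝 Z0.2) := (continuous_snd.tendsto _).comp hZ
  have h3 : ∀ᶠ j in atTop, (Z j).1 0 = Z0.1 0 := by
    have := ((continuous_apply (0:ℕ)).tendsto Z0.1).comp h1
    exact this.eventually ((isOpen_discrete {Z0.1 0}).mem_nhds rfl)
  obtain ⟨M, hM⟩ := eventually_atTop.1 h3
  choose y hy1 hy2 using h
  have hs : Tendsto (fun j => j + M) atTop atTop := tendsto_add_atTop_nat M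
  refine (RMv hg (Z0.1 0)).crit_limit (h2.comp hs) (y' := fun j => y (j + M)) ?_ fun k => ?_
  · rw [tendsto_sph]
    have e1 := (tendsto_sph.1 h2).comp hs
    have e2 := e1.add (hη.comp hs)
    simp only [add_zero] at e2
    refine squeeze_zero (fun _ => sg_nonneg _ _) (fun j => ?_) e2
    have := sg_triangle (y (j+M)) (Z (j+M)).2 Z0.2
    have := hy2 (j+M)
    rw [sg_comm] at this
    simp only [Function.comp]
    linarith
  · have := hy1 (k + M)
    rw [hM (k+M) (by omega)] at this
    exact this

lemma per_crit (hA1 : NoSuperAttract p q) {A B : SymX N} {m : ℕ} (hm : 1 ≤ m) (hAB : (Tmap p q)^[m] A = B)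
    (h2 : A.2 = B.2) (hB : B ∈ juliaSet p q) (hc : A ∈ critSet p q) : False := by
  obtain ⟨a, c⟩ := A
  obtain ⟨b, c'⟩ := B
  simp only at h2
  subst h2
  rw [Titer] at hAB
  have hab : ∀ k, a (k + m) = b k := fun k => congrFun (congrArg Prod.fst hAB) k
  have hcc : itComp p q a m c = c := congrArg Prod.snd hAB
  let W : ℕ → ℕ → Fin N := fun k n => if n < k * m then a (n % m) else b (n - k * m)
  have hW0 : W 0 = b := by funext n; simp [W]
  have hWs : ∀ k, (Tmap p q)^[m] (W (k+1), c) = (W k, c) := fun k => by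
    rw [Titer, itComp_congr p q (w' := a), hcc]
    · refine Prod.ext (funext fun n => ?_) rfl
      simp only [W, Nat.add_mod_right]
      have : (k+1)*m = k*m+m := by ring
      rw [this, Nat.add_sub_add_right]
      simp
    · intro n hn
      have : n < (k+1)*m := by nlinarith
      simp only [W, this, if_true, Nat.mod_eq_of_lt hn]
  have hWJ : ∀ k, (W k, c) ∈ juliaSet p q := fun k => by
    induction k with
    | zero => rw [hW0]; exact hB
    | succ k ih => exact J_backn hg (n := m) (by rw [hWs]; exact ih)
  let u : ℕ → Fin N := fun n => a (n % m)
  have hlim : Tendsto (fun k => (W k, c)) atTop (𝓝 (u, c)) := by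
    refine Tendsto.prodMk_nhds (tendsto_pi_nhds.2 fun n => ?_) tendsto_const_nhds
    refine tendsto_const_nhds.congr' ?_
    filter_upwards [eventually_gt_atTop n] with k hk
    have : n < k * m := by nlinarith
    simp [W, u, this]
  have hu : (u, c) ∈ juliaSet p q := by
    have hcl : IsClosed (juliaSet p q) := isClosed_closure
    exact hcl.mem_of_tendsto hlim (Eventually.of_forall hWJ)
  have hfix : (Tmap p q)^[m] (u, c) = (u, c) := by
    rw [Titer, itComp_congr p q (w' := a), hcc]
    · refine Prod.ext (funext fun n => ?_) rfl
      simp [u]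
    · intro n hn; simp [u, Nat.mod_eq_of_lt hn]
  refine hA1 (u, c) hu m hm hfix 0 (by omega) ?_
  have hu0 : u 0 = a 0 := by simp [u]
  simp only [Function.iterate_zero, id, critSet, Set.mem_setOf_eq, hu0] at hc ⊢
  exact hc

lemma bad_bound (hA1 : NoSuperAttract p q) : ∃ K : ℕ, ∀ τ : ℕ, ∃ η : ℝ, 0 < η ∧ ∀ Z : SymX N,
    (Tmap p q)^[τ] Z ∈ juliaSet p q →
    ((Finset.range τ).filter fun k => (Tmap p q)^[k] Z ∈ Bad p q η).card ≤ K := by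
  refine ⟨(crit_fin hg).toFinset.card, fun τ => ?_⟩
  by_contra! hcon
  choose Z hZ1 hZ2 using fun j : ℕ => hcon (1 / ((j : ℝ) + 1)) (by positivity)
  have hZJ : ∀ j k, k ≤ τ → (Tmap p q)^[k] (Z j) ∈ juliaSet p q := fun j k hk => by
    refine J_backn hg (n := τ - k) ?_
    rw [← Function.iterate_add_apply, Nat.sub_add_cancel hk]
    exact hZ1 j
  obtain ⟨Z0, φ, hφ, hlim⟩ := CompactSpace.tendsto_subseq Z
  let S : ℕ → Finset ℕ := fun j => (Finset.range τ).filter fun k => (Tmap p q)^[k] (Z j) ∈ Bad p q (1 / ((j : ℝ) + 1))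
  have hS : ∀ j, S j ∈ (Finset.range τ).powerset := fun j => Finset.mem_powerset.2 (Finset.filter_subset _ _)
  obtain ⟨S0, hS0⟩ : ∃ S0, ∃ᶠ j in atTop, S (φ j) = S0 := by
    by_contra! hc
    have : ∀ᶠ j in atTop, ∀ S0 ∈ (Finset.range τ).powerset, S (φ j) ≠ S0 :=
      (Filter.eventually_all_finset _).2 fun S0 _ => hc S0
    obtain ⟨j, hj⟩ := this.exists
    exact hj _ (hS _) rfl
  obtain ⟨ψ, hψ, hψ2⟩ := extraction_of_frequently_atTop hS0
  have hlim2 := hlim.comp hψ.tendsto_atTop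
  have hT : ∀ k, Tendsto (fun j => (Tmap p q)^[k] (Z (φ (ψ j)))) atTop (𝓝 ((Tmap p q)^[k] Z0)) := fun k =>
    (((Tmap_cont hg).iterate k).tendsto _).comp hlim2
  have hη : Tendsto (fun j => 1 / (((φ (ψ j) : ℕ) : ℝ) + 1)) atTop (𝓝 0) :=
    tendsto_one_div_add_atTop_nhds_zero_nat.comp ((hφ.comp hψ).tendsto_atTop)
  have hcl : IsClosed (juliaSet p q) := isClosed_closure
  have hcrit : ∀ k ∈ S0, (Tmap p q)^[k] Z0 ∈ critSet p q ∧ (Tmap p q)^[k] Z0 ∈ juliaSet p q := fun k hk => by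
    refine ⟨bad_limit hg (hT k) hη fun j => ?_, hcl.mem_of_tendsto (hT k) (Eventually.of_forall fun j => hZJ _ _ ?_)⟩
    · rw [← hψ2 j] at hk
      exact (Finset.mem_filter.1 hk).2
    · rw [← hψ2 j] at hk
      exact (Finset.mem_range.1 (Finset.mem_filter.1 hk).1).le
  have hcard : (crit_fin hg).toFinset.card < S0.card := by rw [← hψ2 0]; exact hZ2 _
  obtain ⟨i, hi, j, hj, hij, he⟩ := Finset.exists_ne_map_eq_of_card_lt_of_maps_to hcard
    (f := fun k => ((Tmap p q)^[k] Z0).2) (fun k hk => by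
      simp only [Set.Finite.coe_toFinset]; exact ⟨_, (hcrit k hk).1, rfl⟩)
  wlog hlt : i < j generalizing i j
  · exact this j hj i hi hij.symm he.symm (by omega)
  refine per_crit hg hA1 (A := (Tmap p q)^[i] Z0) (B := (Tmap p q)^[j] Z0) (m := j - i) (by omega) ?_ he
    (hcrit j hj).2 (hcrit i hi).1
  rw [← Function.iterate_add_apply, Nat.sub_add_cancel hlt.le]

lemma step_bad {η : ℝ} (hη : 0 < η) (hη1 : η ≤ 1) : ∃ C : ℝ, 0 ≤ C ∧ ∀ (v : Fin N) (x : SymX N) (c : Sphere),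
    ∃ Y : SymX N, Tmap p q Y = x ∧ -kp (ratEval (p v) (q v) c) x.2 ≤
      C + (Dtot p q : ℝ) ^ (if Y ∈ Bad p q η then 1 else 0) * -kp c Y.2 := by
  choose κ hκ0 hκ1 hκ using fun v => (RMv hg v).lower
  have hD := D_pos hg
  have hlk : ∀ v, 0 ≤ -Real.log (κ v) := fun v => by
    have := Real.log_nonpos (hκ0 v).le (hκ1 v); linarith
  have hle : 0 ≤ -Real.log (η / 2) := by
    have := Real.log_nonpos (x := η / 2) (by positivity) (by linarith); linarith
  refine ⟨(∑ v, -Real.log (κ v)) + Dtot p q * -Real.log (η / 2), add_nonneg (Finset.sum_nonneg fun v _ => hlk v) (by positivity), fun v x c => ?_⟩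
  have hsum : -Real.log (κ v) ≤ ∑ v, -Real.log (κ v) :=
    Finset.single_le_sum (f := fun v => -Real.log (κ v)) (fun v _ => hlk v) (Finset.mem_univ v)
  have H := RMv hg v
  have hdD : degR p q v ≤ Dtot p q := Finset.single_le_sum (f := degR p q) (fun _ _ => Nat.zero_le _) (Finset.mem_univ v)
  obtain ⟨y0, hy0⟩ := H.exists_mem x.2
  obtain ⟨y, hy, hmin⟩ := (fiber (p v) (q v) x.2).toFinset.exists_min_image (fun y => sg y c) ⟨y0, by simpa using hy0⟩
  simp only [Multiset.mem_toFinset] at hy hmin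
  have hR := H.mem_fib.1 hy
  refine ⟨(consW v x.1, y), by rw [Tmap_cons, hR], ?_⟩
  have hl : 0 ≤ -kp c y := by have := kp_nonpos c y; linarith
  by_cases h0 : ratEval (p v) (q v) c = x.2
  · have : kp (ratEval (p v) (q v) c) x.2 = 0 := by
      rw [kp, sg_eq_zero.2 h0, Real.log_zero]
    rw [this, neg_zero]
    have h1 := mul_nonneg hD.le hle
    have := hlk v
    have h2 : 0 ≤ (Dtot p q : ℝ) ^ (if (consW v x.1, y) ∈ Bad p q η then 1 else 0) * -kp c y := mul_nonneg (by positivity) hl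
    linarith
  have hs : 0 < sg y c := sg_pos fun h => h0 (by rw [← h]; exact hR)
  have hs1 := sg_le_one y c
  have key : (η / 2) ^ (Dtot p q) * sg y c ^ ((Dtot p q) ^ (if (consW v x.1, y) ∈ Bad p q η then 1 else 0)) ≤
      ((fiber (p v) (q v) x.2).map fun y => sg y c).prod := by
    have hη2 : (η / 2) ^ (Dtot p q) ≤ 1 := pow_le_one₀ (by positivity) (by linarith)
    split_ifs with hb
    · have h1 := pow_le_prod_sg (s := fiber (p v) (q v) x.2) (c := c) hs.le hmin
      rw [H.card] at h1
      refine le_trans ?_ h1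
      rw [pow_one]
      calc _ ≤ 1 * sg y c ^ (Dtot p q) := by gcongr
        _ ≤ _ := by rw [one_mul]; exact pow_le_pow_of_le_one hs.le hs1 hdD
    · rw [pow_zero, pow_one, ← Multiset.cons_erase hy, Multiset.map_cons, Multiset.prod_cons, mul_comm]
      gcongr
      have h1 := pow_le_prod_sg (s := (fiber (p v) (q v) x.2).erase y) (c := c) (ε := η / 2) (by positivity) (fun y' hy' => by
        simp only [Bad, Set.mem_setOf_eq, cons_zero, hR, not_exists, not_and, not_le] at hb
        have e1 := hb y' hy'
        have e2 := hmin y' (Multiset.mem_of_mem_erase hy')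
        have e3 := sg_triangle y c y'
        rw [sg_comm c y'] at e3
        linarith)
      refine le_trans ?_ h1
      refine pow_le_pow_of_le_one (by positivity) (by linarith) ?_
      refine (Multiset.card_le_card (Multiset.erase_le _ _)).trans ?_
      rw [H.card]; exact hdD
  have h1 : κ v * ((η / 2) ^ (Dtot p q) * sg y c ^ ((Dtot p q) ^ (if (consW v x.1, y) ∈ Bad p q η then 1 else 0))) ≤ sg (ratEval (p v) (q v) c) x.2 :=
    (mul_le_mul_of_nonneg_left key (hκ0 v).le).trans (hκ v c x.2)
  have h2 := Real.log_le_log (by have := hκ0 v; positivity) h1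
  rw [Real.log_mul (hκ0 v).ne' (by positivity), Real.log_mul (by positivity) (by positivity), Real.log_pow, Real.log_pow] at h2
  push_cast at h2
  rw [kp, kp_comm, kp]
  linarith

def bc (p q : Fin N → ℂ[X]) (η : ℝ) (n : ℕ) (Y : SymX N) : ℕ :=
  ∑ k ∈ Finset.range n, if (Tmap p q)^[k] Y ∈ Bad p q η then 1 else 0

lemma n_steps {η : ℝ} (hη : 0 < η) (hη1 : η ≤ 1) : ∃ C : ℝ, 0 ≤ C ∧ ∀ (w : ℕ → Fin N) (c : Sphere) (n : ℕ) (x : SymX N),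
    ∃ Y : SymX N, (Tmap p q)^[n] Y = x ∧ -kp (itComp p q w n c) x.2 ≤
      (Dtot p q : ℝ) ^ bc p q η n Y * (n * C + -kp c Y.2) := by
  obtain ⟨C, hC, h1⟩ := step_bad hg hη hη1
  have hD := one_lt_D hg
  refine ⟨C, hC, fun w c n => ?_⟩
  induction n with
  | zero => intro x; exact ⟨x, rfl, by simp [bc, itComp]⟩
  | succ n ih =>
    intro x
    obtain ⟨Y1, hY1, hle⟩ := h1 (w n) x (itComp p q w n c)
    obtain ⟨Y, hY, hle2⟩ := ih Y1
    refine ⟨Y, by rw [Function.iterate_succ_apply', hY, hY1], ?_⟩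
    have hb : bc p q η (n+1) Y = bc p q η n Y + (if Y1 ∈ Bad p q η then 1 else 0) := by
      rw [bc, Finset.sum_range_succ, hY]; rfl
    rw [hb]
    set e := if Y1 ∈ Bad p q η then 1 else 0
    have h3 : (1:ℝ) ≤ (Dtot p q : ℝ) ^ (bc p q η n Y + e) := one_le_pow₀ hD.le
    simp only [itComp, Function.comp]
    have h4 := mul_le_mul_of_nonneg_left hle2 (by positivity : (0:ℝ) ≤ (Dtot p q : ℝ) ^ e)
    rw [← mul_assoc, ← pow_add, add_comm e] at h4
    push_cast
    nlinarith

lemma bc_le {η : ℝ} {K τ : ℕ} (hτ : 1 ≤ τ) (hb : ∀ Z : SymX N, (Tmap p q)^[τ] Z ∈ juliaSet p q →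
    ((Finset.range τ).filter fun k => (Tmap p q)^[k] Z ∈ Bad p q η).card ≤ K) (n : ℕ) (Y : SymX N)
    (hY : (Tmap p q)^[n] Y ∈ juliaSet p q) : bc p q η n Y ≤ K * (n / τ) + τ := by
  induction n using Nat.strong_induction_on generalizing Y with
  | _ n ih =>
    by_cases hn : n < τ
    · refine le_trans (b := n) ?_ (by omega)
      calc bc p q η n Y ≤ ∑ k ∈ Finset.range n, 1 := Finset.sum_le_sum fun k _ => by split_ifs <;> omega
        _ = n := by simp
    · obtain ⟨m, rfl⟩ := Nat.exists_eq_add_of_le (not_lt.1 hn)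
      have h1 := ih m (by omega) ((Tmap p q)^[τ] Y) (by rw [← Function.iterate_add_apply, add_comm]; exact hY)
      have h2 := hb Y (J_backn hg (n := m) (by rw [← Function.iterate_add_apply, add_comm]; exact hY))
      rw [Finset.card_filter] at h2
      have h3 : bc p q η (τ + m) Y = bc p q η τ Y + bc p q η m ((Tmap p q)^[τ] Y) := by
        rw [bc, Finset.sum_range_add]
        simp only [bc, ← Function.iterate_add_apply, add_comm τ]
      rw [h3, Nat.add_div_left _ (by omega)]
      have : K * (m / τ).succ = K * (m / τ) + K := by rw [Nat.succ_eq_add_one]; ring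
      have h4 : bc p q η τ Y ≤ K := h2
      rw [this]; omega

omit hg in
lemma msum_int {m : Measure Sphere} {f : SymX N → Sphere → ℝ} {B : ℝ} (h : ∀ Y, Integrable (f Y) m ∧ ∫ c, f Y c ∂m ≤ B)
    (s : Multiset (SymX N)) : Integrable (fun c => (s.map fun Y => f Y c).sum) m ∧
      ∫ c, (s.map fun Y => f Y c).sum ∂m ≤ s.card * B := by
  induction s using Multiset.induction_on with
  | empty => simp
  | cons a s ih =>
    simp only [Multiset.map_cons, Multiset.sum_cons, Multiset.card_cons]
    refine ⟨(h a).1.add ih.1, ?_⟩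
    rw [integral_add (h a).1 ih.1]
    push_cast
    linarith [(h a).2, ih.2]

theorem equiJ (hA1 : NoSuperAttract p q) {x : SymX N} (hx : x ∈ juliaSet p q) : Equi p q (Measure.dirac x.2) := by
  intro a r hr
  refine ⟨fun n => integrable_dirac (by simp), ?_⟩
  simp only [integral_dirac]
  obtain ⟨K, hK⟩ := bad_bound hg hA1
  obtain ⟨L0, C1, hL0, hC1, htail⟩ := tail a hr
  have ht0 : 0 ≤ th p q := th_nonneg hg
  have ht1 := th_lt hg
  have hD := one_lt_D hg
  set s0 : ℝ := 2 / (1 + th p q) with hs0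
  have hs1 : 1 < s0 := by rw [hs0, lt_div_iff₀ (by linarith)]; linarith
  have hs2 : th p q * s0 < 1 := by rw [hs0, mul_div, div_lt_one (by linarith)]; linarith
  obtain ⟨τ', hτ'⟩ := pow_unbounded_of_one_lt ((Dtot p q : ℝ) ^ K) hs1
  set τ := τ' + 1
  have hτ : (Dtot p q : ℝ) ^ K ≤ s0 ^ τ := hτ'.le.trans (pow_le_pow_right₀ hs1.le (by omega))
  obtain ⟨η', hη', hb'⟩ := hK τ
  set η := min η' 1
  have hη : 0 < η := lt_min hη' one_pos
  have hb : ∀ Z : SymX N, (Tmap p q)^[τ] Z ∈ juliaSet p q →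
    ((Finset.range τ).filter fun k => (Tmap p q)^[k] Z ∈ Bad p q η).card ≤ K := fun Z hZ => by
    refine (Finset.card_le_card ?_).trans (hb' Z hZ)
    intro k hk
    simp only [Finset.mem_filter] at hk ⊢
    obtain ⟨h1, y, h2, h3⟩ := hk
    exact ⟨h1, y, h2, h3.trans (min_le_left _ _)⟩
  obtain ⟨C, hC, hst⟩ := n_steps hg hη (min_le_right _ _)
  set A : ℝ := C + Real.log (Dtot p q)
  have hlog : 0 ≤ Real.log (Dtot p q) := Real.log_nonneg hD.le
  have hbound : ∀ n, -en p q (cm a r) n x.2 ≤ (Dtot p q : ℝ) ^ τ * ((th p q * s0) ^ n * (n * A + (L0 + C1))) := fun n => by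
    set L : ℝ := n * Real.log (Dtot p q) with hL
    have hLn : 0 ≤ L := by positivity
    set E := K * (n / τ) + τ with hE
    let Sf : Sphere → ℝ := fun c => ((preimTn p q n x).map fun Y => max (-kp Y.2 c - (L + L0)) 0).sum
    have hS := msum_int (f := fun Y c => max (-kp Y.2 c - (L + L0)) 0) (m := cm a r) (fun Y => htail Y.2 L hLn) (preimTn p q n x)
    rw [card_preimTn hg] at hS
    have hpt : ∀ c, -(Pf p q ^ n) (kp x.2) c ≤ th p q ^ n * ((Dtot p q : ℝ) ^ E * (n * C + L + L0 + Sf c)) := fun c => by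
      have h1 : -(Pf p q ^ n) (kp x.2) c = (Pf p q ^ n) (-kp x.2) c := by rw [map_neg]; rfl
      rw [h1]
      refine Pfn_le hg n fun w => ?_
      obtain ⟨Y, hY, hle⟩ := hst w c n x
      rw [Pi.neg_apply, kp_comm]
      refine hle.trans ?_
      have hE' := bc_le hg (by omega) hb n Y (by rw [hY]; exact hx)
      have h2 : -kp c Y.2 ≤ L + L0 + Sf c := by
        have h3 : max (-kp Y.2 c - (L + L0)) 0 ≤ Sf c := by
          refine Multiset.single_le_sum ?_ _ (Multiset.mem_map_of_mem _ ((mem_preimTn hg).2 hY))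
          intro z hz
          obtain ⟨_, _, rfl⟩ := Multiset.mem_map.1 hz
          exact le_max_right _ _
        have h4 := le_max_left (-kp Y.2 c - (L + L0)) 0
        rw [kp_comm c]
        linarith
      have h5 : 0 ≤ -kp c Y.2 := by have := kp_nonpos c Y.2; linarith
      calc _ ≤ (Dtot p q : ℝ) ^ E * (n * C + -kp c Y.2) := 
            mul_le_mul_of_nonneg_right (pow_le_pow_right₀ hD.le hE') (by positivity)
        _ ≤ _ := mul_le_mul_of_nonneg_left (by linarith) (by positivity)
    haveI := (cm_nice a hr).null
    have hI := (main_id hg (m := cm a r) (cm_nice a hr).int n x.2).1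
    have hI2 : Integrable (fun c => th p q ^ n * ((Dtot p q : ℝ) ^ E * (n * C + L + L0 + Sf c))) (cm a r) :=
      (((integrable_const _).add hS.1).const_mul _).const_mul _
    have h6 : -en p q (cm a r) n x.2 ≤ ∫ c, th p q ^ n * ((Dtot p q : ℝ) ^ E * (n * C + L + L0 + Sf c)) ∂(cm a r) := by
      rw [en, ← integral_neg]
      exact integral_mono hI.neg hI2 hpt
    rw [integral_const_mul, integral_const_mul, integral_add (integrable_const _) hS.1, integral_const] at h6
    simp only [probReal_univ, one_smul] at h6
    have h7 : ∫ c, Sf c ∂(cm a r) ≤ C1 := by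
      refine hS.2.trans (le_of_eq ?_)
      rw [hL, ← Real.log_pow, Real.exp_neg, Real.exp_log (by positivity)]
      push_cast
      field_simp
    have h8 : (Dtot p q : ℝ) ^ E ≤ (Dtot p q : ℝ) ^ τ * s0 ^ n := by
      rw [hE, pow_add, mul_comm, pow_mul]
      gcongr
      calc ((Dtot p q : ℝ) ^ K) ^ (n / τ) ≤ (s0 ^ τ) ^ (n / τ) := by gcongr
        _ = s0 ^ (τ * (n / τ)) := (pow_mul _ _ _).symm
        _ ≤ s0 ^ n := pow_le_pow_right₀ hs1.le (Nat.mul_div_le _ _)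
    calc _ ≤ _ := h6
      _ ≤ th p q ^ n * (((Dtot p q : ℝ) ^ τ * s0 ^ n) * (n * C + L + L0 + C1)) :=
        mul_le_mul_of_nonneg_left ((mul_le_mul_of_nonneg_left (by linarith) (by positivity)).trans
          (mul_le_mul_of_nonneg_right h8 (by positivity))) (by positivity)
      _ = _ := by rw [mul_pow]; ring
  have hlim : Tendsto (fun n : ℕ => (Dtot p q : ℝ) ^ τ * ((th p q * s0) ^ n * (n * A + (L0 + C1)))) atTop (𝓝 0) := by
    have hn : 0 ≤ th p q * s0 := by positivity
    have h1 := (tendsto_self_mul_const_pow_of_lt_one hn hs2).mul_const A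
    have h2 := (tendsto_pow_atTop_nhds_zero_of_lt_one hn hs2).mul_const (L0 + C1)
    have := (h1.add h2).const_mul ((Dtot p q : ℝ) ^ τ)
    simp only [zero_mul, add_zero, mul_zero] at this
    refine this.congr fun n => by ring
  have h9 := squeeze_zero (fun n => by have := en_nonpos hg (cm a r) n x.2; linarith) hbound hlim
  simpa using h9.neg
end

end

section
/-! ### Part 10: the Julia set is nonempty -/
attribute [local instance] sphMS
attribute [local instance] sphMeas
attribute [local instance] sphBorel

lemma GSn_zero {p q : Fin N → ℂ[X]} (hg : Good p q) {φ : Sphere → ℝ} {n : ℕ} {z : Sphere}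
    (h : ∀ w y, itComp p q w n y = z → φ y = 0) : (GS p q ^ n) φ z = 0 := by
  induction n generalizing z with
  | zero =>
    obtain ⟨hN, -⟩ := hg
    exact h (fun _ => ⟨0, hN⟩) z rfl
  | succ n ih =>
    rw [pow_succ', Module.End.mul_apply, GS_apply]
    refine mul_eq_zero_of_right _ (Finset.sum_eq_zero fun v _ => ?_)
    refine Multiset.sum_eq_zero fun a ha => ?_
    obtain ⟨y, hy, rfl⟩ := Multiset.mem_map.1 ha
    refine ih fun w u hu => h (Function.update w n v) u ?_
    simp only [itComp, Function.comp, Function.update_self]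
    rw [itComp_congr p q (w' := w), hu, (RMv hg v).mem_fib.1 hy]
    intro k hk
    rw [Function.update_of_ne hk.ne]

lemma circ_far (c : Sphere) : (∀ b : ℂ, ‖b - 0‖ = 1/10 → 1/4 ≤ sg b c) ∨ (∀ b : ℂ, ‖b - 0‖ = 10 → 1/4 ≤ sg b c) := by
  by_contra! hcon
  obtain ⟨⟨b, hb, h1⟩, b', hb', h2⟩ := hcon
  rw [sub_zero] at hb hb'
  have e1 : sg ((0:ℂ) : Sphere) b ≤ 1/10 := by
    rw [sg_comm, sg_coe, sub_zero, hb]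
    have := nn_one_le b
    have := nn_one_le 0
    rw [div_le_iff₀ (by positivity)]
    nlinarith
  have e2 : sg (b' : Sphere) OnePoint.infty ≤ 1/10 := by
    rw [sg_comm, sg_inf]
    have : 10 ≤ nn b' := by
      have := fst_le_n2 (b', 1)
      simp only [hb'] at this; exact this
    rw [inv_eq_one_div]
    exact one_div_le_one_div_of_le (by norm_num) this
  have e3 : sg ((0:ℂ) : Sphere) OnePoint.infty = 1 := by
    rw [sg_comm, sg_inf, nn, n2_eq]; simp
  have t1 := sg_triangle ((0:ℂ) : Sphere) b OnePoint.infty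
  have t2 := sg_triangle (b : Sphere) c OnePoint.infty
  have t3 := sg_triangle c b' OnePoint.infty
  rw [sg_comm c b'] at t3
  linarith

theorem julia_nonempty {p q : Fin N → ℂ[X]} (hg : Good p q) : (juliaSet p q).Nonempty := by
  by_contra hne
  rw [Set.not_nonempty_iff_eq_empty] at hne
  obtain ⟨v, hv⟩ := hg.2.2.2
  have hF : ∀ z, z ∈ fatouW p q (fun _ => v) := fun z => by
    by_contra hz
    have : ((fun _ => v : ℕ → Fin N), z) ∈ juliaSet p q :=
      subset_closure (Set.mem_iUnion.2 ⟨_, rfl, hz⟩)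
    rw [hne] at this; exact this
  let p1 : Fin 1 → ℂ[X] := fun _ => p v
  let q1 : Fin 1 → ℂ[X] := fun _ => q v
  have hg1 : Good p1 q1 := ⟨le_rfl, fun _ => hg.2.1 v, fun _ => hg.2.2.1 v, 0, hv⟩
  have hit : ∀ n w, itComp p1 q1 w n = itComp p q (fun _ => v) n := fun n w => by
    induction n with
    | zero => rfl
    | succ n ih => simp only [itComp, ih, p1, q1]
  obtain ⟨ℓ, hℓ⟩ := T0 hg1
  have hloc : ∀ y : Sphere, ∃ O : Set Sphere, IsOpen O ∧ y ∈ O ∧ ∀ φ : C(Sphere, ℝ), tsupport φ ⊆ O → ℓ φ = 0 := fun y => by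
    obtain ⟨U, hU, hy, hn⟩ := hF y
    obtain ⟨K, hK, hyK, hKU⟩ := exists_compact_subset hU hy
    obtain ⟨f, hf, g, hgl⟩ := hn (fun n => itComp p q (fun _ => v) (n+1)) fun n => ⟨n+1, by omega, rfl⟩
    obtain ⟨n0, hn0⟩ := eventually_atTop.1 (hgl K hKU hK (1/10) (by norm_num))
    set s : ℕ → Sphere → Sphere := fun n => itComp p q (fun _ => v) (f n + 1) with hs
    have hn0' : ∀ n ≥ n0, ∀ z ∈ K, sg (s n z) (g z) < 1/20 := fun n hn z hz => by
      have := hn0 n hn z hz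
      rw [sphDist_eq] at this; linarith
    have hsc : Continuous fun z => sg (s n0 z) (s n0 y) :=
      (continuous_sg_left _).comp (itComp_cont hg _ _)
    refine ⟨interior K ∩ {z | sg (s n0 z) (s n0 y) < 1/20}, isOpen_interior.inter (isOpen_lt hsc continuous_const),
      ⟨hyK, by simp [sg_self]⟩, fun φ hφ => ?_⟩
    have hsm : ∀ n ≥ n0, ∀ z, φ z ≠ 0 → sg (s n z) (g y) < 1/4 := fun n hn z hz => by
      obtain ⟨h1, h2⟩ := hφ (subset_tsupport _ hz)
      have h2' : sg (s n0 z) (s n0 y) < 1/20 := h2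
      have a1 := hn0' n hn z (interior_subset h1)
      have a2 := hn0' n0 le_rfl z (interior_subset h1)
      have a3 := hn0' n0 le_rfl y (interior_subset hyK)
      have t1 := sg_triangle (s n z) (g z) (g y)
      have t2 := sg_triangle (g z) (s n0 z) (g y)
      have t3 := sg_triangle (s n0 z) (s n0 y) (g y)
      rw [sg_comm] at a2
      linarith
    have main : ∀ r : ℝ, 0 < r → (∀ b : ℂ, ‖b - 0‖ = r → 1/4 ≤ sg b (g y)) → ℓ φ = 0 := fun r hr hfar => by
      have hl := hℓ (cm 0 r) inferInstance ((cm_nice 0 hr).equi hg1) φ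
      have hl2 := hl.comp ((tendsto_add_atTop_nat 1).comp hf.tendsto_atTop)
      refine tendsto_nhds_unique hl2 (tendsto_const_nhds.congr' ?_)
      filter_upwards [eventually_ge_atTop n0] with n hn
      simp only [Function.comp]
      symm
      refine integral_eq_zero_of_ae ?_
      filter_upwards [cm_ae 0 r hr.le] with z hz
      obtain ⟨b, rfl, hb⟩ := hz
      refine GSn_zero hg1 fun w u hu => ?_
      by_contra h0
      rw [hit] at hu
      have := hsm n hn u h0
      rw [hs] at this
      simp only [hu] at this
      linarith [hfar b hb]
    rcases circ_far (g y) with h | h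
    · exact main _ (by norm_num) h
    · exact main _ (by norm_num) h
  choose O hO hyO hO0 using hloc
  obtain ⟨t, ht⟩ := isCompact_univ.elim_finite_subcover O hO fun y _ => Set.mem_iUnion.2 ⟨y, hyO y⟩
  obtain ⟨e⟩ : Nonempty (Fin t.card ≃ t) := ⟨t.equivFin.symm⟩
  obtain ⟨f, hf1, hf2, -, -⟩ := exists_continuous_sum_one_of_isOpen_isCompact (s := fun i => O (e i)) (t := Set.univ)
    (fun i => hO _) isCompact_univ (fun z hz => by
      obtain ⟨y, hy, hz⟩ := Set.mem_iUnion₂.1 (ht hz)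
      exact Set.mem_iUnion.2 ⟨e.symm ⟨y, hy⟩, by simpa using hz⟩)
  have h0 := tendsto_finsetSum (Finset.univ : Finset (Fin t.card)) fun i _ =>
    hℓ (cm 0 1) inferInstance ((cm_nice 0 one_pos).equi hg1) (f i)
  simp only [fun i => hO0 _ (f i) (hf1 i), Finset.sum_const_zero] at h0
  refine one_ne_zero (α := ℝ) (tendsto_nhds_unique (tendsto_const_nhds.congr fun n => ?_) h0)
  rw [← integral_finsetSum _ fun i _ => cont_int (GSn_cont hg1 (f i).continuous n) _]
  have : ∀ z, ∑ i, (GS p1 q1 ^ n) (f i) z = 1 := fun z => by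
    have h1 : (∑ i, (f i : Sphere → ℝ)) = fun _ => 1 := by
      funext z
      have := hf2 (Set.mem_univ z)
      simpa using this
    rw [← Finset.sum_apply, ← map_sum, h1, GSn_const hg1]
  simp [this]

end

section
/-! ### Part 11: the limit measure -/
section
attribute [local instance] sphMS
attribute [local instance] sphMeas
attribute [local instance] sphBorel

lemma T0J {p q : Fin N → ℂ[X]} (hg : Good p q) (hA1 : NoSuperAttract p q) :
    ∃ ℓ : C(Sphere, ℝ) → ℝ, ∀ x ∈ juliaSet p q, ∀ φ : C(Sphere, ℝ),
      Tendsto (fun n => (GS p q ^ n) φ x.2) atTop (𝓝 (ℓ φ)) := by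
  obtain ⟨ℓ, hℓ⟩ := T0 hg
  refine ⟨ℓ, fun x hx φ => ?_⟩
  have := hℓ (Measure.dirac x.2) inferInstance (equiJ hg hA1 hx) φ
  simpa only [integral_dirac] using this
end

def GX (p q : Fin N → ℂ[X]) : Module.End ℝ (SymX N → ℝ) where
  toFun g := fun x => (Dtot p q : ℝ)⁻¹ * ((preimT p q x).map g).sum
  map_add' f g := by
    funext x
    simp [Multiset.sum_map_add, mul_add]
  map_smul' r g := by
    funext x
    simp only [Pi.smul_apply, smul_eq_mul, Multiset.sum_map_mul_left, RingHom.id_apply]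
    ring

section
variable {p q}

lemma GX_apply (g : SymX N → ℝ) (x) : GX p q g x = (Dtot p q : ℝ)⁻¹ * ((preimT p q x).map g).sum := rfl

lemma GX_apply' (g : SymX N → ℝ) (x) : GX p q g x = (Dtot p q : ℝ)⁻¹ *
    ∑ v, ((fiber (p v) (q v) x.2).map fun y => g (consW v x.1, y)).sum := by
  rw [GX_apply, preimT]
  congr 1
  rw [← Multiset.coe_mapAddMonoidHom, map_sum, ← Multiset.coe_sumAddMonoidHom, map_sum]
  simp [Multiset.map_map, Function.comp_def]

lemma GXn_apply (n : ℕ) (g : SymX N → ℝ) (x) :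
    (GX p q ^ n) g x = ((Dtot p q : ℝ) ^ n)⁻¹ * ((preimTn p q n x).map g).sum := by
  induction n generalizing x with
  | zero => simp [preimTn]
  | succ n ih =>
    rw [pow_succ', Module.End.mul_apply, GX_apply, preimTn, Multiset.map_bind, Multiset.sum_bind]
    simp only [ih, Multiset.sum_map_mul_left]
    rw [pow_succ, mul_inv, ← mul_assoc, mul_comm (Dtot p q : ℝ)⁻¹]

lemma GXn_snd (n : ℕ) (φ : Sphere → ℝ) : (GX p q ^ n) (fun x => φ x.2) = fun x => (GS p q ^ n) φ x.2 := by
  induction n with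
  | zero => rfl
  | succ n ih =>
    rw [pow_succ', Module.End.mul_apply, ih, pow_succ', Module.End.mul_apply]
    funext x
    rw [GX_apply', GS_apply]

lemma GXn_cyl (k : ℕ) (g : SymX N → ℝ) (h : ∀ w w' z, (∀ i < k, w i = w' i) → g (w, z) = g (w', z)) (w w' z) :
    (GX p q ^ k) g (w, z) = (GX p q ^ k) g (w', z) := by
  induction k generalizing g with
  | zero => exact h _ _ _ (by simp)
  | succ k ih =>
    rw [pow_succ, Module.End.mul_apply]
    refine ih _ fun w w' z hw => ?_
    rw [GX_apply', GX_apply']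
    congr 1
    refine Finset.sum_congr rfl fun v _ => ?_
    congr 1
    refine Multiset.map_congr rfl fun y _ => h _ _ _ fun i hi => ?_
    simp only [consW]
    split_ifs
    · rfl
    · exact hw _ (by omega)

variable (hg : Good p q)
include hg

lemma GX_cont {g : SymX N → ℝ} (h : Continuous g) : Continuous (GX p q g) := by
  have : GX p q g = fun x => (Dtot p q : ℝ)⁻¹ *
    ∑ v, ((fiber (p v) (q v) x.2).map fun y => g (consW v x.1, y)).sum := funext (GX_apply' g)
  rw [this]
  refine continuous_const.mul (continuous_finsetSum _ fun v _ => ?_)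
  have h2 : Continuous fun x : (ℕ → Fin N) × Sphere => g (consW v x.1, x.2) :=
    h.comp (((cons_cont v).comp continuous_fst).prodMk continuous_snd)
  exact (RMv hg v).continuous_sum h2

lemma GXn_cont {g : SymX N → ℝ} (h : Continuous g) (n : ℕ) : Continuous ((GX p q ^ n) g) := by
  induction n with
  | zero => exact h
  | succ n ih => rw [pow_succ', Module.End.mul_apply]; exact GX_cont hg ih

lemma GXn_const (r : ℝ) (n : ℕ) (x) : (GX p q ^ n) (fun _ => r) x = r := by
  rw [GXn_apply]
  have := D_pos hg
  simp [card_preimTn hg]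
  field_simp

lemma GXn_nonneg {g : SymX N → ℝ} (n : ℕ) (x) (h : ∀ y ∈ preimTn p q n x, 0 ≤ g y) : 0 ≤ (GX p q ^ n) g x := by
  rw [GXn_apply]
  refine mul_nonneg (by positivity) (Multiset.sum_nonneg fun a ha => ?_)
  obtain ⟨y, hy, rfl⟩ := Multiset.mem_map.1 ha
  exact h y hy

lemma GXn_abs {g : SymX N → ℝ} {C : ℝ} (n : ℕ) (x) (h : ∀ y, |g y| ≤ C) : |(GX p q ^ n) g x| ≤ C := by
  have h1 := GXn_nonneg hg (g := (fun _ => C) - g) n x fun y _ => by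
    have := abs_le.1 (h y); simp; linarith
  have h2 := GXn_nonneg hg (g := (fun _ => C) + g) n x fun y _ => by
    have := abs_le.1 (h y); simp; linarith
  rw [map_sub, Pi.sub_apply, GXn_const hg] at h1
  rw [map_add, Pi.add_apply, GXn_const hg] at h2
  exact abs_le.2 ⟨by linarith, by linarith⟩

omit hg in
lemma cyl_approx (a : Fin N) (g : C(SymX N, ℝ)) {ε : ℝ} (hε : 0 < ε) :
    ∃ k : ℕ, ∀ x : SymX N, |g (fun n => if n < k then x.1 n else a, x.2) - g x| ≤ ε := by
  by_contra! hcon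
  choose x hx using hcon
  obtain ⟨x0, φ, hφ, hlim⟩ := CompactSpace.tendsto_subseq x
  have h2 : Tendsto (fun j => ((fun n => if n < φ j then (x (φ j)).1 n else a, (x (φ j)).2) : SymX N)) atTop (𝓝 x0) := by
    refine Tendsto.prodMk_nhds (tendsto_pi_nhds.2 fun n => ?_) ((continuous_snd.tendsto _).comp hlim)
    have h3 := ((continuous_apply n).tendsto _).comp ((continuous_fst.tendsto _).comp hlim)
    refine h3.congr' ?_
    filter_upwards [hφ.tendsto_atTop.eventually (eventually_gt_atTop n)] with j hj
    simp [hj]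
  have h4 := (((g.continuous.tendsto _).comp h2).sub ((g.continuous.tendsto _).comp hlim)).abs
  simp only [sub_self, abs_zero] at h4
  obtain ⟨j, hj⟩ := (h4.eventually (gt_mem_nhds hε)).exists
  exact absurd hj (not_lt.2 (hx (φ j)).le)

theorem T1 (hA1 : NoSuperAttract p q) : ∃ L : C(SymX N, ℝ) → ℝ, ∀ x ∈ juliaSet p q, ∀ g : C(SymX N, ℝ),
    Tendsto (fun n => (GX p q ^ n) g x) atTop (𝓝 (L g)) := by
  obtain ⟨ℓ, hℓ⟩ := T0J hg hA1
  obtain ⟨x0, hx0⟩ := julia_nonempty hg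
  let a : Fin N := ⟨0, hg.1⟩
  have t1 : Tendsto (Prod.fst : ℕ × ℕ → ℕ) atTop atTop := by
    rw [← prod_atTop_atTop_eq]; exact tendsto_fst
  have t2 : Tendsto (Prod.snd : ℕ × ℕ → ℕ) atTop atTop := by
    rw [← prod_atTop_atTop_eq]; exact tendsto_snd
  have main : ∀ x ∈ juliaSet p q, ∀ g : C(SymX N, ℝ),
      Tendsto (fun nm : ℕ × ℕ => (GX p q ^ nm.1) g x - (GX p q ^ nm.2) g x0) atTop (𝓝 0) := fun x hx => by
    have hcl := closed_null (l := (atTop : Filter (ℕ × ℕ)))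
      (fun (nm : ℕ × ℕ) (g : C(SymX N, ℝ)) => (GX p q ^ nm.1) g x - (GX p q ^ nm.2) g x0) 2 (fun nm f g => by
        have h1 := GXn_abs hg (g := (f : SymX N → ℝ) - g) nm.1 x (C := ‖f - g‖) fun y => (f - g).norm_coe_le_norm y
        have h2 := GXn_abs hg (g := (f : SymX N → ℝ) - g) nm.2 x0 (C := ‖f - g‖) fun y => (f - g).norm_coe_le_norm y
        rw [map_sub, Pi.sub_apply] at h1 h2
        rw [abs_le] at *
        constructor <;> linarith [h1.1, h1.2, h2.1, h2.2])
    intro g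
    have : g ∈ closure {g : C(SymX N, ℝ) | Tendsto (fun nm : ℕ × ℕ => (GX p q ^ nm.1) g x - (GX p q ^ nm.2) g x0) atTop (𝓝 0)} := by
      rw [Metric.mem_closure_iff]
      intro ε hε
      obtain ⟨k, hk⟩ := cyl_approx a g (half_pos hε)
      have hc : Continuous fun x : SymX N => g (fun n => if n < k then x.1 n else a, x.2) := by
        refine g.continuous.comp (Continuous.prodMk (continuous_pi fun n => ?_) continuous_snd)
        split_ifs
        · exact (continuous_apply n).comp continuous_fst
        · exact continuous_const
      let gk : C(SymX N, ℝ) := ⟨_, hc⟩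
      refine ⟨gk, ?_, ?_⟩
      · let φ : C(Sphere, ℝ) := ⟨fun z => (GX p q ^ k) gk (fun _ => a, z),
          (GXn_cont hg gk.continuous k).comp (Continuous.prodMk continuous_const continuous_id)⟩
        have e1 : (GX p q ^ k) gk = fun x => φ x.2 := by
          funext y
          refine GXn_cyl k _ (fun w w' z hw => ?_) _ _ _
          change g _ = g _
          congr 2
          funext n
          simp only
          split_ifs with h
          · exact hw n h
          · rfl
        have e2 : ∀ y ∈ juliaSet p q, Tendsto (fun n => (GX p q ^ n) gk y) atTop (𝓝 (ℓ φ)) := fun y hy => by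
          rw [← tendsto_add_atTop_iff_nat k]
          refine (hℓ y hy φ).congr fun n => ?_
          rw [pow_add, Module.End.mul_apply, e1, GXn_snd]
        have := ((e2 x hx).comp t1).sub ((e2 x0 hx0).comp t2)
        rw [sub_self] at this
        exact this
      · refine lt_of_le_of_lt ((ContinuousMap.dist_le (half_pos hε).le).2 fun y => ?_) (half_lt_self hε)
        rw [dist_comm]
        exact hk y
    rwa [hcl.closure_eq] at this
  have hc : ∀ g : C(SymX N, ℝ), ∃ ℓ, Tendsto (fun n => (GX p q ^ n) g x0) atTop (𝓝 ℓ) := fun g => by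
    refine cauchySeq_tendsto_of_complete ?_
    rw [cauchySeq_iff_tendsto_dist_atTop_0]
    exact (tendsto_zero_iff_abs_tendsto_zero _).1 (main x0 hx0 g)
  choose L hL using hc
  refine ⟨L, fun x hx g => ?_⟩
  have h1 := (main x hx g).comp (show Tendsto (fun n : ℕ => (n, n)) atTop atTop by
    rw [← prod_atTop_atTop_eq]; exact tendsto_id.prodMk tendsto_id)
  have := h1.add (hL g)
  simpa using this

theorem T2 (hA1 : NoSuperAttract p q) : ∃ μ : Measure (SymX N), IsProbabilityMeasure μ ∧
    ∀ x ∈ juliaSet p q, ∀ g : C(SymX N, ℝ), Tendsto (fun n => (GX p q ^ n) g x) atTop (𝓝 (∫ y, g y ∂μ)) := by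
  obtain ⟨L, hL⟩ := T1 hg hA1
  obtain ⟨x0, hx0⟩ := julia_nonempty hg
  let Λ0 : CompactlySupportedContinuousMap (SymX N) ℝ →ₗ[ℝ] ℝ :=
    { toFun := fun f => L f.toContinuousMap
      map_add' := fun f g => by
        refine tendsto_nhds_unique (hL x0 hx0 _) (((hL x0 hx0 _).add (hL x0 hx0 _)).congr fun n => ?_)
        exact (congrFun (map_add (GX p q ^ n) (f : SymX N → ℝ) (g : SymX N → ℝ)) x0).symm
      map_smul' := fun r f => by
        refine tendsto_nhds_unique (hL x0 hx0 _) (((hL x0 hx0 _).const_mul r).congr fun n => ?_)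
        exact (congrFun (map_smul (GX p q ^ n) r (f : SymX N → ℝ)) x0).symm }
  let Λ := PositiveLinearMap.mk₀ Λ0 fun f hf => ge_of_tendsto' (hL x0 hx0 _) fun n =>
    GXn_nonneg hg n x0 fun y _ => CompactlySupportedContinuousMap.le_def.1 hf y
  have hΛ : ∀ f, Λ f = L f.toContinuousMap := fun f => rfl
  have hint : ∀ g : C(SymX N, ℝ), ∫ y, g y ∂(RealRMK.rieszMeasure Λ) = L g := fun g =>
    RealRMK.integral_rieszMeasure Λ (CompactlySupportedContinuousMap.continuousMapEquiv g)
  refine ⟨RealRMK.rieszMeasure Λ, ?_, fun x hx g => ?_⟩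
  · have h1 := hint (ContinuousMap.const _ 1)
    have h2 : L (ContinuousMap.const _ 1) = 1 :=
      tendsto_nhds_unique (hL x0 hx0 _) (tendsto_const_nhds.congr fun n => (GXn_const hg 1 n x0).symm)
    rw [h2] at h1
    simp only [ContinuousMap.const_apply, integral_const, smul_eq_mul, mul_one] at h1
    refine ⟨?_⟩
    rw [measureReal_def] at h1
    rw [← ENNReal.toReal_eq_one_iff]; exact h1
  · rw [hint]; exact hL x hx g

/-- properties of the support -/
theorem T3 (hA1 : NoSuperAttract p q) : ∃ μ : Measure (SymX N), IsProbabilityMeasure μ ∧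
    (∀ x ∈ juliaSet p q, ∀ g : C(SymX N, ℝ), Tendsto (fun n => (GX p q ^ n) g x) atTop (𝓝 (∫ y, g y ∂μ))) ∧
    ∃ S : Set (SymX N), S = {x : SymX N | ∀ U : Set (SymX N), IsOpen U → x ∈ U → 0 < μ U} ∧ S ⊆ juliaSet p q ∧
      IsClosed S ∧ S.Nonempty ∧ ∀ y, Tmap p q y ∈ S → y ∈ S := by
  obtain ⟨μ, hμ, hlim⟩ := T2 hg hA1
  obtain ⟨x0, hx0⟩ := julia_nonempty hg
  have hint : ∀ f : C(SymX N, ℝ), Integrable f μ := fun f =>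
    f.continuous.integrable_of_hasCompactSupport (HasCompactSupport.of_compactSpace f)
  have hcl : IsClosed (juliaSet p q) := isClosed_closure
  have hnull : ∀ f : C(SymX N, ℝ), (∀ x, 0 ≤ f x) → ∫ y, f y ∂μ = 0 → μ {x | 0 < f x} = 0 := fun f h0 hf => by
    have := (integral_eq_zero_iff_of_nonneg h0 (hint f)).1 hf
    refine measure_mono_null ?_ this
    intro x hx
    exact hx.ne'
  have hpos : ∀ f : C(SymX N, ℝ), IsOpen {x | 0 < f x} := fun f => isOpen_lt continuous_const f.continuous
  have hury : ∀ (C : Set (SymX N)) (x : SymX N), IsClosed C → x ∉ C → ∃ f : C(SymX N, ℝ), (∀ y ∈ C, f y = 0) ∧ f x = 1 ∧ ∀ y, 0 ≤ f y :=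
    fun C x hC hx => by
      obtain ⟨f, h1, h2, h3⟩ := exists_continuous_zero_one_of_isClosed hC (isClosed_singleton (x := x)) (by simpa using hx)
      exact ⟨f, h1, h2 rfl, fun y => (h3 y).1⟩
  refine ⟨μ, hμ, hlim, _, rfl, ?_, ?_, ?_, ?_⟩
  · intro x hx
    by_contra hxJ
    obtain ⟨f, h1, h2, h3⟩ := hury _ x hcl hxJ
    refine (hx _ (hpos f) (by simp [h2])).ne' (hnull f h3 ?_)
    refine tendsto_nhds_unique (hlim x0 hx0 f) (tendsto_const_nhds.congr fun n => ?_)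
    rw [GXn_apply, Multiset.sum_eq_zero, mul_zero]
    intro a ha
    obtain ⟨y, hy, rfl⟩ := Multiset.mem_map.1 ha
    exact h1 y (preimTn_J hg hx0 hy)
  · rw [← isOpen_compl_iff, isOpen_iff_mem_nhds]
    intro x hx
    simp only [Set.mem_compl_iff, Set.mem_setOf_eq, not_forall, not_lt] at hx
    obtain ⟨U, hU, hxU, h0⟩ := hx
    filter_upwards [hU.mem_nhds hxU] with y hy hy2
    exact (hy2 U hU hy).not_ge h0
  · by_contra hne
    rw [Set.not_nonempty_iff_eq_empty] at hne
    have : ∀ x : SymX N, ∃ U : Set (SymX N), IsOpen U ∧ x ∈ U ∧ μ U = 0 := fun x => by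
      have hx : x ∉ {x : SymX N | ∀ U : Set (SymX N), IsOpen U → x ∈ U → 0 < μ U} := by rw [hne]; simp
      simp only [Set.mem_setOf_eq, not_forall, not_lt] at hx
      obtain ⟨U, hU, hxU, h0⟩ := hx
      exact ⟨U, hU, hxU, le_antisymm h0 bot_le⟩
    have h1 : μ Set.univ = 0 := by
      refine isCompact_univ.measure_zero_of_nhdsWithin fun x _ => ?_
      obtain ⟨U, hU, hxU, h0⟩ := this x
      exact ⟨U, mem_nhdsWithin_of_mem_nhds (hU.mem_nhds hxU), h0⟩
    rw [measure_univ] at h1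
    exact one_ne_zero h1
  · intro y hy U hU hyU
    by_contra h0
    have h0' : μ U = 0 := le_antisymm (not_lt.1 h0) bot_le
    obtain ⟨f, h1, h2, h3⟩ := hury Uᶜ y hU.isClosed_compl (by simpa using hyU)
    have hf0 : ∫ y, f y ∂μ = 0 := by
      refine integral_eq_zero_of_ae ?_
      have : ∀ᵐ x ∂μ, x ∉ U := measure_eq_zero_iff_ae_notMem.1 h0'
      filter_upwards [this] with x hx
      exact h1 x hx
    let Gf : C(SymX N, ℝ) := ⟨GX p q f, GX_cont hg f.continuous⟩
    have hG0 : ∀ x, 0 ≤ Gf x := fun x => by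
      have := GXn_nonneg hg (g := f) 1 x fun y _ => h3 y
      rw [pow_one] at this; exact this
    have hG1 : ∫ y, Gf y ∂μ = 0 := by
      rw [← hf0]
      refine tendsto_nhds_unique (hlim x0 hx0 Gf) (((tendsto_add_atTop_iff_nat 1).2 (hlim x0 hx0 f)).congr fun n => ?_)
      rw [pow_succ, Module.End.mul_apply]; rfl
    refine (hy _ (hpos Gf) ?_).ne' (hnull Gf hG0 hG1)
    have hD := D_pos hg
    change 0 < GX p q f (Tmap p q y)
    rw [GX_apply]
    refine mul_pos (by positivity) (lt_of_lt_of_le (one_pos : (0:ℝ) < 1) ?_)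
    rw [← h2]
    refine Multiset.single_le_sum ?_ _ (Multiset.mem_map_of_mem _ ((mem_preimT hg).2 rfl))
    intro z hz
    obtain ⟨_, _, rfl⟩ := Multiset.mem_map.1 hz
    exact h3 _
end

end

section
/-! ### Part 12: lower bounds for potentials off the support -/
attribute [local instance] sphMS
attribute [local instance] sphMeas
attribute [local instance] sphBorel

lemma cC_low (a : ℂ) {r : ℝ} (hr : 0 < r) (hr1 : r ≤ 1) : Real.log (nn a) - 1 ≤ cC a r := by
  have h : ∀ θ, Real.log (nn a) - 1 ≤ Real.log (nn (circleMap a r θ)) := fun θ => by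
    have h1 := log_lip one_pos (nn_one_le a) (nn_one_le (circleMap a r θ))
    have h2 := nn_lip a (circleMap a r θ)
    have h3 := nn_lip (circleMap a r θ) a
    have h4 : ‖circleMap a r θ - a‖ = r := by simp [circleMap, abs_of_pos hr]
    rw [norm_sub_rev] at h2
    rw [h4] at h2 h3
    have h5 : |nn a - nn (circleMap a r θ)| ≤ 1 := abs_le.2 ⟨by linarith, by linarith⟩
    have := (abs_le.1 h1).2
    linarith
  calc Real.log (nn a) - 1 = ∫ θ, (Real.log (nn a) - 1) ∂ang := by simp
    _ ≤ _ := integral_mono (integrable_const _) (lognn_int a r) h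

lemma kp_low (a : ℂ) {r : ℝ} (hr : 0 < r) (hr1 : r ≤ 1) (z : Sphere) (hz : r ≤ sg a z) :
    Km (cm a r) z - 1 ≤ kp a z := by
  have h0 := cC_low a hr hr1
  induction z using OnePoint.rec with
  | infty =>
    rw [kp_comm, kp_inf, Km_inf]; linarith
  | coe b =>
    have h1 : r ≤ ‖b - a‖ := by
      refine hz.trans ?_
      rw [sg_coe, norm_sub_rev]
      refine div_le_self (norm_nonneg _) ?_
      have := nn_one_le a
      have := nn_one_le b
      nlinarith
    have h2 : b ≠ a := fun h => by rw [h, sub_self, norm_zero] at h1; linarith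
    rw [kp_coe h2, Km_coe a hr, max_eq_left h1]; linarith

section
variable {p q : Fin N → ℂ[X]} (hg : Good p q)
include hg

lemma low_pt (hA1 : NoSuperAttract p q) : ∃ C, ∀ x ∈ juliaSet p q, ∀ (a : ℂ) (r : ℝ), 0 < r →
    ∃ M, ∀ m ≥ M, -C ≤ (GS p q ^ m) (Km (cm a r)) x.2 := by
  obtain ⟨C1, hC1, hK⟩ := (cm_nice 0 one_pos).bdd
  obtain ⟨C2, hC2, hU, -⟩ := un_bdd hg
  refine ⟨C1 + 2 * C2 + 2, fun x hx a r hr => ?_⟩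
  have hun : ∀ (m : Measure Sphere) [IsProbabilityMeasure m] n, |∫ c, un p q n c ∂m| ≤ C2 := fun m _ n => by
    have := norm_integral_le_of_norm_le_const (μ := m) (f := un p q n) (C := C2) (Eventually.of_forall fun c => hU n c)
    simpa using this
  have h1 := (equiJ hg hA1 hx a r hr).2
  have h2 := (equiJ hg hA1 hx 0 1 one_pos).2
  simp only [integral_dirac] at h1 h2
  obtain ⟨M, hM⟩ := eventually_atTop.1 ((h1.eventually (lt_mem_nhds (show (-1:ℝ) < 0 by norm_num))).and
    (h2.eventually (gt_mem_nhds (show (0:ℝ) < 1 by norm_num))))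
  refine ⟨M, fun m hm => ?_⟩
  obtain ⟨h3, h4⟩ := hM m hm
  haveI := (cm_nice a hr).null
  haveI := (cm_nice 0 one_pos).null
  have e1 := (main_id hg (kp_int a hr) m x.2).2
  have e2 := (main_id hg (kp_int 0 one_pos) m x.2).2
  have b1 := abs_le.1 (GSn_abs hg hK m x.2)
  have b2 := abs_le.1 (hun (cm a r) m)
  have b3 := abs_le.1 (hun (cm 0 1) m)
  linarith [b1.1, b2.1, b3.2]

lemma low_nb (hA1 : NoSuperAttract p q) : ∃ C, ∀ x ∈ juliaSet p q, ∀ S : Set Sphere, IsClosed S →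
    (∀ m, ∀ Y ∈ preimTn p q m x, Y.2 ∈ S) → ∀ K : Set Sphere, IsCompact K → K ⊆ Sᶜ →
    ∃ M, ∀ m ≥ M, ∀ a ∈ K, -C ≤ (GX p q ^ m) (fun Y => kp a Y.2) x := by
  obtain ⟨C, hC⟩ := low_pt hg hA1
  refine ⟨C + 1 + Real.log 3, fun x hx S hS hY K hK hKS => ?_⟩
  refine hK.induction_on (p := fun K => ∃ M, ∀ m ≥ M, ∀ a ∈ K, -(C + 1 + Real.log 3) ≤ (GX p q ^ m) (fun Y => kp a Y.2) x)
    ⟨0, fun m _ a h => h.elim⟩ (fun s t hst ⟨M, hM⟩ => ⟨M, fun m hm a ha => hM m hm a (hst ha)⟩)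
    (fun s t ⟨M, hM⟩ ⟨M', hM'⟩ => ⟨max M M', fun m hm a ha => ha.elim (hM m (le_of_max_le_left hm) a) (hM' m (le_of_max_le_right hm) a)⟩) ?_
  intro a haK
  obtain ⟨δ, hδ, hball⟩ := (nhds_sph a).mem_iff.1 (hS.isOpen_compl.mem_nhds (hKS haK))
  have hfar : ∀ z ∈ S, δ ≤ sg z a := fun z hz => le_of_not_gt fun h => hball h hz
  obtain ⟨a', ha'⟩ : ∃ a' : ℂ, sg a' a < δ / 4 := by
    obtain ⟨y, ⟨b, rfl⟩, hy⟩ := (OnePoint.denseRange_coe (X := ℂ)).inter_nhds_nonempty ((nhds_sph a).mem_of_mem (show 0 < δ/4 by positivity)) 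
    exact ⟨b, hy⟩
  have hδ1 : δ ≤ 1 := (hfar _ (hY 0 x (by simp [preimTn]))).trans (sg_le_one _ _)
  obtain ⟨M, hM⟩ := hC x hx a' (δ / 4) (by positivity)
  refine ⟨_, mem_nhdsWithin_of_mem_nhds ((nhds_sph a).mem_of_mem (show 0 < δ/4 by positivity)), M, fun m hm b hb => ?_⟩
  have hb : sg b a < δ / 4 := hb
  have key : ∀ z ∈ S, Km (cm a' (δ/4)) z - 1 - Real.log 3 ≤ kp b z := fun z hz => by
    have h1 := hfar z hz
    have h2 := sg_triangle z a' a
    have h3 := sg_triangle z b a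
    have h4 := sg_triangle z b a'
    have h5 := sg_triangle b a a'
    have h6 := sg_triangle z b a'
    rw [sg_comm a a'] at h5
    have h7 := kp_low a' (show 0 < δ/4 by positivity) (by linarith) z (by rw [sg_comm]; linarith)
    have h8 : kp a' z ≤ Real.log 3 + kp b z := by
      rw [kp, kp, ← Real.log_mul (by norm_num) (by rw [sg_comm]; linarith)]
      refine Real.log_le_log ?_ ?_ <;> rw [sg_comm] 
      · linarith
      · rw [sg_comm b z]; linarith
    linarith
  have h9 := GXn_nonneg hg (g := (fun Y => kp b Y.2) - (fun Y => Km (cm a' (δ/4)) Y.2) + fun _ => (1 + Real.log 3)) m x fun Y hYm => by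
    have := key _ (hY m Y hYm); simp; linarith
  rw [map_add, map_sub, Pi.add_apply, Pi.sub_apply, GXn_const hg, GXn_snd m (Km (cm a' (δ/4)))] at h9
  have := hM m hm
  linarith
end

end

section
/-! ### Part 13: Lipschitz bounds for holomorphic families -/
attribute [local instance] sphMS

lemma root_exists {f : ℂ → ℂ} {ρ : ℝ} (hρ : 0 < ρ) (hf : DifferentiableOn ℂ f (Metric.ball 0 ρ))
    (h0 : ∀ t ∈ Metric.ball (0:ℂ) ρ, f t ≠ 0) {M : ℕ} (hM : M ≠ 0) :
    ∃ A : ℂ → ℂ, DifferentiableOn ℂ A (Metric.ball 0 ρ) ∧ (∀ t, A t ≠ 0) ∧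
      ∀ t ∈ Metric.ball (0:ℂ) ρ, A t ^ M = f t := by
  have h00 : (0:ℂ) ∈ Metric.ball (0:ℂ) ρ := Metric.mem_ball_self hρ
  have hd : DifferentiableOn ℂ (deriv f) (Metric.ball 0 ρ) := hf.deriv Metric.isOpen_ball
  obtain ⟨l, hl0, hl⟩ := ((hd.div hf h0).isExactOn_ball).with_val_at 0 (Complex.log (f 0))
  have hc : ∀ t ∈ Metric.ball (0:ℂ) ρ, f t = Complex.exp (l t) := by
    have hder : ∀ t ∈ Metric.ball (0:ℂ) ρ, HasDerivAt (fun t => f t * Complex.exp (-l t)) 0 t := fun t ht => by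
      have h1 := (hf.differentiableAt (Metric.isOpen_ball.mem_nhds ht)).hasDerivAt
      have h2 := h1.mul (hl t ht).neg.cexp
      have e : deriv f t * Complex.exp (-l t) + f t * (Complex.exp (-l t) * -(deriv f t / f t)) = 0 := by
        have := h0 t ht
        field_simp
        ring
      exact e ▸ h2
    intro t ht
    have := Convex.norm_image_sub_le_of_norm_hasDerivWithin_le (C := 0) (fun x hx => (hder x hx).hasDerivWithinAt)
      (fun x _ => by simp) (convex_ball (0:ℂ) ρ) h00 ht
    rw [zero_mul, norm_le_zero_iff, sub_eq_zero] at this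
    rw [hl0, Complex.exp_neg, Complex.exp_neg, Complex.exp_log (h0 0 h00), mul_inv_cancel₀ (h0 0 h00),
      mul_inv_eq_one₀ (Complex.exp_ne_zero _)] at this
    exact this
  refine ⟨fun t => Complex.exp (l t / M), ?_, fun t => Complex.exp_ne_zero _, fun t ht => ?_⟩
  · have : DifferentiableOn ℂ l (Metric.ball 0 ρ) := fun t ht => (hl t ht).differentiableAt.differentiableWithinAt
    exact (this.div_const _).cexp
  · rw [hc t ht, ← Complex.exp_nat_mul, mul_div_cancel₀ _ (by exact_mod_cast hM)]

lemma n2_le (u : ℂ × ℂ) : n2 u ≤ ‖u.1‖ + ‖u.2‖ := by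
  rw [n2_eq, Real.sqrt_le_left (by positivity)]
  nlinarith [norm_nonneg u.1, norm_nonneg u.2]

lemma sg_proj_le {u v : ℂ × ℂ} (hu : 1 ≤ n2 u) (hv : 1 ≤ n2 v) : sg (proj u) (proj v) ≤ n2 (u - v) := by
  have hu0 : u ≠ 0 := fun h => by rw [h, n2_eq] at hu; simp at hu; linarith
  have hv0 : v ≠ 0 := fun h => by rw [h, n2_eq] at hv; simp at hv; linarith
  rw [sg_proj hu0 hv0, div_le_iff₀ (by positivity)]
  have h1 : wdg u v = wdg (u - v) v := by simp [wdg]; ring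
  rw [h1]
  refine (wdg_le _ _).trans ?_
  have h2 := n2_nonneg (u - v)
  have : n2 v ≤ n2 u * n2 v := by nlinarith
  exact mul_le_mul_of_nonneg_left this h2

def Pm (F : ℂ → ℂ × ℂ) (s : Multiset Sphere) (t : ℂ) : ℂ := (s.map fun y => wdg (F t) (lft y) / n2 (lft y)).prod

lemma Pm_diff {F : ℂ → ℂ × ℂ} (hF : Differentiable ℂ F) (s : Multiset Sphere) : Differentiable ℂ (Pm F s) := by
  induction s using Multiset.induction with
  | empty => exact differentiable_const _
  | cons a s ih =>
    have : Pm F (a ::ₘ s) = fun t => wdg (F t) (lft a) / n2 (lft a) * Pm F s t := by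
      funext t; simp [Pm]
    rw [this]
    refine Differentiable.mul ?_ ih
    unfold wdg
    fun_prop

lemma Pm_kp {F : ℂ → ℂ × ℂ} {t : ℂ} (hF : F t ≠ 0) (s : Multiset Sphere) (hs : ∀ y ∈ s, proj (F t) ≠ y) :
    Pm F s t ≠ 0 ∧ (s.map (kp (proj (F t)))).sum = Real.log ‖Pm F s t‖ - s.card * Real.log (n2 (F t)) := by
  induction s using Multiset.induction with
  | empty => simp [Pm]
  | cons a s ih =>
    obtain ⟨h1, h2⟩ := ih fun y hy => hs y (Multiset.mem_cons_of_mem hy)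
    have e : Pm F (a ::ₘ s) t = wdg (F t) (lft a) / n2 (lft a) * Pm F s t := by simp [Pm]
    have hl := nl_pos a
    have hn := n2_pos hF
    have h3 := sg_proj hF (lft_ne a)
    rw [proj_lft] at h3
    have h4 := sg_pos (hs a (Multiset.mem_cons_self a s))
    have h5 : wdg (F t) (lft a) ≠ 0 := fun h => by rw [h3, h] at h4; simp at h4
    have h6 : (n2 (lft a) : ℂ) ≠ 0 := by exact_mod_cast hl.ne'
    have h7 := norm_pos_iff.2 h5
    refine ⟨e ▸ mul_ne_zero (div_ne_zero h5 h6) h1, ?_⟩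
    rw [Multiset.map_cons, Multiset.sum_cons, h2, e, kp, h3, norm_mul, norm_div, Complex.norm_real, Real.norm_of_nonneg hl.le,
      Real.log_mul (div_pos h7 hl).ne' (norm_ne_zero_iff.2 h1), Real.log_div h7.ne' hl.ne', Real.log_div h7.ne' (by positivity),
      Real.log_mul hn.ne' hl.ne', Multiset.card_cons]
    push_cast; ring

lemma hol_lip {F : ℂ → ℂ × ℂ} (hF : Differentiable ℂ F) {ρ : ℝ} (hρ : 0 < ρ)
    (h0 : ∀ t ∈ Metric.ball (0:ℂ) ρ, F t ≠ 0) {s : Multiset Sphere} (hs : s.card ≠ 0) {C : ℝ}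
    (hne : ∀ t ∈ Metric.ball (0:ℂ) ρ, ∀ y ∈ s, proj (F t) ≠ y)
    (hC : ∀ t ∈ Metric.ball (0:ℂ) ρ, -C ≤ (s.card : ℝ)⁻¹ * (s.map (kp (proj (F t)))).sum)
    {t t' : ℂ} (ht : t ∈ Metric.ball (0:ℂ) (ρ/2)) (ht' : t' ∈ Metric.ball (0:ℂ) (ρ/2)) :
    sg (proj (F t)) (proj (F t')) ≤ 2 * (Real.exp C / (ρ / 3)) * ‖t - t'‖ := by
  obtain ⟨A, hA, hA0, hAM⟩ := root_exists hρ (Pm_diff hF s).differentiableOn (fun t ht => (Pm_kp (h0 t ht) s (hne t ht)).1) hs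
  have hlog : ∀ t ∈ Metric.ball (0:ℂ) ρ, (s.card : ℝ)⁻¹ * (s.map (kp (proj (F t)))).sum = Real.log ‖A t‖ - Real.log (n2 (F t)) := fun t ht => by
    rw [(Pm_kp (h0 t ht) s (hne t ht)).2, ← hAM t ht, norm_pow, Real.log_pow]
    field_simp
  let G : ℂ → ℂ × ℂ := fun t => (A t)⁻¹ • F t
  have hGn : ∀ t, n2 (G t) = n2 (F t) / ‖A t‖ := fun t => by
    rw [n2_smul, norm_inv]; ring
  have hG1 : ∀ t ∈ Metric.ball (0:ℂ) ρ, 1 ≤ n2 (G t) := fun t ht => by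
    have hp := norm_pos_iff.2 (hA0 t)
    rw [hGn, le_div_iff₀ hp, one_mul, ← Real.log_le_log_iff hp (n2_pos (h0 t ht)), ← sub_nonpos, ← hlog t ht]
    refine mul_nonpos_of_nonneg_of_nonpos (by positivity) ?_
    have := Multiset.sum_map_le_sum_map (s := s) (kp (proj (F t))) (fun _ => 0) fun y _ => kp_nonpos _ _
    simpa using this
  have hG2 : ∀ t ∈ Metric.ball (0:ℂ) ρ, n2 (G t) ≤ Real.exp C := fun t ht => by
    have hp := norm_pos_iff.2 (hA0 t)
    have hn := n2_pos (h0 t ht)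
    have := hC t ht
    rw [hlog t ht] at this
    rw [hGn, ← Real.log_le_iff_le_exp (by positivity), Real.log_div hn.ne' hp.ne']
    linarith
  have hGp : ∀ t, proj (G t) = proj (F t) := fun t => proj_smul (inv_ne_zero (hA0 t)) _
  have hAi : DifferentiableOn ℂ (fun t => (A t)⁻¹) (Metric.ball 0 ρ) := hA.inv fun t _ => hA0 t
  have cau : ∀ g : ℂ → ℂ, DifferentiableOn ℂ g (Metric.ball 0 ρ) → (∀ t ∈ Metric.ball (0:ℂ) ρ, ‖g t‖ ≤ Real.exp C) →
      ‖g t - g t'‖ ≤ Real.exp C / (ρ / 3) * ‖t - t'‖ := fun g hg hb => by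
    have sub : ∀ x ∈ Metric.ball (0:ℂ) (ρ/2), Metric.closedBall x (ρ/3) ⊆ Metric.ball 0 ρ := fun x hx =>
      Metric.closedBall_subset_ball' (by have := Metric.mem_ball.1 hx; linarith)
    refine Convex.norm_image_sub_le_of_norm_deriv_le (𝕜 := ℂ) (s := Metric.ball (0:ℂ) (ρ/2)) (fun x hx => ?_) (fun x hx => ?_) (convex_ball _ _) ht' ht
    · exact hg.differentiableAt (Metric.isOpen_ball.mem_nhds (sub x hx (Metric.mem_closedBall_self (by positivity))))
    · exact Complex.norm_deriv_le_of_forall_mem_sphere_norm_le (by positivity)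
        (hg.mono (by rw [closure_ball _ (by positivity)]; exact sub x hx)).diffContOnCl
        (fun z hz => hb z (sub x hx (Metric.sphere_subset_closedBall hz)))
  have sub2 : Metric.ball (0:ℂ) (ρ/2) ⊆ Metric.ball 0 ρ := Metric.ball_subset_ball (by linarith)
  rw [← hGp, ← hGp]
  refine (sg_proj_le (hG1 t (sub2 ht)) (hG1 t' (sub2 ht'))).trans ((n2_le _).trans ?_)
  have c1 := cau (fun t => (G t).1) (hAi.mul hF.fst.differentiableOn) (fun t ht => (fst_le_n2 _).trans (hG2 t ht))
  have c2 := cau (fun t => (G t).2) (hAi.mul hF.snd.differentiableOn) (fun t ht => (snd_le_n2 _).trans (hG2 t ht))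
  simp only [Prod.fst_sub, Prod.snd_sub]
  linarith

end

section
/-! ### Part 14: the support is the whole Julia set -/
attribute [local instance] sphMS

lemma normal_of_lip {f : ℕ → Sphere → Sphere} (hf : ∀ n, Continuous (f n)) {K : Set Sphere} (hK : IsCompact K)
    {k : ℕ} {L : ℝ} (hL : ∀ n ≥ k, ∀ y ∈ K, ∀ y' ∈ K, sg (f n y) (f n y') ≤ L * sg y y') :
    NormalOn {g | ∃ n, 1 ≤ n ∧ g = f n} K := by
  haveI : CompactSpace K := isCompact_iff_compactSpace.1 hK
  intro s hs
  choose ν hν1 hν using hs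
  let B : ℕ → BoundedContinuousFunction K Sphere := fun n =>
    BoundedContinuousFunction.mkOfCompact ⟨fun y => f n y, (hf n).comp continuous_subtype_val⟩
  have hB : ∀ n y, B n y = f n y := fun n y => rfl
  have hcpt : IsCompact (closure (Set.range B)) := by
    refine BoundedContinuousFunction.arzela_ascoli Set.univ isCompact_univ _ (fun _ _ _ => trivial) ?_
    intro x
    rw [Metric.equicontinuousAt_iff_right]
    intro ε hε
    have h1 : ∀ᶠ y in 𝓝 x, ∀ n ∈ Finset.range k, dist (B n x) (B n y) < ε := by
      rw [Finset.eventually_all]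
      intro n _
      have := (Metric.tendsto_nhds.1 ((B n).continuous.tendsto x)) ε hε
      filter_upwards [this] with y hy
      rwa [dist_comm]
    have h2 : ∀ᶠ y in 𝓝 x, L * dist x y < ε := by
      have hc : Continuous fun y : K => L * dist x y := by fun_prop
      have := hc.tendsto x
      simp only [dist_self, mul_zero] at this
      exact this.eventually (gt_mem_nhds hε)
    filter_upwards [h1, h2] with y hy1 hy2
    rintro ⟨_, n, rfl⟩
    by_cases hn : n < k
    · exact hy1 n (Finset.mem_range.2 hn)
    · exact (hL n (not_lt.1 hn) x x.2 y y.2).trans_lt hy2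
  obtain ⟨g, -, φ, hφ, hg⟩ := hcpt.tendsto_subseq (x := fun j => B (ν j)) (fun j => subset_closure ⟨_, rfl⟩)
  refine ⟨φ, hφ, fun y => if h : y ∈ K then g ⟨y, h⟩ else y, fun K' hK' _ ε hε => ?_⟩
  filter_upwards [Metric.tendsto_nhds.1 hg (ε / 2) (by positivity)] with j hj y hy
  have h1 := (BoundedContinuousFunction.dist_coe_le_dist (f := B (ν (φ j))) (g := g) ⟨y, hK' hy⟩).trans_lt hj
  rw [hB, sph_dist] at h1
  rw [dif_pos (hK' hy), sphDist_eq, hν]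
  linarith

lemma chart0 (z : Sphere) : ∃ u0 u1 : ℂ × ℂ, n2 u1 = 1 ∧ wdg u0 u1 = 1 ∧ proj u0 = z := by
  induction z using OnePoint.rec with
  | infty => exact ⟨(1, 0), (0, 1), by simp [n2_eq], by simp [wdg], proj_lft OnePoint.infty⟩
  | coe b => exact ⟨(b, 1), (-1, 0), by simp [n2_eq], by simp [wdg], proj_lft b⟩

lemma chart {z : Sphere} {U : Set Sphere} (hU : U ∈ 𝓝 z) : ∃ (u0 u1 : ℂ × ℂ) (ρ c ε : ℝ), 0 < ρ ∧ 0 < ε ∧ 0 ≤ c ∧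
    (∀ t : ℂ, u0 + t • u1 ≠ 0) ∧ (Continuous fun t : ℂ => proj (u0 + t • u1)) ∧ (∀ t : ℂ, ‖t‖ ≤ ρ → proj (u0 + t • u1) ∈ U) ∧
    ∀ y y', sg y z < ε → sg y' z < ε → ∃ t t' : ℂ, ‖t‖ < ρ / 2 ∧ ‖t'‖ < ρ / 2 ∧ proj (u0 + t • u1) = y ∧
      proj (u0 + t' • u1) = y' ∧ ‖t - t'‖ ≤ c * sg y y' := by
  obtain ⟨u0, u1, h1, h2, h3⟩ := chart0 z
  have hw : ∀ t t' : ℂ, wdg (u0 + t • u1) (u0 + t' • u1) = t' - t := fun t t' => by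
    have : wdg (u0 + t • u1) (u0 + t' • u1) = (t' - t) * wdg u0 u1 := by simp [wdg]; ring
    rw [this, h2, mul_one]
  have hn1 : ∀ t : ℂ, 1 ≤ n2 (u0 + t • u1) := fun t => by
    have e : wdg (u0 + t • u1) u1 = wdg u0 u1 := by simp [wdg]; ring
    have := wdg_le (u0 + t • u1) u1
    rw [e, h2, h1, norm_one, mul_one] at this
    exact this
  have hne : ∀ t : ℂ, u0 + t • u1 ≠ 0 := fun t h => by
    have := hn1 t; rw [h, n2_eq] at this; simp at this; linarith
  have hz : proj (u0 + (0:ℂ) • u1) = z := by rw [zero_smul, add_zero, h3]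
  have hn2 : ∀ t : ℂ, n2 (u0 + t • u1) ≤ n2 u0 + ‖t‖ := fun t => by
    have := n2_add u0 (t • u1); rwa [n2_smul, h1, mul_one] at this
  have hu0 : 1 ≤ n2 u0 := by have := hn1 0; rwa [zero_smul, add_zero] at this
  have hu00 : 0 < n2 u0 := by linarith
  have hsg : ∀ t t' : ℂ, ‖t - t'‖ = sg (proj (u0 + t • u1)) (proj (u0 + t' • u1)) * (n2 (u0 + t • u1) * n2 (u0 + t' • u1)) := fun t t' => by
    have := hn1 t
    have := hn1 t'
    rw [sg_proj (hne t) (hne t'), hw, norm_sub_rev, div_mul_cancel₀ _ (by positivity)]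
  have hlip : Continuous fun t : ℂ => proj (u0 + t • u1) := by
    refine (LipschitzWith.of_dist_le_mul (K := 1) fun t t' => ?_).continuous
    rw [sph_dist, NNReal.coe_one, one_mul, dist_eq_norm, hsg]
    exact le_mul_of_one_le_right (sg_nonneg _ _) (by nlinarith [hn1 t, hn1 t'])
  obtain ⟨δ, hδ, hδU⟩ := (nhds_sph z).mem_iff.1 hU
  set ρ := min 1 (δ / 2) with hρ
  have hρ0 : 0 < ρ := by positivity
  have hu1z : 0 < sg (proj u1) z := by
    rw [← h3, sg_proj (fun h => by rw [h, n2_eq] at h1; simp at h1) (fun h => by rw [h, n2_eq] at hu0; simp at hu0; linarith),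
      wdg_comm, h2, h1, norm_one]
    positivity
  have hsm : ∀ y, sg y z < min (sg (proj u1) z) (min (1 / (2 * n2 u0)) (ρ / (4 * n2 u0 ^ 2))) → ∃ t : ℂ, ‖t‖ < ρ / 2 ∧ proj (u0 + t • u1) = y := fun y hy => by
    obtain ⟨a1, a2, a3⟩ : _ ∧ _ ∧ _ := by simpa only [lt_min_iff] using hy
    have hdec : lft y = wdg (lft y) u1 • u0 + wdg u0 (lft y) • u1 := by
      have e1 : (wdg (lft y) u1 • u0 + wdg u0 (lft y) • u1) = wdg u0 u1 • lft y := by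
        ext <;> simp [wdg] <;> ring
      rw [e1, h2, one_smul]
    set α := wdg (lft y) u1
    set β := wdg u0 (lft y)
    have hα : α ≠ 0 := fun h => by
      rw [h, zero_smul, zero_add] at hdec
      have hβ : β ≠ 0 := fun h' => lft_ne y (by rw [hdec, h', zero_smul])
      have : y = proj u1 := by rw [← proj_lft y, hdec, proj_smul hβ]
      rw [this] at a1; exact lt_irrefl _ a1
    have hy2 : proj (u0 + (β / α) • u1) = y := by
      rw [← proj_smul hα, smul_add, smul_smul, mul_div_cancel₀ _ hα, ← hdec, proj_lft]
    refine ⟨β / α, ?_, hy2⟩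
    have b1 := hsg (β / α) 0
    rw [hy2, hz, sub_zero, zero_smul, add_zero] at b1
    have b2 := hn2 (β / α)
    rw [lt_div_iff₀ (by positivity)] at a2 a3
    have b0 := sg_nonneg y z
    have b3 : ‖β / α‖ ≤ sg y z * ((n2 u0 + ‖β / α‖) * n2 u0) := by
      refine b1.le.trans ?_
      exact mul_le_mul_of_nonneg_left (mul_le_mul_of_nonneg_right b2 hu00.le) b0
    have := norm_nonneg (β / α)
    nlinarith
  refine ⟨u0, u1, ρ, (n2 u0 + 1) ^ 2, min (sg (proj u1) z) (min (1 / (2 * n2 u0)) (ρ / (4 * n2 u0 ^ 2))), hρ0, lt_min hu1z (lt_min (by positivity) (by positivity)), by positivity, hne, hlip, fun t ht => hδU ?_, fun y y' hy hy' => ?_⟩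
  · change sg _ z < δ
    have b1 := hsg t 0
    rw [hz, sub_zero, zero_smul, add_zero] at b1
    have b0 := sg_nonneg (proj (u0 + t • u1)) z
    have b2 : 1 ≤ n2 (u0 + t • u1) * n2 u0 := by nlinarith [hn1 t]
    have b3 : sg (proj (u0 + t • u1)) z ≤ ‖t‖ := by rw [b1]; exact le_mul_of_one_le_right b0 b2
    have := min_le_right 1 (δ / 2)
    linarith
  · obtain ⟨t, ht, rfl⟩ := hsm y hy
    obtain ⟨t', ht', rfl⟩ := hsm y' hy'
    refine ⟨t, t', ht, ht', rfl, rfl, ?_⟩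
    have b0 := sg_nonneg (proj (u0 + t • u1)) (proj (u0 + t' • u1))
    have := min_le_left 1 (δ / 2)
    rw [hsg, mul_comm, sq]
    refine mul_le_mul_of_nonneg_right (mul_le_mul ((hn2 t).trans (by linarith)) ((hn2 t').trans (by linarith)) (n2_nonneg _) (by positivity)) b0

def Fw (p q : Fin N → ℂ[X]) (w : ℕ → Fin N) : ℕ → ℂ × ℂ → ℂ × ℂ
  | 0 => id
  | n + 1 => fun u => FF (p (w n)) (q (w n)) (Fw p q w n u)

section
variable {p q : Fin N → ℂ[X]} (hg : Good p q)

lemma Fw_diff (w : ℕ → Fin N) (n : ℕ) : Differentiable ℂ (Fw p q w n) := by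
  induction n with
  | zero => exact differentiable_id
  | succ n ih => exact ((differentiable_homP _ _).comp ih).prodMk ((differentiable_homP _ _).comp ih)

include hg
lemma Fw_proj (w : ℕ → Fin N) (n : ℕ) {u : ℂ × ℂ} (hu : u ≠ 0) :
    Fw p q w n u ≠ 0 ∧ proj (Fw p q w n u) = itComp p q w n (proj u) := by
  induction n with
  | zero => exact ⟨hu, rfl⟩
  | succ n ih =>
    refine ⟨FF_ne (hg.2.1 _) (hg.2.2.1 _) ih.1, ?_⟩
    rw [itComp, Function.comp, ← ih.2, ratEval_proj (hg.2.1 _) (hg.2.2.1 _) ih.1]; rfl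

lemma julia_sub (hA1 : NoSuperAttract p q) {S : Set (SymX N)} (hS : IsClosed S) (hS0 : S.Nonempty)
    (hSJ : S ⊆ juliaSet p q) (hb : ∀ y, Tmap p q y ∈ S → y ∈ S) : juliaSet p q ⊆ S := by
  have hbn : ∀ n y, (Tmap p q)^[n] y ∈ S → y ∈ S := fun n => by
    induction n with
    | zero => exact fun y h => h
    | succ n ih => exact fun y h => hb y (ih _ h)
  refine closure_minimal (Set.iUnion_subset fun w => ?_) hS
  rintro ⟨w', z⟩ ⟨hw', hz⟩
  obtain rfl : w' = w := hw'
  by_contra hout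
  apply hz
  obtain ⟨x0, hx0⟩ := hS0
  obtain ⟨W, hW, U, hU, hWU⟩ := mem_nhds_prod_iff.1 (hS.isOpen_compl.mem_nhds hout)
  rw [nhds_pi, Filter.mem_pi] at hW
  obtain ⟨I, hI, τ, hτ, hIW⟩ := hW
  obtain ⟨k, hk⟩ := hI.bddAbove
  have hWk : ∀ v : ℕ → Fin N, (∀ i ≤ k, v i = w' i) → v ∈ W := fun v hv => hIW fun i hi => by
    rw [hv i (hk hi)]; exact mem_of_mem_nhds (hτ i)
  obtain ⟨u0, u1, ρ, c, ε, hρ, hε, hc, hne, hχ, hρU, hsur⟩ := chart hU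
  obtain ⟨C, hC⟩ := low_nb hg hA1
  set L := 2 * (Real.exp C / (ρ / 3)) with hL
  have hcl : IsClosed (Prod.snd '' S) := (hS.isCompact.image continuous_snd).isClosed
  have key : ∀ n ≥ k + 1, ∀ t t' : ℂ, ‖t‖ < ρ / 2 → ‖t'‖ < ρ / 2 →
      sg (itComp p q w' n (proj (u0 + t • u1))) (itComp p q w' n (proj (u0 + t' • u1))) ≤ L * ‖t - t'‖ := fun n hn t t' ht ht' => by
    have hout2 : ∀ b ∈ U, itComp p q w' n b ∉ Prod.snd '' S := by
      rintro b hbU ⟨Y, hY, hYe⟩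
      refine hWU (Set.mk_mem_prod (hWk (fun i => if i < n then w' i else Y.1 (i - n)) fun i hi => if_pos (by omega)) hbU) (hbn n _ ?_)
      rw [Titer]
      convert hY using 1
      refine Prod.ext (funext fun i => ?_) ?_
      · simp
      · rw [hYe]
        exact congrFun (itComp_congr p q fun i hi => if_pos hi) b
    have hcont : Continuous fun t : ℂ => itComp p q w' n (proj (u0 + t • u1)) := by
      exact (itComp_cont hg w' n).comp hχ
    obtain ⟨m, hm⟩ := hC x0 (hSJ hx0) _ hcl (fun m Y hY => ⟨Y, hbn m Y (by rw [(mem_preimTn hg).1 hY]; exact hx0), rfl⟩)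
      ((fun t : ℂ => itComp p q w' n (proj (u0 + t • u1))) '' Metric.closedBall 0 ρ) ((isCompact_closedBall _ _).image hcont)
      (by rintro _ ⟨t, ht, rfl⟩; exact hout2 _ (hρU t (by simpa using ht)))
    have hm := hm m le_rfl
    have hp : ∀ t : ℂ, Fw p q w' n (u0 + t • u1) ≠ 0 ∧ proj (Fw p q w' n (u0 + t • u1)) = itComp p q w' n (proj (u0 + t • u1)) :=
      fun t => Fw_proj hg w' n (hne t)
    have hcard : (((preimTn p q m x0).map Prod.snd).card : ℝ) = (Dtot p q : ℝ) ^ m := by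
      rw [Multiset.card_map, card_preimTn hg]; push_cast; rfl
    have hD := D_pos hg
    have := hol_lip (F := fun t => Fw p q w' n (u0 + t • u1)) ((Fw_diff w' n).comp (by fun_prop)) hρ (fun t _ => (hp t).1)
      (s := (preimTn p q m x0).map Prod.snd) (C := C) (by
        intro h; rw [h] at hcard; have := pow_pos hD m; simp at hcard; linarith) (fun t ht y hy => ?_) (fun t ht => ?_)
      (t := t) (t' := t') (by simpa using ht) (by simpa using ht')
    · rwa [(hp t).2, (hp t').2] at this
    · rw [(hp t).2]
      intro h
      obtain ⟨Y, hY, rfl⟩ := Multiset.mem_map.1 hy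
      exact hout2 _ (hρU t (by simpa using Metric.ball_subset_closedBall ht)) ⟨Y, hbn m Y (by rw [(mem_preimTn hg).1 hY]; exact hx0), h.symm⟩
    · have := hm _ ⟨t, Metric.ball_subset_closedBall ht, rfl⟩
      rw [GXn_apply] at this
      rw [hcard, (hp t).2, Multiset.map_map]
      exact this
  have hK : IsCompact {y : Sphere | sg y z ≤ ε / 2} := (isClosed_le (continuous_sg_left z) continuous_const).isCompact
  refine ⟨{y | sg y z < ε / 2}, isOpen_lt (continuous_sg_left z) continuous_const, by simpa using hε, ?_⟩
  have hnorm := normal_of_lip (f := itComp p q w') (fun n => itComp_cont hg w' n) hK (k := k + 1) (L := L * c) (fun n hn y hy y' hy' => by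
    have hy : sg y z ≤ ε / 2 := hy
    have hy' : sg y' z ≤ ε / 2 := hy'
    obtain ⟨t, t', ht, ht', rfl, rfl, h⟩ := hsur y y' (by linarith) (by linarith)
    refine (key n hn t t' ht ht').trans ?_
    have hL0 : 0 ≤ L := by positivity
    rw [mul_assoc L]
    exact mul_le_mul_of_nonneg_left h hL0)
  intro s hs
  obtain ⟨φ, hφ, g, hgK⟩ := hnorm s hs
  exact ⟨φ, hφ, g, fun K hKU => hgK K (hKU.trans fun y (hy : sg y z < ε / 2) => hy.le)⟩
end

end

theorem equidistribution_of_preimages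
    (hg : Good p q) (hA1 : NoSuperAttract p q) :
    ∃ μ : Measure (SymX N), IsProbabilityMeasure μ ∧
      {x : SymX N | ∀ U : Set (SymX N), IsOpen U → x ∈ U → 0 < μ U} = juliaSet p q ∧
      ∀ x ∈ juliaSet p q, ∀ g : C(SymX N, ℝ),
        Tendsto (fun n : ℕ =>
            ((Dtot p q : ℝ) ^ n)⁻¹ * ((preimTn p q n x).map fun y => g y).sum)
          atTop (𝓝 (∫ y, g y ∂μ)) := by
  obtain ⟨μ, h1, h2, S, hS, h3, h4, h5, h6⟩ := T3 hg hA1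
  refine ⟨μ, h1, ?_, fun x hx g => ?_⟩
  · rw [← hS]
    exact Set.Subset.antisymm h3 (julia_sub hg hA1 h4 h5 h3 h6)
  · exact (h2 x hx g).congr fun n => GXn_apply n _ x

end SkewRational
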